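/- Let u_ε be a sequence of stable solutions of (E_ε) with u_ε − 2 ln ε bounded above away from Z₂, and suppose either w_ε := u_ε − 2 ln ε → w in C²_loc(Ω∖Z₂) with Δw + e^w/τ³ = 4π Σ_j m_{j,1} δ_{p_{j,1}} + 4π Σ_j β_{j,2} δ_{p_{j,2}}, or w_ε − w_ε(x₀) → g in C²_loc(Ω∖Z₂) with Δg = 4π Σ_j m_{j,1} δ_{p_{j,1}} + 4π Σ_j β_{j,2} δ_{p_{j,2}}. Fix p = p_{j,2} ∈ Z₂, set û_ε(x) := u_ε(εx) in local coordinates, and assume lim_{ε→0} sup_{|x−p|=η} û_ε(x) = −∞ for every η > 0. Then lim_{ε→0} sup_{η ≤ |x−p| ≤ r/ε} û_ε(x) = −∞ for all small η, r > 0, and m_{j,2} + β_{j,2} = 0. -/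

import Mathlib

open MeasureTheory Real Filter Set Metric Topology

noncomputable section

/-- The Euclidean plane `ℝ²`. -/
abbrev Pl := EuclideanSpace ℝ (Fin 2)

/-- The unit lattice `ℤ² ⊆ ℝ²`; the flat 2-torus `Ω` is its quotient, which we model by
working with doubly periodic functions on the plane. -/
def unitLattice : Set Pl :=
  {v | ∃ a b : ℤ, v = (a : ℝ) • EuclideanSpace.single 0 (1:ℝ) +
      (b : ℝ) • EuclideanSpace.single 1 (1:ℝ)}

/-- A fundamental domain for the torus `Ω` (of total area `|Ω| = 1`). -/
def fund : Set Pl := {x | x 0 ∈ Ico (0:ℝ) 1 ∧ x 1 ∈ Ico (0:ℝ) 1}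

/-- A doubly periodic function on the plane, i.e. a function on the torus `Ω`. -/
def Periodic2 (u : Pl → ℝ) : Prop := ∀ x : Pl, ∀ v ∈ unitLattice, u (x + v) = u x

/-- Partial derivative in the `i`-th coordinate direction. -/
def pd (u : Pl → ℝ) (i : Fin 2) : Pl → ℝ :=
  fun x => lineDeriv ℝ u x (EuclideanSpace.single i (1:ℝ))

/-- The Laplacian `Δu`. -/
def lap (u : Pl → ℝ) (x : Pl) : ℝ := pd (pd u 0) 0 x + pd (pd u 1) 1 x

/-- `|∇u|²`. -/
def gradSq (u : Pl → ℝ) (x : Pl) : ℝ := (pd u 0 x) ^ 2 + (pd u 1 x) ^ 2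

/-- The nonlinearity `f_τ(t) = e^t (1 − e^t) / (τ + e^t)³`. -/
def fτ (τ t : ℝ) : ℝ := exp t * (1 - exp t) / (τ + exp t) ^ 3

/-- `f_τ'(t) = e^t (τ − 2(τ+1) e^t + e^{2t}) / (τ + e^t)⁴`. -/
def fτ' (τ t : ℝ) : ℝ := exp t * (τ - 2 * (τ + 1) * exp t + exp (2 * t)) / (τ + exp t) ^ 4

/-- The antiderivative `F_{2,τ}(t) = e^t ((1−τ) e^t + 2τ) / (2τ² (τ+e^t)²)` of `f_τ`. -/
def F2τ (τ t : ℝ) : ℝ := exp t * ((1 - τ) * exp t + 2 * τ) / (2 * τ ^ 2 * (τ + exp t) ^ 2)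

/-- `u − 2a ln‖· − p‖` extends smoothly across `p`: this encodes the distributional
equation `Δu = 4πa δ_p + (smooth)` near `p`. -/
def LogSing (u : Pl → ℝ) (p : Pl) (a : ℝ) : Prop :=
  ∃ r > 0, ∃ v : Pl → ℝ, ContDiffOn ℝ (⊤ : ℕ∞) v (ball p r) ∧
    ∀ x ∈ ball p r, x ≠ p → u x = 2 * a * Real.log ‖x - p‖ + v x

/-- The vortex data: distinct points `p_{j,1}` (`1 ≤ j ≤ d₁`), `p_{j,2}` (`1 ≤ j ≤ d₂`)
of the torus with multiplicities `m_{j,1} ≥ 0`, `m_{j,2} ≥ 0`. -/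
structure VortexData where
  d₁ : ℕ
  d₂ : ℕ
  p₁ : Fin d₁ → Pl
  p₂ : Fin d₂ → Pl
  m₁ : Fin d₁ → ℝ
  m₂ : Fin d₂ → ℝ
  m₁_nonneg : ∀ j, 0 ≤ m₁ j
  m₂_nonneg : ∀ j, 0 ≤ m₂ j
  distinct : ∀ i j : Fin d₁ ⊕ Fin d₂, i ≠ j → ∀ v ∈ unitLattice,
      Sum.elim p₁ p₂ i ≠ Sum.elim p₁ p₂ j + v

namespace VortexData
variable (V : VortexData)

/-- The set `Z₁` of vortex points `p_{j,1}` (viewed in the plane: all lattice translates). -/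
def Z1 : Set Pl := {x | ∃ j v, v ∈ unitLattice ∧ x = V.p₁ j + v}

/-- The set `Z₂` of vortex points `p_{j,2}` (viewed in the plane: all lattice translates). -/
def Z2 : Set Pl := {x | ∃ j v, v ∈ unitLattice ∧ x = V.p₂ j + v}

/-- The full vortex set `Z = Z₁ ∪ Z₂`. -/
def Z : Set Pl := V.Z1 ∪ V.Z2

/-- `N₁ = Σ_j m_{j,1}`. -/
def N1 : ℝ := ∑ j, V.m₁ j

/-- `N₂ = Σ_j m_{j,2}`. -/
def N2 : ℝ := ∑ j, V.m₂ j

end VortexData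

/-- `u` is a solution of `(E_ε)`:
`Δu + ε⁻² f_τ(u) = 4π Σ_j m_{j,1} δ_{p_{j,1}} − 4π Σ_j m_{j,2} δ_{p_{j,2}}` on `Ω`,
formulated classically: `u` is doubly periodic, smooth away from `Z`, solves the PDE
classically off `Z`, and has the prescribed logarithmic singularities at the vortices. -/
structure IsSolution (V : VortexData) (τ ε : ℝ) (u : Pl → ℝ) : Prop where
  periodic : Periodic2 u
  smooth : ContDiffOn ℝ (⊤ : ℕ∞) u (V.Z)ᶜ
  pde : ∀ x ∉ V.Z, lap u x + (ε ^ 2)⁻¹ * fτ τ (u x) = 0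
  sing₁ : ∀ j, LogSing u (V.p₁ j) (V.m₁ j)
  sing₂ : ∀ j, LogSing u (V.p₂ j) (-(V.m₂ j))

/-- The quadratic form `∫_Ω |∇φ|² − ε⁻² f_τ'(u) φ²` of the linearized operator at `u`. -/
def QuadForm (τ ε : ℝ) (u φ : Pl → ℝ) : ℝ :=
  ∫ x in fund, (gradSq φ x - (ε ^ 2)⁻¹ * fτ' τ (u x) * (φ x) ^ 2)

/-- `u` is a stable solution: the first eigenvalue `μ_ε` of the linearized operator is
nonnegative, i.e. the quadratic form is nonnegative on all (smooth, doubly periodic)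
test functions. -/
def Stable (τ ε : ℝ) (u : Pl → ℝ) : Prop :=
  ∀ φ : Pl → ℝ, ContDiff ℝ (⊤ : ℕ∞) φ → Periodic2 φ → 0 ≤ QuadForm τ ε u φ

/-- `u` is strictly stable: the first eigenvalue `μ_ε` of the linearized operator is
strictly positive. -/
def StrictlyStable (τ ε : ℝ) (u : Pl → ℝ) : Prop :=
  ∃ μ > 0, ∀ φ : Pl → ℝ, ContDiff ℝ (⊤ : ℕ∞) φ → Periodic2 φ →
    μ * (∫ x in fund, (φ x) ^ 2) ≤ QuadForm τ ε u φ

/-- `u_n → w` in `C²_loc(s)`: locally uniform convergence of the functions and of their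
first and second partial derivatives on `s`. -/
def TendstoC2LocOn (u : ℕ → Pl → ℝ) (w : Pl → ℝ) (s : Set Pl) : Prop :=
  TendstoLocallyUniformlyOn u w atTop s ∧
  (∀ i : Fin 2, TendstoLocallyUniformlyOn (fun n => pd (u n) i) (pd w i) atTop s) ∧
  (∀ i j : Fin 2, TendstoLocallyUniformlyOn
      (fun n => pd (pd (u n) i) j) (pd (pd w i) j) atTop s)

/-- Case 1 of the hypotheses: `w_ε = u_ε − 2 ln ε → w` in `C²_loc(Ω∖Z₂)`, where `w` solves
`Δw + e^w/τ³ = 4π Σ_j m_{j,1} δ_{p_{j,1}} + 4π Σ_j β_{j,2} δ_{p_{j,2}}` on `Ω`. -/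
def Case1 (V : VortexData) (τ : ℝ) (ε : ℕ → ℝ) (u : ℕ → Pl → ℝ)
    (β : Fin V.d₂ → ℝ) (w : Pl → ℝ) : Prop :=
  TendstoC2LocOn (fun n x => u n x - 2 * Real.log (ε n)) w (V.Z2)ᶜ ∧
  Periodic2 w ∧ ContDiffOn ℝ (⊤ : ℕ∞) w (V.Z)ᶜ ∧
  (∀ x ∉ V.Z, lap w x + Real.exp (w x) / τ ^ 3 = 0) ∧
  (∀ j, LogSing w (V.p₁ j) (V.m₁ j)) ∧ (∀ j, LogSing w (V.p₂ j) (β j))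

/-- Case 2 of the hypotheses: `w_ε − w_ε(x₀) → g` in `C²_loc(Ω∖Z₂)` for a fixed
`x₀ ∈ Ω∖Z`, where `Δg = 4π Σ_j m_{j,1} δ_{p_{j,1}} + 4π Σ_j β_{j,2} δ_{p_{j,2}}` on `Ω`. -/
def Case2 (V : VortexData) (u : ℕ → Pl → ℝ) (β : Fin V.d₂ → ℝ)
    (x₀ : Pl) (g : Pl → ℝ) : Prop :=
  x₀ ∉ V.Z ∧
  TendstoC2LocOn (fun n x => u n x - u n x₀) g (V.Z2)ᶜ ∧
  Periodic2 g ∧ ContDiffOn ℝ (⊤ : ℕ∞) g (V.Z)ᶜ ∧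
  (∀ x ∉ V.Z, lap g x = 0) ∧
  (∀ j, LogSing g (V.p₁ j) (V.m₁ j)) ∧ (∀ j, LogSing g (V.p₂ j) (β j))

/-! ### Basic calculus with `pd` -/

abbrev ee (i : Fin 2) : Pl := EuclideanSpace.single i (1:ℝ)

lemma HasFDerivAt.pd_eq {u : Pl → ℝ} {L : Pl →L[ℝ] ℝ} {x : Pl} (h : HasFDerivAt u L x) (i : Fin 2) :
    pd u i x = L (ee i) := (h.hasLineDerivAt (ee i)).lineDeriv

lemma pd_eq_fderiv {u : Pl → ℝ} {x : Pl} (h : DifferentiableAt ℝ u x) (i : Fin 2) :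
    pd u i x = fderiv ℝ u x (ee i) := h.hasFDerivAt.pd_eq i

lemma pd_congr {u v : Pl → ℝ} {x : Pl} (h : u =ᶠ[𝓝 x] v) (i : Fin 2) : pd u i x = pd v i x :=
  h.lineDeriv_eq

lemma pd_congr' {u v : Pl → ℝ} {x : Pl} (h : u =ᶠ[𝓝 x] v) (i : Fin 2) :
    pd u i =ᶠ[𝓝 x] pd v i := by
  filter_upwards [h.eventually_nhds] with y hy using pd_congr hy i

lemma lap_congr {u v : Pl → ℝ} {x : Pl} (h : u =ᶠ[𝓝 x] v) : lap u x = lap v x := by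
  unfold lap
  rw [pd_congr (pd_congr' h 0), pd_congr (pd_congr' h 1)]

lemma pd_add {u v : Pl → ℝ} {x : Pl} (hu : DifferentiableAt ℝ u x) (hv : DifferentiableAt ℝ v x)
    (i : Fin 2) : pd (fun y => u y + v y) i x = pd u i x + pd v i x := by
  have h : HasFDerivAt (fun y => u y + v y) (fderiv ℝ u x + fderiv ℝ v x) x :=
    hu.hasFDerivAt.add hv.hasFDerivAt
  rw [h.pd_eq, pd_eq_fderiv hu, pd_eq_fderiv hv]; rfl

lemma pd_mul {u v : Pl → ℝ} {x : Pl} (hu : DifferentiableAt ℝ u x) (hv : DifferentiableAt ℝ v x)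
    (i : Fin 2) : pd (fun y => u y * v y) i x = pd u i x * v x + u x * pd v i x := by
  have h : HasFDerivAt (fun y => u y * v y) (u x • fderiv ℝ v x + v x • fderiv ℝ u x) x :=
    hu.hasFDerivAt.mul hv.hasFDerivAt
  rw [h.pd_eq, pd_eq_fderiv hu, pd_eq_fderiv hv]
  simp; ring

lemma pd_const_mul {v : Pl → ℝ} {x : Pl} (c : ℝ) (hv : DifferentiableAt ℝ v x)
    (i : Fin 2) : pd (fun y => c * v y) i x = c * pd v i x := by
  rw [(hv.hasFDerivAt.const_mul c : HasFDerivAt (fun y => c * v y) _ x).pd_eq, pd_eq_fderiv hv]; rfl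

lemma pd_const_add (v : Pl → ℝ) (x : Pl) (c : ℝ) 
    (i : Fin 2) : pd (fun y => c + v y) i x = pd v i x := by
  simp [pd, lineDeriv]

lemma pd_sub_const (v : Pl → ℝ) (c : ℝ) 
    (i : Fin 2) : pd (fun y => v y - c) i = pd v i := by
  funext x; simp [pd, lineDeriv]

lemma pd_comp {g : ℝ → ℝ} {g' : ℝ} {v : Pl → ℝ} {x : Pl} (hv : DifferentiableAt ℝ v x)
    (hg : HasDerivAt g g' (v x)) (i : Fin 2) :
    pd (fun y => g (v y)) i x = g' * pd v i x := by
  have h : HasFDerivAt (fun y => g (v y)) (g' • fderiv ℝ v x) x :=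
    hg.comp_hasFDerivAt x hv.hasFDerivAt
  rw [h.pd_eq, pd_eq_fderiv hv]; rfl

lemma pd_translate (u : Pl → ℝ) (p : Pl) (i : Fin 2) :
    pd (fun y => u (p + y)) i = fun y => pd u i (p + y) := by
  funext y; simp [pd, lineDeriv, add_assoc]

lemma lap_translate (u : Pl → ℝ) (p y : Pl) :
    lap (fun y => u (p + y)) y = lap u (p + y) := by
  simp only [lap, pd_translate]

lemma hasFDerivAt_coord (i : Fin 2) (x : Pl) :
    HasFDerivAt (fun y : Pl => y i) (EuclideanSpace.proj i : Pl →L[ℝ] ℝ) x :=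
  (EuclideanSpace.proj i : Pl →L[ℝ] ℝ).hasFDerivAt

lemma pd_coord (i j : Fin 2) (x : Pl) : pd (fun y => y i) j x = if i = j then 1 else 0 := by
  rw [(hasFDerivAt_coord i x).pd_eq]; simp [ee, EuclideanSpace.proj]

lemma smooth_coord (i : Fin 2) : ContDiff ℝ (⊤ : ℕ∞) (fun y : Pl => y i) :=
  (EuclideanSpace.proj i : Pl →L[ℝ] ℝ).contDiff

lemma smooth_pd {V : Pl → ℝ} (hV : ContDiff ℝ (⊤ : ℕ∞) V) (i : Fin 2) :
    ContDiff ℝ (⊤ : ℕ∞) (pd V i) := by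
  have h1 : pd V i = fun x => fderiv ℝ V x (ee i) := by
    funext x; exact pd_eq_fderiv (hV.differentiable (by simp) x) i
  rw [h1]
  have h2 := hV.fderiv_right (m := (⊤ : ℕ∞)) (by simp)
  exact h2.clm_apply contDiff_const

lemma contDiffOn_pd {V : Pl → ℝ} {s : Set Pl} (hs : IsOpen s) (hV : ContDiffOn ℝ (⊤ : ℕ∞) V s)
    (i : Fin 2) : ContDiffOn ℝ (⊤ : ℕ∞) (pd V i) s := by
  have h2 := hV.fderiv_of_isOpen (m := (⊤ : ℕ∞)) hs (by simp)
  have h3 : ContDiffOn ℝ (⊤ : ℕ∞) (fun x => fderiv ℝ V x (ee i)) s := h2.clm_apply contDiffOn_const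
  refine h3.congr fun x hx => ?_
  exact pd_eq_fderiv ((hV.contDiffAt (hs.mem_nhds hx)).differentiableAt (by simp)) i

lemma pd_comm {V : Pl → ℝ} (hV : ContDiff ℝ (⊤ : ℕ∞) V) (i j : Fin 2) (x : Pl) :
    pd (pd V i) j x = pd (pd V j) i x := by
  have h1 : ∀ i, pd V i = fun x => fderiv ℝ V x (ee i) := fun i => by
    funext x; exact pd_eq_fderiv (hV.differentiable (by simp) x) i
  have hd : DifferentiableAt ℝ (fderiv ℝ V) x :=
    (hV.fderiv_right (m := (⊤ : ℕ∞)) (by simp)).differentiable (by simp) x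
  have h2 : ∀ i j, pd (pd V i) j x = fderiv ℝ (fderiv ℝ V) x (ee j) (ee i) := fun i j => by
    rw [h1 i, pd_eq_fderiv (hd.clm_apply (differentiableAt_const _)), fderiv_clm_apply hd (differentiableAt_const _)]
    simp
  rw [h2, h2]
  exact (hV.contDiffAt.isSymmSndFDerivAt (by simp only [minSmoothness_of_isRCLikeNormedField]; exact WithTop.coe_le_coe.2 (le_top : (2:ℕ∞) ≤ ⊤))) _ _

lemma pl_norm_sq (y : Pl) : ‖y‖ ^ 2 = y 0 ^ 2 + y 1 ^ 2 := by
  rw [EuclideanSpace.norm_sq_eq]; simp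

lemma abs_coord_le (y : Pl) (i : Fin 2) : |y i| ≤ ‖y‖ := by
  simpa using PiLp.norm_apply_le y i

lemma hasFDerivAt_log_norm {y : Pl} (hy : y ≠ 0) :
    HasFDerivAt (fun y : Pl => Real.log ‖y‖)
      ((‖y‖ ^ 2)⁻¹ • (innerSL ℝ y : Pl →L[ℝ] ℝ)) y := by
  have h1 : HasFDerivAt (fun y : Pl => ‖y‖ ^ 2) (2 • (innerSL ℝ y : Pl →L[ℝ] ℝ)) y := (hasStrictFDerivAt_norm_sq y).hasFDerivAt
  have hn : ‖y‖ ^ 2 ≠ 0 := by simpa using hy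
  have h2 := (h1.log hn).const_mul (1/2 : ℝ)
  have h3 : (fun y : Pl => Real.log ‖y‖) = fun y => (1/2:ℝ) * Real.log (‖y‖^2) := by
    funext z; rw [Real.log_pow]; push_cast; ring
  rw [h3]
  have h4 : ((‖y‖ ^ 2)⁻¹ • (innerSL ℝ y : Pl →L[ℝ] ℝ)) =
      (1 / 2 : ℝ) • (‖y‖ ^ 2)⁻¹ • 2 • (innerSL ℝ y : Pl →L[ℝ] ℝ) := by
    ext z; simp; ring
  rw [h4]; exact h2

lemma pd_log_norm {y : Pl} (hy : y ≠ 0) (i : Fin 2) :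
    pd (fun y : Pl => Real.log ‖y‖) i y = y i / ‖y‖ ^ 2 := by
  rw [(hasFDerivAt_log_norm hy).pd_eq]
  simp [ee, EuclideanSpace.inner_single_right]; ring

lemma contDiffAt_log_norm {y : Pl} (hy : y ≠ 0) :
    ContDiffAt ℝ (⊤ : ℕ∞) (fun y : Pl => Real.log ‖y‖) y :=
  (contDiffAt_norm ℝ hy).log (by simpa using hy)

lemma lap_log_norm {y : Pl} (hy : y ≠ 0) : lap (fun y : Pl => Real.log ‖y‖) y = 0 := by
  have key : ∀ i : Fin 2, pd (pd (fun y : Pl => Real.log ‖y‖) i) i y =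
      (‖y‖^2)⁻¹ - 2 * (y i)^2 / (‖y‖^2)^2 := by
    intro i
    have h1 : pd (fun y : Pl => Real.log ‖y‖) i =ᶠ[𝓝 y] fun y => y i * (‖y‖^2)⁻¹ := by
      filter_upwards [isOpen_ne.mem_nhds hy] with z hz
      rw [pd_log_norm hz, div_eq_mul_inv]
    rw [pd_congr h1]
    have hn : ‖y‖ ^ 2 ≠ 0 := by simpa using hy
    have hN : HasFDerivAt (fun y : Pl => ‖y‖ ^ 2) (2 • (innerSL ℝ y : Pl →L[ℝ] ℝ)) y := (hasStrictFDerivAt_norm_sq y).hasFDerivAt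
    have hI : HasDerivAt (fun t : ℝ => t⁻¹) (-((‖y‖^2)^2)⁻¹) (‖y‖^2) := hasDerivAt_inv hn
    have hd : DifferentiableAt ℝ (fun y : Pl => (‖y‖^2)⁻¹) y := hN.differentiableAt.inv hn
    rw [pd_mul (hasFDerivAt_coord i y).differentiableAt hd, pd_comp hN.differentiableAt hI, pd_coord, hN.pd_eq]
    simp [ee, EuclideanSpace.inner_single_right]; ring
  unfold lap
  rw [key, key]
  have hn : ‖y‖ ^ 2 ≠ 0 := by simpa using hy
  have := pl_norm_sq y
  field_simp
  nlinarith

/-! ### Integration lemmas -/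

lemma ae_ne_zero_pl : ∀ᵐ y : Pl, y ≠ 0 := by
  have : (volume : Measure Pl) {0} = 0 := measure_singleton 0
  rw [ae_iff]; simpa using this

lemma pd_eq_zero_of_notMem {g : Pl → ℝ} {r : ℝ} (hg : ∀ y, r < ‖y‖ → g y = 0) (i : Fin 2) {y : Pl}
    (hy : r < ‖y‖) : pd g i y = 0 := by
  have : g =ᶠ[𝓝 y] fun _ => (0:ℝ) := by
    filter_upwards [(isOpen_lt continuous_const continuous_norm).mem_nhds hy] with z hz using hg z hz
  rw [pd_congr this]; simp [pd, lineDeriv]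

lemma ibp0 {g : Pl → ℝ} {r : ℝ} (hc : Continuous g) (hs : ∀ y, r < ‖y‖ → g y = 0)
    (hd : ∀ y, y ≠ 0 → DifferentiableAt ℝ g y) (i : Fin 2) (hi : Integrable (pd g i)) :
    ∫ y, pd g i y = 0 := by
  set R := |r| + 1 with hR
  have hR0 : 0 < R := by positivity
  have hrR : r < R := by have := le_abs_self r; linarith
  let T : (Fin 2 → ℝ) → Pl := WithLp.toLp 2
  let eL : (Fin 2 → ℝ) ≃L[ℝ] Pl := (EuclideanSpace.equiv (Fin 2) ℝ).symm
  have heT : ∀ x, eL x = T x := fun x => rfl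
  have hmp : MeasurePreserving T := PiLp.volume_preserving_toLp (Fin 2)
  have hme : MeasurableEmbedding T := (MeasurableEquiv.toLp 2 (Fin 2 → ℝ)).measurableEmbedding
  rw [← hmp.integral_comp hme]
  have hi' : Integrable (fun x => pd g i (T x)) := (hmp.integrable_comp_emb hme).2 hi
  let a : Fin 2 → ℝ := fun _ => -R
  let b : Fin 2 → ℝ := fun _ => R
  have hle : a ≤ b := fun _ => by simp [a, b]; linarith
  have hT : Continuous T := eL.continuous
  have hnorm : ∀ x j, |x j| ≤ ‖T x‖ := fun x j => abs_coord_le (T x) j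
  have hdG : ∀ x, x ≠ 0 → HasFDerivAt (fun x => g (T x)) ((fderiv ℝ g (T x)).comp (eL : (Fin 2 → ℝ) →L[ℝ] Pl)) x := by
    intro x hx
    have hTx : T x ≠ 0 := by
      intro h; exact hx (eL.map_eq_zero_iff.1 h)
    exact HasFDerivAt.comp x (hd _ hTx).hasFDerivAt eL.hasFDerivAt
  have hpd : ∀ x, x ≠ 0 → (∑ j : Fin 2, (if j = i then (fderiv ℝ g (T x)).comp (eL : (Fin 2 → ℝ) →L[ℝ] Pl) else 0) (Pi.single j 1)) = pd g i (T x) := by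
    intro x hx
    have hTx : T x ≠ 0 := by
      intro h; exact hx (eL.map_eq_zero_iff.1 h)
    rw [Finset.sum_eq_single i]
    · simp only [if_true]
      rw [pd_eq_fderiv (hd _ hTx)]
      rfl
    · intro j _ hj; simp [hj]
    · simp
  have hae : ∀ᵐ x : Fin 2 → ℝ, x ≠ 0 := by
    have : (volume : Measure (Fin 2 → ℝ)) {0} = 0 := measure_singleton 0
    rw [ae_iff]; simpa using this
  have hcongr : (fun x => (∑ j : Fin 2, (if j = i then (fderiv ℝ g (T x)).comp (eL : (Fin 2 → ℝ) →L[ℝ] Pl) else 0) (Pi.single j 1))) =ᵐ[volume] fun x => pd g i (T x) := by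
    filter_upwards [hae] with x hx using hpd x hx
  have main := integral_divergence_of_hasFDerivAt_off_countable' a b hle
    (fun j x => if j = i then g (T x) else 0)
    (fun j x => if j = i then (fderiv ℝ g (T x)).comp (eL : (Fin 2 → ℝ) →L[ℝ] Pl) else 0) {0}
    (countable_singleton _) ?_ ?_ ?_
  · have h1 : ∫ x, pd g i (T x) = ∫ x in Icc a b, pd g i (T x) := by
      refine (setIntegral_eq_integral_of_forall_compl_eq_zero fun x hx => ?_).symm
      have : ∃ j, R < |x j| := by
        by_contra hcon
        push Not at hcon
        exact hx ⟨fun j => (abs_le.1 (hcon j)).1, fun j => (abs_le.1 (hcon j)).2⟩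
      obtain ⟨j, hj⟩ := this
      exact pd_eq_zero_of_notMem hs i (hrR.trans (hj.trans_le (hnorm x j)))
    rw [h1, ← setIntegral_congr_ae (g := fun x => pd g i (T x)) measurableSet_Icc (hcongr.mono fun x hx _ => hx), main]
    refine Finset.sum_eq_zero fun j _ => ?_
    by_cases hj : j = i
    · simp only [hj, if_true]
      have z : ∀ (c : ℝ) (x : Fin 1 → ℝ), |c| = R → g (T (i.insertNth c x)) = 0 := by
        intro c x hcR
        refine hs _ (hrR.trans_le ?_)
        have := hnorm (i.insertNth c x) i
        simpa [hcR] using this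
      have z1 := fun x => z R x (abs_of_pos hR0)
      have z2 := fun x => z (-R) x (by rw [abs_neg, abs_of_pos hR0])
      simp [a, b, z1, z2]
    · simp [hj]
  · intro j
    by_cases hj : j = i
    · simp only [hj, if_true]; exact (hc.comp hT).continuousOn
    · simp only [hj, if_false]; exact continuousOn_const
  · intro x hx j
    by_cases hj : j = i
    · simp only [hj, if_true]; exact hdG x hx.2
    · simp only [hj, if_false]; exact hasFDerivAt_const _ _
  · exact (hi'.congr hcongr.symm).integrableOn

/-- bounded, continuous off the origin, zero outside a ball: integrable -/
lemma integ_of {g : Pl → ℝ} {r C : ℝ} (hc : ContinuousOn g {0}ᶜ) (hs : ∀ y, r < ‖y‖ → g y = 0)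
    (hb : ∀ y, y ≠ 0 → |g y| ≤ C) : Integrable g := by
  have hm : AEStronglyMeasurable g volume := by
    have := hc.aestronglyMeasurable (μ := (volume : Measure Pl)) (measurableSet_singleton (0:Pl)).compl
    rwa [restrict_compl_singleton] at this
  have hI : IntegrableOn g (closedBall 0 r) := by
    refine Measure.integrableOn_of_bounded (M := C) measure_closedBall_lt_top.ne hm ?_
    refine ae_restrict_of_ae ?_
    filter_upwards [ae_ne_zero_pl] with y hy using hb y hy
  rw [← integrableOn_univ]
  refine hI.of_forall_sdiff_eq_zero MeasurableSet.univ fun y hy => hs y ?_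
  simpa using hy.2

lemma integ_cont {g : Pl → ℝ} {r : ℝ} (hc : Continuous g) (hs : ∀ y, r < ‖y‖ → g y = 0) :
    Integrable g := by
  refine hc.integrable_of_hasCompactSupport ?_
  refine HasCompactSupport.intro (isCompact_closedBall (0:Pl) r) fun y hy => hs y ?_
  simpa using hy

lemma bdd_of_cont {g : Pl → ℝ} {r : ℝ} (hc : Continuous g) (hs : ∀ y, r < ‖y‖ → g y = 0) :
    ∃ C, ∀ y, |g y| ≤ C := by
  have : HasCompactSupport g := by
    refine HasCompactSupport.intro (isCompact_closedBall (0:Pl) r) fun y hy => hs y ?_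
    simpa using hy
  exact this.exists_bound_of_continuous hc

/-! ### Logarithmic cutoffs -/

/-- derivative of the smooth transition -/
def Sd (t : ℝ) : ℝ := deriv Real.smoothTransition t

lemma S_hasDerivAt (t : ℝ) : HasDerivAt Real.smoothTransition (Sd t) t :=
  ((Real.smoothTransition.contDiff (n := 1)).differentiable (by simp) t).hasDerivAt

lemma Sd_cont : Continuous Sd :=
  (Real.smoothTransition.contDiff (n := 1)).continuous_deriv (by simp)

lemma Sd_nonneg (t : ℝ) : 0 ≤ Sd t := Real.smoothTransition.monotone.deriv_nonneg

lemma Sd_zero_of_nonpos {t : ℝ} (ht : t ≤ 0) : Sd t = 0 := by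
  apply IsLocalMin.deriv_eq_zero
  refine Filter.Eventually.of_forall fun s => ?_
  rw [Real.smoothTransition.zero_of_nonpos ht]; exact Real.smoothTransition.nonneg s

lemma Sd_zero_of_one_le {t : ℝ} (ht : 1 ≤ t) : Sd t = 0 := by
  apply IsLocalMax.deriv_eq_zero
  refine Filter.Eventually.of_forall fun s => ?_
  rw [Real.smoothTransition.one_of_one_le ht]; exact Real.smoothTransition.le_one s

lemma Sd_bdd : ∃ C > 0, ∀ t, Sd t ≤ C := by
  obtain ⟨C, hC⟩ := (isCompact_Icc (a := (0:ℝ)) (b := 1)).exists_bound_of_continuousOn Sd_cont.continuousOn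
  refine ⟨max C 1, by positivity, fun t => ?_⟩
  by_cases h : t ∈ Icc (0:ℝ) 1
  · exact ((le_abs_self _).trans (hC t h)).trans (le_max_left _ _)
  · have : Sd t = 0 := by
      by_cases h0 : t ≤ 0
      · exact Sd_zero_of_nonpos h0
      · apply Sd_zero_of_one_le
        by_contra h1
        exact h ⟨by linarith, by linarith⟩
    rw [this]; positivity

/-- logarithmic variable -/
def Tl (a L : ℝ) (t : ℝ) : ℝ := Real.log (t / a) / L

lemma Tl_nonpos {a L t : ℝ} (ha : 0 < a) (hL : 0 < L) (ht0 : 0 ≤ t) (ht : t ≤ a) : Tl a L t ≤ 0 := by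
  unfold Tl
  have : Real.log (t/a) ≤ 0 := Real.log_nonpos (by positivity) ((div_le_one ha).2 ht)
  exact div_nonpos_of_nonpos_of_nonneg this hL.le

lemma Tl_ge_one {a L t : ℝ} (ha : 0 < a) (hL : 0 < L) (ht : a * Real.exp L ≤ t) : 1 ≤ Tl a L t := by
  unfold Tl
  rw [one_le_div hL, Real.le_log_iff_exp_le, le_div_iff₀ ha]
  · linarith
  · have : 0 < a * Real.exp L := by positivity
    exact div_pos (by linarith) ha

lemma Tl_hasDerivAt {a L t : ℝ} (ha : 0 < a) (ht : t ≠ 0) :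
    HasDerivAt (Tl a L) (1 / (L * t)) t := by
  have h1 : HasDerivAt (fun t : ℝ => t / a) (1 / a) t := (hasDerivAt_id t).div_const a
  have h2 := (h1.log (div_ne_zero ht ha.ne')).div_const L
  refine h2.congr_deriv ?_
  field_simp

lemma radial_int {P P' : ℝ → ℝ} (hP : ∀ t, HasDerivAt P (P' t) t) (hc : Continuous P')
    (h0 : ∀ t ≤ 0, P' t = 0) (h1 : ∀ t ≥ 1, P' t = 0) {a L : ℝ} (ha : 0 < a) (hL : 0 < L) :
    ∫ y : Pl, P' (Tl a L ‖y‖) / (L * ‖y‖ ^ 2) =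
      2 * (volume : Measure Pl).real (ball 0 1) * (P 1 - P 0) := by
  rw [integral_fun_norm_addHaar (volume : Measure Pl) (fun t => P' (Tl a L t) / (L * t ^ 2))]
  have hdim : Module.finrank ℝ Pl = 2 := by simp
  rw [hdim]
  have hab : a ≤ a * Real.exp L := le_mul_of_one_le_right ha.le (Real.one_le_exp hL.le)
  have e1 : ∫ y in Ioi (0:ℝ), y ^ (2-1) • (P' (Tl a L y) / (L * y ^ 2)) =
      ∫ y in Ioc a (a * Real.exp L), P' (Tl a L y) * (1 / (L * y)) := by
    have : ∫ y in Ioi (0:ℝ), y ^ (2-1) • (P' (Tl a L y) / (L * y ^ 2)) =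
      ∫ y in Ioi (0:ℝ), P' (Tl a L y) * (1 / (L * y)) := by
      refine setIntegral_congr_fun measurableSet_Ioi fun y hy => ?_
      have hy' : (0:ℝ) < y := hy
      simp; field_simp
    rw [this]
    refine setIntegral_eq_of_subset_of_forall_sdiff_eq_zero measurableSet_Ioi (fun y hy => ha.trans hy.1) ?_
    intro y hy
    have hy' : (0:ℝ) < y := hy.1
    by_cases hya : y ≤ a
    · rw [h0 _ (Tl_nonpos ha hL hy'.le hya)]; simp
    · have : a * Real.exp L ≤ y := by
        by_contra hcon
        exact hy.2 ⟨not_le.1 hya, (not_le.1 hcon).le⟩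
      rw [h1 _ (Tl_ge_one ha hL this)]; simp
  rw [e1, ← intervalIntegral.integral_of_le hab]
  have hd : ∀ t ∈ uIcc a (a * Real.exp L), HasDerivAt (fun t => P (Tl a L t)) (P' (Tl a L t) * (1 / (L * t))) t := by
    intro t ht
    rw [uIcc_of_le hab] at ht
    exact (hP _).comp t (Tl_hasDerivAt ha (by linarith [ht.1]))
  have hTc : ContinuousOn (Tl a L) (uIcc a (a * Real.exp L)) := fun t ht => by
    rw [uIcc_of_le hab] at ht
    exact (Tl_hasDerivAt ha (by linarith [ht.1])).continuousAt.continuousWithinAt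
  rw [intervalIntegral.integral_eq_sub_of_hasDerivAt hd]
  · have t1 : Tl a L (a * Real.exp L) = 1 := by
      unfold Tl; rw [mul_div_cancel_left₀ _ ha.ne', Real.log_exp, div_self hL.ne']
    have t0 : Tl a L a = 0 := by
      unfold Tl; rw [div_self ha.ne']; simp
    rw [t1, t0]; simp; ring
  · apply ContinuousOn.intervalIntegrable
    refine (hc.comp_continuousOn hTc).mul ?_
    refine ContinuousOn.div continuousOn_const (by fun_prop) fun t ht => ?_
    rw [uIcc_of_le hab] at ht
    have : 0 < t := by linarith [ht.1]
    positivity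

/-- logarithmic cutoff: `1` on `‖y‖ ≤ a`, `0` on `‖y‖ ≥ a e^L`. -/
def cut (a L : ℝ) (y : Pl) : ℝ := 1 - Real.smoothTransition (Tl a L ‖y‖)


lemma cut_one {a L : ℝ} (ha : 0 < a) (hL : 0 < L) {y : Pl} (hy : ‖y‖ ≤ a) : cut a L y = 1 := by
  unfold cut; rw [Real.smoothTransition.zero_of_nonpos (Tl_nonpos ha hL (norm_nonneg y) hy)]; simp

lemma cut_zero {a L : ℝ} (ha : 0 < a) (hL : 0 < L) {y : Pl} (hy : a * Real.exp L ≤ ‖y‖) : cut a L y = 0 := by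
  unfold cut; rw [Real.smoothTransition.one_of_one_le (Tl_ge_one ha hL hy)]; simp

lemma cut_smooth {a L : ℝ} (ha : 0 < a) (hL : 0 < L) : ContDiff ℝ (⊤ : ℕ∞) (cut a L) := by
  rw [contDiff_iff_contDiffAt]
  intro y
  by_cases hy : y = 0
  · have : cut a L =ᶠ[𝓝 y] fun _ => 1 := by
      filter_upwards [isOpen_ball.mem_nhds (show y ∈ ball (0:Pl) a by simpa [hy] using ha)] with z hz
      exact cut_one ha hL (by simpa using (mem_ball.1 hz).le)
    exact contDiffAt_const.congr_of_eventuallyEq this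
  · have h1 : ContDiffAt ℝ (⊤ : ℕ∞) (fun y : Pl => Tl a L ‖y‖) y := by
      unfold Tl
      refine ContDiffAt.div_const ?_ _
      refine ((contDiffAt_norm ℝ hy).div_const a).log ?_
      exact div_ne_zero (by simpa using hy) ha.ne'
    exact contDiffAt_const.sub ((Real.smoothTransition.contDiff (n := ⊤)).contDiffAt.comp y h1)

lemma pd_cut {a L : ℝ} (ha : 0 < a) (hL : 0 < L) (i : Fin 2) (y : Pl) : pd (cut a L) i y = -(Sd (Tl a L ‖y‖) / L) * (y i / ‖y‖ ^ 2) := by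
  by_cases hy : y = 0
  · have : cut a L =ᶠ[𝓝 y] fun _ => 1 := by
      filter_upwards [isOpen_ball.mem_nhds (show y ∈ ball (0:Pl) a by simpa [hy] using ha)] with z hz
      exact cut_one ha hL (by simpa using (mem_ball.1 hz).le)
    rw [pd_congr this]; simp [pd, lineDeriv, hy]
  · have h1 : cut a L =ᶠ[𝓝 y] fun z => (fun s => 1 - Real.smoothTransition ((s - Real.log a) / L)) (Real.log ‖z‖) := by
      filter_upwards [isOpen_ne.mem_nhds hy] with z hz
      simp only [cut, Tl]
      rw [Real.log_div (by simpa using hz) ha.ne']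
    have hT : (Real.log ‖y‖ - Real.log a) / L = Tl a L ‖y‖ := by
      simp only [Tl]
      rw [Real.log_div (by simpa using hy) ha.ne']
    have h2 : HasDerivAt (fun s => 1 - Real.smoothTransition ((s - Real.log a) / L)) (-(Sd (Tl a L ‖y‖) / L)) (Real.log ‖y‖) := by
      have h3 : HasDerivAt (fun s : ℝ => (s - Real.log a) / L) (1 / L) (Real.log ‖y‖) :=
        ((hasDerivAt_id _).sub_const _).div_const _
      have h4 := ((S_hasDerivAt ((Real.log ‖y‖ - Real.log a) / L)).comp (Real.log ‖y‖) h3).const_sub 1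
      rw [hT] at h4
      exact h4.congr_deriv (by ring)
    rw [pd_congr h1, pd_comp (hasFDerivAt_log_norm hy).differentiableAt h2, pd_log_norm hy]

lemma Sd_collar {a L : ℝ} (ha : 0 < a) (hL : 0 < L) {y : Pl} (h : ‖y‖ ≤ a ∨ a * Real.exp L ≤ ‖y‖) : Sd (Tl a L ‖y‖) = 0 := by
  rcases h with h | h
  · exact Sd_zero_of_nonpos (Tl_nonpos ha hL (norm_nonneg y) h)
  · exact Sd_zero_of_one_le (Tl_ge_one ha hL h)

lemma gradSq_cut {a L : ℝ} (ha : 0 < a) (hL : 0 < L) (y : Pl) : gradSq (cut a L) y = (Sd (Tl a L ‖y‖) / L) * (Sd (Tl a L ‖y‖) / (L * ‖y‖ ^ 2)) := by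
  unfold gradSq
  rw [pd_cut ha hL, pd_cut ha hL]
  by_cases hy : y = 0
  · simp [hy]
  have hn : ‖y‖ ^ 2 ≠ 0 := by simpa using hy
  have := pl_norm_sq y
  have : y 1 ^ 2 = ‖y‖ ^ 2 - y 0 ^ 2 := by linarith
  simp only [mul_pow, div_pow, neg_sq, this]
  field_simp
  ring

lemma x_grad_cut {a L : ℝ} (ha : 0 < a) (hL : 0 < L) (y : Pl) : y 0 * pd (cut a L) 0 y + y 1 * pd (cut a L) 1 y = - (Sd (Tl a L ‖y‖) / L) := by
  rw [pd_cut ha hL, pd_cut ha hL]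
  by_cases hy : y = 0
  · rw [Sd_collar ha hL (by simp [hy, ha.le])]; simp
  have hn : ‖y‖ ^ 2 ≠ 0 := by simpa using hy
  have := pl_norm_sq y
  have : y 1 ^ 2 = ‖y‖ ^ 2 - y 0 ^ 2 := by linarith
  field_simp
  rw [this]; ring

lemma cut_nonneg {a L : ℝ} (y : Pl) : 0 ≤ cut a L y := by
  have := Real.smoothTransition.le_one (Tl a L ‖y‖)
  unfold cut; linarith

lemma cut_le_one {a L : ℝ} (y : Pl) : cut a L y ≤ 1 := by
  have := Real.smoothTransition.nonneg (Tl a L ‖y‖)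
  unfold cut; linarith

lemma int_Sd {a L : ℝ} (ha : 0 < a) (hL : 0 < L) : ∫ y : Pl, Sd (Tl a L ‖y‖) / (L * ‖y‖ ^ 2) =
      2 * (volume : Measure Pl).real (ball 0 1) := by
  rw [radial_int S_hasDerivAt Sd_cont (fun t ht => Sd_zero_of_nonpos ht)
    (fun t ht => Sd_zero_of_one_le ht) ha hL]
  simp

lemma int_Sd2 {a L : ℝ} (ha : 0 < a) (hL : 0 < L) : ∫ y : Pl, (2 * cut a L y * Sd (Tl a L ‖y‖)) / (L * ‖y‖ ^ 2) =
      2 * (volume : Measure Pl).real (ball 0 1) := by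
  have hd : ∀ t, HasDerivAt (fun t => 1 - (1 - Real.smoothTransition t) ^ 2)
      (2 * (1 - Real.smoothTransition t) * Sd t) t := by
    intro t
    have := (((S_hasDerivAt t).const_sub 1).pow 2).const_sub 1
    exact this.congr_deriv (by push_cast; ring)
  have := radial_int hd (by have := Real.smoothTransition.continuous; have := Sd_cont; fun_prop) (fun t ht => by simp [Sd_zero_of_nonpos ht])
    (fun t ht => by simp [Sd_zero_of_one_le ht]) ha hL
  simpa [cut] using this

/-! ### The nonlinearity -/

lemma F_hasDerivAt {τ : ℝ} (hτ : 0 < τ) (t : ℝ) : HasDerivAt (F2τ τ) (fτ τ t) t := by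
  have he := Real.hasDerivAt_exp t
  have hp : 0 < Real.exp t := Real.exp_pos t
  have hne : 2 * τ ^ 2 * (τ + Real.exp t) ^ 2 ≠ 0 := by positivity
  have h1 := (he.mul ((he.const_mul (1 - τ)).add_const (2 * τ))).div
    (((he.const_add τ).pow 2).const_mul (2 * τ ^ 2)) hne
  refine h1.congr_deriv ?_
  unfold fτ
  simp
  field_simp
  ring

lemma f_hasDerivAt {τ : ℝ} (hτ : 0 < τ) (t : ℝ) : HasDerivAt (fτ τ) (fτ' τ t) t := by
  have he := Real.hasDerivAt_exp t
  have hp : 0 < Real.exp t := Real.exp_pos t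
  have hne : (τ + Real.exp t) ^ 3 ≠ 0 := by positivity
  have h1 := (he.mul (he.const_sub 1)).div ((he.const_add τ).pow 3) hne
  refine h1.congr_deriv ?_
  unfold fτ'
  have : Real.exp (2 * t) = Real.exp t ^ 2 := by rw [← Real.exp_nat_mul]; norm_num
  rw [this]
  simp
  field_simp
  ring

lemma f_cont {τ : ℝ} (hτ : 0 < τ) : Continuous (fτ τ) :=
  continuous_iff_continuousAt.2 fun t => (f_hasDerivAt hτ t).continuousAt

lemma F_cont {τ : ℝ} (hτ : 0 < τ) : Continuous (F2τ τ) :=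
  continuous_iff_continuousAt.2 fun t => (F_hasDerivAt hτ t).continuousAt

lemma f'_cont {τ : ℝ} (hτ : 0 < τ) : Continuous (fτ' τ) := by
  unfold fτ'
  refine Continuous.div (by fun_prop) (by fun_prop) fun t => ?_
  have := Real.exp_pos t
  positivity

lemma f_nonneg {τ : ℝ} (hτ : 0 < τ) {t : ℝ} (ht : t ≤ 0) : 0 ≤ fτ τ t := by
  have : Real.exp t ≤ 1 := Real.exp_le_one_iff.2 ht
  have hp := Real.exp_pos t
  unfold fτ
  have : 0 ≤ 1 - Real.exp t := by linarith
  positivity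

lemma f_neg {τ : ℝ} (hτ : 0 < τ) {t : ℝ} (ht : 0 < t) : fτ τ t < 0 := by
  have : 1 < Real.exp t := Real.one_lt_exp_iff.2 ht
  have hp := Real.exp_pos t
  unfold fτ
  apply div_neg_of_neg_of_pos
  · nlinarith
  · positivity

lemma f_bdd {τ : ℝ} (hτ : 0 < τ) : ∃ K > 0, ∀ t, |fτ τ t| ≤ K := by
  refine ⟨(1 + 1 / τ) / τ, by positivity, fun t => ?_⟩
  have hs := Real.exp_pos t
  unfold fτ
  set s := Real.exp t
  rw [abs_div, abs_of_pos (show 0 < (τ + s)^3 by positivity), div_le_iff₀ (by positivity), abs_mul, abs_of_pos hs]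
  have h1 : |1 - s| ≤ 1 + s := by rw [abs_le]; constructor <;> linarith
  have h2 : 1 + s ≤ (1 + 1/τ) * (τ + s) := by
    have : (1 + 1/τ) * (τ + s) = τ + 1 + s + s / τ := by field_simp; ring
    have : 0 ≤ s / τ := by positivity
    linarith
  have h3 : s ≤ (τ + s)^2 / τ := by rw [le_div_iff₀ hτ]; nlinarith
  calc s * |1 - s| ≤ ((τ + s)^2 / τ) * ((1 + 1/τ) * (τ + s)) := by
        apply mul_le_mul h3 (h1.trans h2) (abs_nonneg _) (by positivity)
    _ = _ := by ring

lemma f'_bdd {τ : ℝ} (hτ : 0 < τ) : ∃ K > 0, ∀ t, |fτ' τ t| ≤ K := by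
  refine ⟨(3 + 3 * τ) / τ ^ 2, by positivity, fun t => ?_⟩
  have hs := Real.exp_pos t
  unfold fτ'
  have e2 : Real.exp (2 * t) = Real.exp t ^ 2 := by rw [← Real.exp_nat_mul]; norm_num
  rw [e2]
  set s := Real.exp t
  rw [abs_div, abs_of_pos (show 0 < (τ + s)^4 by positivity), div_le_iff₀ (by positivity), abs_mul, abs_of_pos hs]
  have h1 : |τ - 2 * (τ + 1) * s + s^2| ≤ τ + 2 * (τ + 1) * s + s^2 := by
    have : 0 ≤ (τ + 1) * s := by positivity
    have : 0 ≤ s ^2 := by positivity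
    rw [abs_le]; constructor <;> linarith
  have h2 : s * (τ + 2 * (τ + 1) * s + s^2) ≤ ((3 + 3 * τ) / τ ^ 2) * (τ + s)^4 := by
    rw [div_mul_eq_mul_div, le_div_iff₀ (by positivity)]
    have : 0 ≤ 3 * τ^4 + 11 * τ^3*s + 16*τ^2*s^2+12*τ*s^3 + 3 * s^4 + 3*τ^5+12*τ^4*s+16*τ^3*s^2+11*τ^2*s^3+3*τ*s^4 := by positivity
    nlinarith
  exact (mul_le_mul_of_nonneg_left h1 hs.le).trans h2

lemma F_bdd {τ : ℝ} (hτ : 0 < τ) : ∃ K > 0, ∀ t, |F2τ τ t| ≤ K := by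
  refine ⟨(1 + τ + 1) / (2 * τ ^ 2), by positivity, fun t => ?_⟩
  have hs := Real.exp_pos t
  unfold F2τ
  set s := Real.exp t
  rw [abs_div, abs_of_pos (show 0 < 2 * τ ^ 2 * (τ + s)^2 by positivity), div_le_iff₀ (by positivity), abs_mul, abs_of_pos hs]
  have h1 : |(1 - τ) * s + 2 * τ| ≤ (1 + τ) * s + 2 * τ := by
    have : 0 ≤ τ * s := by positivity
    rw [abs_le]; constructor <;> nlinarith
  have h2 : s * ((1 + τ) * s + 2 * τ) ≤ (1 + τ + 1) / (2 * τ ^ 2) * (2 * τ ^ 2 * (τ + s)^2) := by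
    have : (1 + τ + 1) / (2 * τ ^ 2) * (2 * τ ^ 2 * (τ + s)^2) = (1 + τ + 1) * (τ + s)^2 := by field_simp
    rw [this]
    have : 0 ≤ τ^3 + 2 * τ^2 * s + 2 * τ^2 + 2*τ*s + s^2 := by positivity
    nlinarith
  exact (mul_le_mul_of_nonneg_left h1 hs.le).trans h2

lemma exp_le_F {τ : ℝ} (hτ : 0 < τ) : ∃ K > 0, ∀ t ≤ 0, Real.exp t ≤ K * F2τ τ t := by
  have hm : 0 < min (2 * τ) (1 + τ) := lt_min (by positivity) (by positivity)
  refine ⟨2 * τ ^ 2 * (τ + 1) ^ 2 / min (2 * τ) (1 + τ), by positivity, fun t ht => ?_⟩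
  have hs := Real.exp_pos t
  have hs1 : Real.exp t ≤ 1 := Real.exp_le_one_iff.2 ht
  unfold F2τ
  set s := Real.exp t
  have h1 : min (2 * τ) (1 + τ) ≤ (1 - τ) * s + 2 * τ := by
    have e : (1 - τ) * s + 2 * τ = (1 - s) * (2 * τ) + s * (1 + τ) := by ring
    rw [e]
    have a1 := mul_le_mul_of_nonneg_left (min_le_left (2 * τ) (1 + τ)) (show 0 ≤ 1 - s by linarith)
    have a2 := mul_le_mul_of_nonneg_left (min_le_right (2 * τ) (1 + τ)) hs.le
    nlinarith
  set μ := min (2 * τ) (1 + τ)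
  rw [div_mul_div_comm, le_div_iff₀ (by positivity)]
  have h3 : (τ + s) ^ 2 ≤ (τ + 1) ^ 2 := by gcongr
  calc s * (μ * (2 * τ ^ 2 * (τ + s) ^ 2)) ≤ s * (((1 - τ) * s + 2 * τ) * (2 * τ ^ 2 * (τ + 1) ^ 2)) := by
        have h0 := hm.le.trans h1
        gcongr
    _ = _ := by ring

lemma f_le_exp {τ : ℝ} (hτ : 0 < τ) : ∃ K > 0, ∀ t ≤ 0, fτ τ t ≤ K * Real.exp t := by
  refine ⟨1 / τ ^ 3, by positivity, fun t ht => ?_⟩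
  have hs := Real.exp_pos t
  have hs1 : Real.exp t ≤ 1 := Real.exp_le_one_iff.2 ht
  unfold fτ
  set s := Real.exp t
  rw [div_mul_eq_mul_div]
  apply div_le_div₀ (by positivity) (by nlinarith) (by positivity)
  gcongr; linarith

lemma F_le_f {τ : ℝ} (hτ : 0 < τ) : ∃ K > 0, ∀ t ≤ -1, |F2τ τ t| ≤ K * fτ τ t := by
  refine ⟨(1 + τ + 2 * τ) / (2 * τ ^ 4) * (2 * (τ + 1) ^ 3), by positivity, fun t ht => ?_⟩
  have hs := Real.exp_pos t
  have hs1 : Real.exp t ≤ 1 / 2 := by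
    have h1 : Real.exp t ≤ Real.exp (-1) := Real.exp_le_exp.2 ht
    have h2 : Real.exp (-1) < 1 / 2 := by
      rw [Real.exp_neg, inv_lt_comm₀ (Real.exp_pos 1) (by norm_num)]
      have := Real.exp_one_gt_d9
      norm_num; linarith
    linarith
  unfold F2τ fτ
  set s := Real.exp t
  have a1 : |s * ((1 - τ) * s + 2 * τ) / (2 * τ ^ 2 * (τ + s) ^ 2)| ≤ (1 + τ + 2 * τ) / (2 * τ ^ 4) * s := by
    rw [abs_div, abs_of_pos (show 0 < 2 * τ ^ 2 * (τ + s)^2 by positivity), div_mul_eq_mul_div, abs_mul, abs_of_pos hs]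
    have h1 : |(1 - τ) * s + 2 * τ| ≤ 1 + τ + 2 * τ := by
      have : 0 ≤ τ * s := by positivity
      rw [abs_le]; constructor <;> nlinarith
    refine div_le_div₀ (by positivity) (by nlinarith [abs_nonneg ((1 - τ) * s + 2 * τ)]) (by positivity) ?_
    have : τ ^ 2 ≤ (τ + s) ^ 2 := by gcongr; linarith
    have h0 : 0 ≤ 2 * τ ^ 2 := by positivity
    nlinarith [mul_le_mul_of_nonneg_left this h0]
  have a2 : s ≤ 2 * (τ + 1) ^ 3 * (s * (1 - s) / (τ + s) ^ 3) := by
    rw [← mul_div_assoc, le_div_iff₀ (by positivity)]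
    have h3 : (τ + s) ^ 3 ≤ (τ + 1) ^ 3 := by gcongr; linarith
    have h4 : s * (τ + s) ^ 3 ≤ s * (τ + 1) ^ 3 := by gcongr
    have h5 : 0 ≤ s * (τ + 1) ^ 3 := by positivity
    nlinarith
  calc _ ≤ (1 + τ + 2 * τ) / (2 * τ ^ 4) * s := a1
    _ ≤ (1 + τ + 2 * τ) / (2 * τ ^ 4) * (2 * (τ + 1) ^ 3 * (s * (1 - s) / (τ + s) ^ 3)) := by gcongr
    _ = _ := by ring

/-- All bounds with one constant. -/
lemma tau_bounds {τ : ℝ} (hτ : 0 < τ) : ∃ K ≥ 1, (∀ t, |fτ τ t| ≤ K) ∧ (∀ t, |F2τ τ t| ≤ K) ∧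
    (∀ t ≤ 0, Real.exp t ≤ K * F2τ τ t) ∧ (∀ t ≤ 0, fτ τ t ≤ K * Real.exp t) ∧
    (∀ t ≤ -1, |F2τ τ t| ≤ K * fτ τ t) := by
  obtain ⟨K1, p1, h1⟩ := f_bdd hτ
  obtain ⟨K2, p2, h2⟩ := F_bdd hτ
  obtain ⟨K3, p3, h3⟩ := exp_le_F hτ
  obtain ⟨K4, p4, h4⟩ := f_le_exp hτ
  obtain ⟨K5, p5, h5⟩ := F_le_f hτ
  refine ⟨1 + K1 + K2 + K3 + K4 + K5, by linarith, fun t => (h1 t).trans (by linarith),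
    fun t => (h2 t).trans (by linarith), fun t ht => (h3 t ht).trans ?_, fun t ht => (h4 t ht).trans ?_,
    fun t ht => (h5 t ht).trans ?_⟩
  · have : 0 < F2τ τ t := by
      have := (Real.exp_pos t).trans_le (h3 t ht)
      exact (pos_iff_pos_of_mul_pos this).1 p3
    gcongr; linarith
  · gcongr; linarith
  · have := f_nonneg hτ (show t ≤ 0 by linarith)
    gcongr; linarith

/-- the singular function `-2m log|y| + V` -/
def UU (m : ℝ) (V : Pl → ℝ) (y : Pl) : ℝ := -2 * m * Real.log ‖y‖ + V y
/-- the dilation derivative -/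
def ZZ (m : ℝ) (V : Pl → ℝ) (y : Pl) : ℝ := -2 * m + (y 0 * pd V 0 y + y 1 * pd V 1 y)

lemma coord_diff (i : Fin 2) (x : Pl) : DifferentiableAt ℝ (fun y : Pl => y i) x :=
  (hasFDerivAt_coord i x).differentiableAt

lemma sm_diff {V : Pl → ℝ} (hV : ContDiff ℝ (⊤ : ℕ∞) V) (x : Pl) : DifferentiableAt ℝ V x :=
  hV.differentiable (by simp) x

lemma dmul {u v : Pl → ℝ} {x : Pl} (hu : DifferentiableAt ℝ u x) (hv : DifferentiableAt ℝ v x) :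
    DifferentiableAt ℝ (fun y => u y * v y) x := hu.mul hv

lemma dadd {u v : Pl → ℝ} {x : Pl} (hu : DifferentiableAt ℝ u x) (hv : DifferentiableAt ℝ v x) :
    DifferentiableAt ℝ (fun y => u y + v y) x := hu.add hv

/-- integrable with the given integral -/
def HI (f : Pl → ℝ) (a : ℝ) : Prop := Integrable f ∧ ∫ y, f y = a

lemma HI.of {f : Pl → ℝ} (h : Integrable f) : HI f (∫ y, f y) := ⟨h, rfl⟩

lemma HI.add {f g : Pl → ℝ} {a b : ℝ} (hf : HI f a) (hg : HI g b) : HI (fun y => f y + g y) (a + b) :=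
  ⟨hf.1.add hg.1, by rw [integral_add hf.1 hg.1, hf.2, hg.2]⟩

lemma HI.sub {f g : Pl → ℝ} {a b : ℝ} (hf : HI f a) (hg : HI g b) : HI (fun y => f y - g y) (a - b) :=
  ⟨hf.1.sub hg.1, by rw [integral_sub hf.1 hg.1, hf.2, hg.2]⟩

lemma HI.const_mul {f : Pl → ℝ} {a : ℝ} (c : ℝ) (hf : HI f a) : HI (fun y => c * f y) (c * a) :=
  ⟨hf.1.const_mul c, by rw [integral_const_mul, hf.2]⟩

lemma sm_cont {V : Pl → ℝ} (hV : ContDiff ℝ (⊤ : ℕ∞) V) : Continuous V := hV.continuous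

lemma smooth_ZZ (m : ℝ) {V : Pl → ℝ} (hV : ContDiff ℝ (⊤ : ℕ∞) V) : ContDiff ℝ (⊤ : ℕ∞) (ZZ m V) := by
  unfold ZZ
  exact contDiff_const.add (((smooth_coord 0).mul (smooth_pd hV 0)).add ((smooth_coord 1).mul (smooth_pd hV 1)))

lemma UU_diff (m : ℝ) {V : Pl → ℝ} (hV : ContDiff ℝ (⊤ : ℕ∞) V) {y : Pl} (hy : y ≠ 0) :
    DifferentiableAt ℝ (UU m V) y :=
  ((hasFDerivAt_log_norm hy).differentiableAt.const_mul _).add (sm_diff hV y)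

lemma UU_contOn (m : ℝ) {V : Pl → ℝ} (hV : ContDiff ℝ (⊤ : ℕ∞) V) : ContinuousOn (UU m V) {0}ᶜ :=
  fun _ hy => (UU_diff m hV hy).continuousAt.continuousWithinAt

lemma pd_UU (m : ℝ) {V : Pl → ℝ} (hV : ContDiff ℝ (⊤ : ℕ∞) V) {y : Pl} (hy : y ≠ 0) (i : Fin 2) :
    pd (UU m V) i y = -2 * m * (y i / ‖y‖ ^ 2) + pd V i y := by
  have h := (hasFDerivAt_log_norm hy).differentiableAt
  unfold UU
  rw [pd_add (h.const_mul _) (sm_diff hV y), pd_const_mul _ h, pd_log_norm hy]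

lemma x_grad_UU (m : ℝ) {V : Pl → ℝ} (hV : ContDiff ℝ (⊤ : ℕ∞) V) {y : Pl} (hy : y ≠ 0) :
    y 0 * pd (UU m V) 0 y + y 1 * pd (UU m V) 1 y = ZZ m V y := by
  rw [pd_UU m hV hy, pd_UU m hV hy, ZZ]
  have hn : ‖y‖ ^ 2 ≠ 0 := by simpa using hy
  have h := pl_norm_sq y
  have : y 0 * (y 0 / ‖y‖^2) + y 1 * (y 1 / ‖y‖^2) = 1 := by
    rw [h] at hn ⊢; field_simp
  linear_combination (-2 * m) * this

lemma lap_ZZ_gen (m : ℝ) {V : Pl → ℝ} (hV : ContDiff ℝ (⊤ : ℕ∞) V) (y : Pl) :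
    lap (ZZ m V) y = 2 * lap V y + (y 0 * pd (lap V) 0 y + y 1 * pd (lap V) 1 y) := by
  have s1 := fun i => smooth_pd hV i
  have s2 := fun i j => smooth_pd (s1 i) j
  have s3 := fun i j k => smooth_pd (s2 i j) k
  have e1 : ∀ i, pd (ZZ m V) i = fun y => pd V i y + (y 0 * pd (pd V 0) i y + y 1 * pd (pd V 1) i y) := by
    intro i; funext y
    unfold ZZ
    rw [pd_const_add, pd_add (dmul (coord_diff 0 y) (sm_diff (s1 0) y)) (dmul (coord_diff 1 y) (sm_diff (s1 1) y)),
      pd_mul (coord_diff 0 y) (sm_diff (s1 0) y), pd_mul (coord_diff 1 y) (sm_diff (s1 1) y), pd_coord, pd_coord]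
    fin_cases i <;> simp <;> ring
  have e2 : ∀ i, pd (pd (ZZ m V) i) i y = 2 * pd (pd V i) i y +
      (y 0 * pd (pd (pd V 0) i) i y + y 1 * pd (pd (pd V 1) i) i y) := by
    intro i
    rw [e1 i, pd_add (sm_diff (s1 i) y) (dadd (dmul (coord_diff 0 y) (sm_diff (s2 0 i) y)) (dmul (coord_diff 1 y) (sm_diff (s2 1 i) y))),
      pd_add (dmul (coord_diff 0 y) (sm_diff (s2 0 i) y)) (dmul (coord_diff 1 y) (sm_diff (s2 1 i) y)),
      pd_mul (coord_diff 0 y) (sm_diff (s2 0 i) y), pd_mul (coord_diff 1 y) (sm_diff (s2 1 i) y), pd_coord, pd_coord]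
    fin_cases i <;> simp <;> ring
  have e3 : ∀ i j, pd (pd (pd V j) i) i y = pd (pd (pd V i) i) j y := by
    intro i j
    have : pd (pd V j) i = pd (pd V i) j := funext fun x => pd_comm hV j i x
    rw [this, pd_comm (s1 i) j i]
  have e4 : ∀ j, pd (lap V) j y = pd (pd (pd V 0) 0) j y + pd (pd (pd V 1) 1) j y := by
    intro j
    exact pd_add (sm_diff (s2 0 0) y) (sm_diff (s2 1 1) y) j
  rw [e4, e4]
  unfold lap
  rw [e2, e2, e3 1 0, e3 0 1]
  ring

lemma lap_ZZ {τ k m r1 : ℝ} (hτ : 0 < τ) {V : Pl → ℝ} (hV : ContDiff ℝ (⊤ : ℕ∞) V)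
    (hpde : ∀ y, y ≠ 0 → ‖y‖ < r1 → lap V y + k * fτ τ (UU m V y) = 0) {y : Pl} (hy : y ≠ 0) (hy1 : ‖y‖ < r1) :
    lap (ZZ m V) y = - k * (fτ' τ (UU m V y) * ZZ m V y + 2 * fτ τ (UU m V y)) := by
  rw [lap_ZZ_gen m hV]
  have he : lap V =ᶠ[𝓝 y] fun z => -k * fτ τ (UU m V z) := by
    filter_upwards [isOpen_ne.mem_nhds hy, (isOpen_lt continuous_norm continuous_const).mem_nhds hy1] with z h1 h2
    linarith [hpde z h1 h2]
  have hd := UU_diff m hV hy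
  have h1 : ∀ i, pd (lap V) i y = -k * (fτ' τ (UU m V y) * pd (UU m V) i y) := by
    intro i
    have hf := f_hasDerivAt hτ (UU m V y)
    have hdf : DifferentiableAt ℝ (fun z => fτ τ (UU m V z)) y := 
      (hf.comp_hasFDerivAt y hd.hasFDerivAt).differentiableAt
    rw [pd_congr he, pd_const_mul _ hdf, pd_comp hd hf]
  rw [h1, h1, ← x_grad_UU m hV hy]
  have := hpde y hy hy1
  linear_combination 2 * this

/-- continuity of `g * h` if `g` is continuous, vanishes at zero and h is bounded and continuous off zero -/
lemma cont_mul_bdd {g h : Pl → ℝ} (hg : Continuous g) (g0 : g 0 = 0) (hh : ContinuousOn h {0}ᶜ) {C : ℝ}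
    (hb : ∀ y, |h y| ≤ C) : Continuous fun y => g y * h y := by
  rw [continuous_iff_continuousAt]
  intro y
  by_cases hy : y = 0
  · subst hy
    have : Tendsto (fun y => C * |g y|) (𝓝 0) (𝓝 0) := by
      have : Continuous fun y => C * |g y| := by fun_prop
      have := this.tendsto 0
      simpa [g0] using this
    unfold ContinuousAt
    beta_reduce
    rw [g0, zero_mul]
    refine squeeze_zero_norm (fun z => ?_) this
    rw [norm_mul, mul_comm, Real.norm_eq_abs, Real.norm_eq_abs]
    exact mul_le_mul_of_nonneg_right (hb z) (abs_nonneg _)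
  · exact hg.continuousAt.mul (hh.continuousAt (isOpen_compl_singleton.mem_nhds hy))

lemma contOn_comp_UU {g : ℝ → ℝ} (hg : Continuous g) (m : ℝ) {V : Pl → ℝ} (hV : ContDiff ℝ (⊤ : ℕ∞) V) :
    ContinuousOn (fun y => g (UU m V y)) {0}ᶜ :=
  hg.comp_continuousOn (UU_contOn m hV)

/-- integrability of compactly supported continuous times bounded function of U -/
lemma integ_mul_UU {g : ℝ → ℝ} (hg : Continuous g) {C : ℝ} (hC : ∀ t, |g t| ≤ C) (m : ℝ) {V : Pl → ℝ}
    (hV : ContDiff ℝ (⊤ : ℕ∞) V) {q : Pl → ℝ} {r : ℝ} (hq : Continuous q) (hs : ∀ y, r < ‖y‖ → q y = 0) :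
    Integrable fun y => q y * g (UU m V y) := by
  obtain ⟨D, hD⟩ := bdd_of_cont hq hs
  refine integ_of (r := r) (C := D * C) (hq.continuousOn.mul (contOn_comp_UU hg m hV)) (fun y hy => by rw [hs y hy, zero_mul]) fun y _ => ?_
  rw [abs_mul]
  exact mul_le_mul (hD y) (hC _) (abs_nonneg _) ((abs_nonneg _).trans (hD y))

lemma B_pd {τ m : ℝ} (hτ : 0 < τ) {V q : Pl → ℝ} (hV : ContDiff ℝ (⊤ : ℕ∞) V) 
    (hq : ContDiff ℝ (⊤ : ℕ∞) q) (i : Fin 2) {y : Pl} (hy : y ≠ 0) :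
    DifferentiableAt ℝ (fun y => (y i * q y) * F2τ τ (UU m V y)) y ∧
    pd (fun y => (y i * q y) * F2τ τ (UU m V y)) i y =
      (q y + y i * pd q i y) * F2τ τ (UU m V y) + q y * (y i * pd (UU m V) i y) * fτ τ (UU m V y) := by
  have hd := UU_diff m hV hy
  have hF := F_hasDerivAt hτ (UU m V y)
  have hdF : DifferentiableAt ℝ (fun z => F2τ τ (UU m V z)) y := 
      (hF.comp_hasFDerivAt y hd.hasFDerivAt).differentiableAt
  have hyq := dmul (coord_diff i y) (sm_diff hq y)
  refine ⟨dmul hyq hdF, ?_⟩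
  rw [pd_mul hyq hdF, pd_mul (coord_diff i y) (sm_diff hq y), pd_coord, pd_comp hd hF]
  simp; ring

lemma B_int {τ m r : ℝ} (hτ : 0 < τ) {V q : Pl → ℝ} (hV : ContDiff ℝ (⊤ : ℕ∞) V) 
    (hq : ContDiff ℝ (⊤ : ℕ∞) q) (hs : ∀ y, r < ‖y‖ → q y = 0) (i : Fin 2) :
    Integrable (fun y => (q y + y i * pd q i y) * F2τ τ (UU m V y) + q y * (y i * pd (UU m V) i y) * fτ τ (UU m V y)) ∧
    ∫ y, ((q y + y i * pd q i y) * F2τ τ (UU m V y) + q y * (y i * pd (UU m V) i y) * fτ τ (UU m V y)) = 0 := by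
  obtain ⟨Kf, -, hKf⟩ := f_bdd hτ
  obtain ⟨KF, -, hKF⟩ := F_bdd hτ
  have hci : Continuous fun y : Pl => y i := sm_cont (smooth_coord i)
  have hpq := sm_cont (smooth_pd hq i)
  have hpV := sm_cont (smooth_pd hV i)
  have hqc := sm_cont hq
  have hps : ∀ y, r < ‖y‖ → pd q i y = 0 := fun y hy => pd_eq_zero_of_notMem hs i hy
  have I1 : Integrable (fun y => (q y + y i * pd q i y) * F2τ τ (UU m V y)) :=
    integ_mul_UU (F_cont hτ) hKF m hV (r := r) (by fun_prop) (fun y hy => by rw [hs y hy, hps y hy]; ring)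
  have I2 : Integrable (fun y => q y * (y i * pd (UU m V) i y) * fτ τ (UU m V y)) := by
    obtain ⟨D1, hD1⟩ := bdd_of_cont hqc hs
    obtain ⟨D2, hD2⟩ := bdd_of_cont (g := fun y => q y * (y i * pd V i y)) (r := r) (by fun_prop) (fun y hy => by rw [hs y hy]; ring)
    have hcU : ContinuousOn (pd (UU m V) i) {0}ᶜ := by
      have : ContinuousOn (fun y : Pl => -2 * m * (y i / ‖y‖ ^ 2) + pd V i y) {0}ᶜ := by
        refine ContinuousOn.add (continuousOn_const.mul (ContinuousOn.div hci.continuousOn (by fun_prop) fun y hy => by simpa using hy)) hpV.continuousOn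
      exact this.congr fun y hy => pd_UU m hV hy i
    refine integ_of (r := r) (C := (D1 * (2 * |m|) + D2) * Kf) ((hqc.continuousOn.mul (hci.continuousOn.mul hcU)).mul (contOn_comp_UU (f_cont hτ) m hV)) (fun y hy => by rw [hs y hy]; ring) fun y hy => ?_
    rw [abs_mul]
    refine mul_le_mul ?_ (hKf _) (abs_nonneg _) ?_
    · rw [pd_UU m hV hy]
      have e : q y * (y i * (-2 * m * (y i / ‖y‖ ^ 2) + pd V i y)) = q y * (-2 * m * (y i ^2 / ‖y‖ ^ 2)) + q y * (y i * pd V i y) := by ring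
      rw [e]
      refine (abs_add_le _ _).trans (add_le_add ?_ (hD2 y))
      rw [abs_mul]
      refine mul_le_mul (hD1 y) ?_ (abs_nonneg _) ((abs_nonneg _).trans (hD1 y))
      rw [abs_mul, abs_mul, abs_div, abs_neg, abs_two, abs_of_nonneg (sq_nonneg (y i)), abs_of_nonneg (sq_nonneg ‖y‖)]
      have : y i ^ 2 / ‖y‖^2 ≤ 1 := by
        apply div_le_one_of_le₀ _ (sq_nonneg _)
        rw [← sq_abs (y i)]
        have := abs_coord_le y i
        gcongr
      have h2 : 0 ≤ 2 * |m| := by positivity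
      nlinarith
    · have := (abs_nonneg _).trans (hD1 y)
      have := (abs_nonneg _).trans (hD2 y)
      positivity
  have I := I1.add I2
  refine ⟨I, ?_⟩
  have hcong : (pd (fun y => (y i * q y) * F2τ τ (UU m V y)) i) =ᵐ[volume] fun y => (q y + y i * pd q i y) * F2τ τ (UU m V y) + q y * (y i * pd (UU m V) i y) * fτ τ (UU m V y) := by
    filter_upwards [ae_ne_zero_pl] with y hy using (B_pd hτ hV hq i hy).2
  rw [← integral_congr_ae hcong]
  refine ibp0 (r := r) ?_ (fun y hy => by rw [hs y hy]; ring) (fun y hy => (B_pd hτ hV hq i hy).1) i (I.congr hcong.symm)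
  exact cont_mul_bdd (by fun_prop) (by simp) (contOn_comp_UU (F_cont hτ) m hV) (fun y => hKF _)

lemma A_int {V q : Pl → ℝ} {r : ℝ} (hV : ContDiff ℝ (⊤ : ℕ∞) V) 
    (hq : ContDiff ℝ (⊤ : ℕ∞) q) (hs : ∀ y, r < ‖y‖ → q y = 0) (i : Fin 2) :
    Integrable (fun y => pd q i y * V y + q y * pd V i y) ∧ 
    ∫ y, (pd q i y * V y + q y * pd V i y) = 0 := by
  have e : (fun y => pd q i y * V y + q y * pd V i y) = pd (fun y => q y * V y) i := by
    funext y; rw [pd_mul (sm_diff hq y) (sm_diff hV y)]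
  have hI : Integrable (pd (fun y => q y * V y) i) := 
    integ_cont (r := r) (sm_cont (smooth_pd (hq.mul hV) i)) (fun y hy => pd_eq_zero_of_notMem (fun y hy => by rw [hs y hy, zero_mul]) i hy)
  have h2 := ibp0 (r := r) (g := fun y => q y * V y) (sm_cont (hq.mul hV)) (fun y hy => by rw [hs y hy, zero_mul]) (fun y _ => sm_diff (hq.mul hV) y) i hI
  rw [← e] at hI h2
  exact ⟨hI, h2⟩

/-- Pohozaev + stability. -/
lemma poho {τ k m r r1 : ℝ} (hτ : 0 < τ) (hr : r < r1) {V ψ : Pl → ℝ} (hV : ContDiff ℝ (⊤ : ℕ∞) V)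
    (hpde : ∀ y, y ≠ 0 → ‖y‖ < r1 → lap V y + k * fτ τ (UU m V y) = 0)
    (hψ : ContDiff ℝ (⊤ : ℕ∞) ψ) (hs : ∀ y, r < ‖y‖ → ψ y = 0)
    (hst : 0 ≤ ∫ y, (gradSq (fun y => ZZ m V y * ψ y) y - k * fτ' τ (UU m V y) * (ZZ m V y * ψ y) ^ 2)) :
    4 * k * ∫ y, ψ y ^ 2 * F2τ τ (UU m V y) ≤ (∫ y, ZZ m V y ^ 2 * gradSq ψ y) - 
      4 * k * ∫ y, (ψ y * (y 0 * pd ψ 0 y + y 1 * pd ψ 1 y)) * F2τ τ (UU m V y) := by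
  obtain ⟨KF, -, hKF⟩ := F_bdd hτ
  set Z := ZZ m V with hZd
  have hZ : ContDiff ℝ (⊤ : ℕ∞) Z := smooth_ZZ m hV
  have hci : ∀ i, Continuous fun y : Pl => y i := fun i => sm_cont (smooth_coord i)
  have hpψ := fun i => sm_cont (smooth_pd hψ i)
  have hψc := sm_cont hψ
  have hZc := sm_cont hZ
  have hps : ∀ i y, r < ‖y‖ → pd ψ i y = 0 := fun i y hy => pd_eq_zero_of_notMem hs i hy
  have hq : ContDiff ℝ (⊤ : ℕ∞) (fun y => ψ y * ψ y) := hψ.mul hψ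
  have hqs : ∀ y, r < ‖y‖ → ψ y * ψ y = 0 := fun y hy => by rw [hs y hy, zero_mul]
  have hq2 : ContDiff ℝ (⊤ : ℕ∞) (fun y => Z y * (ψ y * ψ y)) := hZ.mul hq
  have hq2s : ∀ y, r < ‖y‖ → Z y * (ψ y * ψ y) = 0 := fun y hy => by rw [hs y hy]; ring
  have a0 := A_int (smooth_pd hZ 0) hq2 hq2s 0
  have a1 := A_int (smooth_pd hZ 1) hq2 hq2s 1
  have b0 := B_int (m := m) hτ hV hq hqs 0
  have b1 := B_int (m := m) hτ hV hq hqs 1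
  have I1 : Integrable fun y => Z y ^ 2 * gradSq ψ y := by
    refine integ_cont (r := r) ?_ (fun y hy => by simp [gradSq, hps _ y hy])
    unfold gradSq
    have := hpψ 0
    have := hpψ 1
    fun_prop
  have I2 : Integrable fun y => ψ y ^ 2 * F2τ τ (UU m V y) :=
    integ_mul_UU (F_cont hτ) hKF m hV (r := r) (by fun_prop) (fun y hy => by rw [hs y hy]; ring)
  have I3 : Integrable fun y => (ψ y * (y 0 * pd ψ 0 y + y 1 * pd ψ 1 y)) * F2τ τ (UU m V y) := by
    refine integ_mul_UU (F_cont hτ) hKF m hV (r := r) ?_ (fun y hy => by rw [hs y hy]; ring)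
    have := hpψ 0
    have := hpψ 1
    have := hci 0
    have := hci 1
    fun_prop
  have key : (fun y => gradSq (fun y => Z y * ψ y) y - k * fτ' τ (UU m V y) * (Z y * ψ y) ^ 2) =ᵐ[volume]
     (fun y => ((pd (fun y => Z y * (ψ y * ψ y)) 0 y * pd Z 0 y + (Z y * (ψ y * ψ y)) * pd (pd Z 0) 0 y)
     + (pd (fun y => Z y * (ψ y * ψ y)) 1 y * pd Z 1 y + (Z y * (ψ y * ψ y)) * pd (pd Z 1) 1 y)
     + 2 * k * (((ψ y * ψ y) + y 0 * pd (fun y => ψ y * ψ y) 0 y) * F2τ τ (UU m V y) + (ψ y * ψ y) * (y 0 * pd (UU m V) 0 y) * fτ τ (UU m V y))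
     + 2 * k * (((ψ y * ψ y) + y 1 * pd (fun y => ψ y * ψ y) 1 y) * F2τ τ (UU m V y) + (ψ y * ψ y) * (y 1 * pd (UU m V) 1 y) * fτ τ (UU m V y)))
     + Z y ^ 2 * gradSq ψ y - (4 * k) * (ψ y ^ 2 * F2τ τ (UU m V y)) - (4 * k) * ((ψ y * (y 0 * pd ψ 0 y + y 1 * pd ψ 1 y)) * F2τ τ (UU m V y))) := by
    filter_upwards [ae_ne_zero_pl] with y hy
    have dψ := sm_diff hψ y
    have dZ := sm_diff hZ y
    have e1 : ∀ i, pd (fun y => ψ y * ψ y) i y = 2 * ψ y * pd ψ i y := by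
      intro i; rw [pd_mul dψ dψ]; ring
    have e2 : ∀ i, pd (fun y => Z y * (ψ y * ψ y)) i y = pd Z i y * (ψ y * ψ y) + Z y * (2 * ψ y * pd ψ i y) := by
      intro i; rw [pd_mul dZ (dmul dψ dψ), e1]
    have e3 : ∀ i, pd (fun y => Z y * ψ y) i y = pd Z i y * ψ y + Z y * pd ψ i y := by
      intro i; rw [pd_mul dZ dψ]
    simp only [gradSq]
    rw [e1, e1, e2, e2, e3, e3]
    by_cases hyr : ‖y‖ < r1
    · have hl := lap_ZZ hτ hV hpde hy hyr
      have hx := x_grad_UU m hV hy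
      rw [← hZd] at hl hx
      unfold lap at hl
      linear_combination (-(Z y * ψ y ^ 2)) * hl - (2 * k * ψ y ^ 2 * fτ τ (UU m V y)) * hx
    · have : r < ‖y‖ := by linarith
      rw [hs y this, hps 0 y this, hps 1 y this]; ring
  rw [integral_congr_ae key] at hst
  have a0' : HI _ _ := a0
  have a1' : HI _ _ := a1
  have b0' : HI _ _ := b0
  have b1' : HI _ _ := b1
  have J := ((((((a0'.add a1').add (b0'.const_mul (2 * k))).add (b1'.const_mul (2 * k))).add (HI.of I1)).sub
    ((HI.of I2).const_mul (4 * k))).sub ((HI.of I3).const_mul (4 * k))).2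
  rw [J] at hst
  linarith

/-- mass identity -/
lemma mass_id {τ k m r r1 : ℝ} (hτ : 0 < τ) (hr : r < r1) {V ψ : Pl → ℝ} (hV : ContDiff ℝ (⊤ : ℕ∞) V)
    (hpde : ∀ y, y ≠ 0 → ‖y‖ < r1 → lap V y + k * fτ τ (UU m V y) = 0)
    (hψ : ContDiff ℝ (⊤ : ℕ∞) ψ) (hs : ∀ y, r < ‖y‖ → ψ y = 0) :
    k * ∫ y, ψ y ^ 2 * fτ τ (UU m V y) = ∫ y, 2 * ψ y * (pd ψ 0 y * pd V 0 y + pd ψ 1 y * pd V 1 y) := by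
  obtain ⟨Kf, -, hKf⟩ := f_bdd hτ
  have hq : ContDiff ℝ (⊤ : ℕ∞) (fun y => ψ y * ψ y) := hψ.mul hψ
  have hqs : ∀ y, r < ‖y‖ → ψ y * ψ y = 0 := fun y hy => by rw [hs y hy, zero_mul]
  have a0 := A_int (smooth_pd hV 0) hq hqs 0
  have a1 := A_int (smooth_pd hV 1) hq hqs 1
  have hψc := sm_cont hψ
  have I2 : Integrable fun y => ψ y ^ 2 * fτ τ (UU m V y) :=
    integ_mul_UU (f_cont hτ) hKf m hV (r := r) (by fun_prop) (fun y hy => by rw [hs y hy]; ring)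
  have key : (fun y => 2 * ψ y * (pd ψ 0 y * pd V 0 y + pd ψ 1 y * pd V 1 y)) =ᵐ[volume] fun y =>
     (pd (fun y => (ψ y * ψ y)) 0 y * pd V 0 y + (ψ y * ψ y) * pd (pd V 0) 0 y)
     + (pd (fun y => (ψ y * ψ y)) 1 y * pd V 1 y + (ψ y * ψ y) * pd (pd V 1) 1 y) + k * (ψ y ^ 2 * fτ τ (UU m V y)) := by
    filter_upwards [ae_ne_zero_pl] with y hy
    have dψ := sm_diff hψ y
    have e1 : ∀ i, pd (fun y => ψ y * ψ y) i y = 2 * ψ y * pd ψ i y := by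
      intro i; rw [pd_mul dψ dψ]; ring
    rw [e1, e1]
    by_cases hyr : ‖y‖ < r1
    · have := hpde y hy hyr
      unfold lap at this
      linear_combination (-ψ y ^ 2) * this
    · have : r < ‖y‖ := by linarith
      rw [hs y this]; ring
  have a0' : HI _ _ := a0
  have a1' : HI _ _ := a1
  rw [integral_congr_ae key, ((a0'.add a1').add ((HI.of I2).const_mul k)).2]
  ring

/-- area of the unit disc -/
def om : ℝ := (volume : Measure Pl).real (ball 0 1)

lemma om_pos : 0 < om := by
  unfold om
  rw [measureReal_def]
  exact ENNReal.toReal_pos (measure_ball_pos _ _ one_pos).ne' measure_ball_lt_top.ne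

/-- indicator of a closed disc -/
def ind (ρ : ℝ) : Pl → ℝ := (closedBall (0:Pl) ρ).indicator fun _ => 1

lemma ind_one {ρ : ℝ} {y : Pl} (h : ‖y‖ ≤ ρ) : ind ρ y = 1 := by
  unfold ind; rw [indicator_of_mem (by simpa using h)]

lemma ind_zero {ρ : ℝ} {y : Pl} (h : ρ < ‖y‖) : ind ρ y = 0 := by
  unfold ind; rw [indicator_of_notMem (by simpa using h)]

lemma ind_nonneg (ρ : ℝ) (y : Pl) : 0 ≤ ind ρ y := by
  unfold ind; exact indicator_nonneg (fun _ _ => zero_le_one) y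

lemma HI_ind {ρ : ℝ} (hρ : 0 ≤ ρ) : HI (ind ρ) (ρ ^ 2 * om) := by
  constructor
  · unfold ind
    rw [integrable_indicator_iff measurableSet_closedBall]
    exact integrableOn_const measure_closedBall_lt_top.ne
  · unfold ind
    rw [integral_indicator measurableSet_closedBall]
    simp only [setIntegral_const, smul_eq_mul, mul_one]
    rw [Measure.addHaar_real_closedBall _ _ hρ]; simp [om]

lemma HI.mono {f g : Pl → ℝ} {a b : ℝ} (hf : HI f a) (hg : HI g b) (h : ∀ y, f y ≤ g y) : a ≤ b := by
  rw [← hf.2, ← hg.2]; exact integral_mono hf.1 hg.1 h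

lemma HI_Sd {a L : ℝ} (ha : 0 < a) (hL : 0 < L) : HI (fun y => Sd (Tl a L ‖y‖) / (L * ‖y‖ ^ 2)) (2 * om) := by
  refine ⟨?_, int_Sd ha hL⟩
  by_contra h
  have h1 := int_Sd ha hL
  rw [integral_undef h] at h1
  have := om_pos
  unfold om at this
  linarith

lemma HI_Sd2 {a L : ℝ} (ha : 0 < a) (hL : 0 < L) : HI (fun y => (2 * cut a L y * Sd (Tl a L ‖y‖)) / (L * ‖y‖ ^ 2)) (2 * om) := by
  refine ⟨?_, int_Sd2 ha hL⟩
  by_contra h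
  have h1 := int_Sd2 ha hL
  rw [integral_undef h] at h1
  have := om_pos
  unfold om at this
  linarith

lemma cut_zero' {a L : ℝ} (ha : 0 < a) (hL : 0 < L) {y : Pl} (hy : a * Real.exp L < ‖y‖) : cut a L y = 0 :=
  cut_zero ha hL hy.le

lemma gradSq_cut_le {a L C : ℝ} (ha : 0 < a) (hL : 0 < L) (hC : ∀ t, Sd t ≤ C) (y : Pl) :
    gradSq (cut a L) y ≤ C / L * (Sd (Tl a L ‖y‖) / (L * ‖y‖ ^ 2)) := by
  rw [gradSq_cut ha hL]
  have := Sd_nonneg (Tl a L ‖y‖)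
  gcongr
  exact hC _

lemma HI_gradSq {a L : ℝ} (ha : 0 < a) (hL : 0 < L) : HI (gradSq (cut a L)) (∫ y, gradSq (cut a L) y) := by
  apply HI.of
  refine integ_cont (r := a * Real.exp L) ?_ (fun y hy => ?_)
  · unfold gradSq
    have h0 := sm_cont (smooth_pd (cut_smooth ha hL) 0)
    have h1 := sm_cont (smooth_pd (cut_smooth ha hL) 1)
    fun_prop
  · simp [gradSq, pd_eq_zero_of_notMem (fun y hy => cut_zero' ha hL hy) _ hy]

/-- step 1: Pohozaev bound -/
lemma core1 {τ : ℝ} (hτ : 0 < τ) {K C : ℝ} (hC : ∀ t, Sd t ≤ C) (hK0 : 0 ≤ K)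
    (hK : ∀ t ≤ -1, |F2τ τ t| ≤ K * fτ τ t)
    {m β B k a L r1 : ℝ} (hB : 0 ≤ B) (ha : 0 < a) (hL : 1 ≤ L) (hr : a * Real.exp L ≤ 1) (hr1 : a * Real.exp L < r1) (hk : 0 ≤ k)
    {V : Pl → ℝ} (hV : ContDiff ℝ (⊤ : ℕ∞) V)
    (hpde : ∀ y, y ≠ 0 → ‖y‖ < r1 → lap V y + k * fτ τ (UU m V y) = 0)
    (hst : ∀ φ : Pl → ℝ, ContDiff ℝ (⊤ : ℕ∞) φ → (∀ y, a * Real.exp L < ‖y‖ → φ y = 0) → 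
       0 ≤ ∫ y, (gradSq φ y - k * fτ' τ (UU m V y) * (φ y) ^ 2))
    (hcol : ∀ y : Pl, a ≤ ‖y‖ → ‖y‖ ≤ a * Real.exp L → 
      (∀ i, |pd V i y - 2 * (m + β) * (y i / ‖y‖ ^ 2)| ≤ B) ∧ k * fτ τ (UU m V y) ≤ B ∧ UU m V y ≤ -1) :
    k * ∫ y, cut a L y ^ 2 * F2τ τ (UU m V y) ≤ ((2 * |β| + 2 * B) ^ 2 * C * (2 * om) + 4 * C * K * B * om) / 4 / L := by
  have hL0 : 0 < L := by linarith
  have hψ := cut_smooth ha hL0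
  have hs : ∀ y : Pl, a * Real.exp L < ‖y‖ → cut a L y = 0 := fun y hy => cut_zero' ha hL0 hy
  have hC0 : 0 ≤ C := (Sd_nonneg 0).trans (hC 0)
  have hZ := smooth_ZZ m hV
  obtain ⟨KF, -, hKF⟩ := F_bdd hτ
  have P := poho hτ hr1 hV hpde hψ hs (hst _ (hZ.mul hψ) (fun y hy => by rw [hs y hy, mul_zero]))
  have hps : ∀ i y, a * Real.exp L < ‖y‖ → pd (cut a L) i y = 0 := fun i y hy => pd_eq_zero_of_notMem hs i hy
  have hp0 := sm_cont (smooth_pd hψ 0)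
  have hp1 := sm_cont (smooth_pd hψ 1)
  have hψc := sm_cont hψ
  have hZc := sm_cont hZ
  have I1 : Integrable fun y => ZZ m V y ^ 2 * gradSq (cut a L) y := by
    refine integ_cont (r := a * Real.exp L) ?_ (fun y hy => by simp [gradSq, hps _ y hy])
    unfold gradSq
    fun_prop
  have I3 : Integrable fun y => (cut a L y * (y 0 * pd (cut a L) 0 y + y 1 * pd (cut a L) 1 y)) * F2τ τ (UU m V y) := by
    refine integ_mul_UU (F_cont hτ) hKF m hV (r := a * Real.exp L) ?_ (fun y hy => by rw [hs y hy]; ring)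
    have := sm_cont (smooth_coord 0)
    have := sm_cont (smooth_coord 1)
    fun_prop
  have dich : ∀ y : Pl, Sd (Tl a L ‖y‖) = 0 ∨ (a ≤ ‖y‖ ∧ ‖y‖ ≤ a * Real.exp L) := by
    intro y
    by_cases h1 : ‖y‖ ≤ a
    · exact Or.inl (Sd_collar ha hL0 (Or.inl h1))
    by_cases h2 : a * Real.exp L ≤ ‖y‖
    · exact Or.inl (Sd_collar ha hL0 (Or.inr h2))
    exact Or.inr ⟨by linarith, by linarith⟩
  have T1 : ∫ y, ZZ m V y ^ 2 * gradSq (cut a L) y ≤ ((2 * |β| + 2 * B) ^ 2 * (C / L)) * (2 * om) := by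
    refine HI.mono (HI.of I1) ((HI_Sd ha hL0).const_mul ((2 * |β| + 2 * B) ^ 2 * (C / L))) fun y => ?_
    rcases dich y with h | ⟨h1, h2⟩
    · rw [gradSq_cut ha hL0, h]; simp
    have hy : y ≠ 0 := by rintro rfl; simp at h1; linarith
    have hn : ‖y‖ ^ 2 ≠ 0 := by simpa using hy
    have hc := (hcol y h1 h2).1
    have hZb : |ZZ m V y| ≤ 2 * |β| + 2 * B := by
      have e : ZZ m V y = 2 * β + y 0 * (pd V 0 y - 2 * (m + β) * (y 0 / ‖y‖ ^ 2)) + y 1 * (pd V 1 y - 2 * (m + β) * (y 1 / ‖y‖ ^ 2)) := by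
        have h := pl_norm_sq y
        have : y 0 * (y 0 / ‖y‖^2) + y 1 * (y 1 / ‖y‖^2) = 1 := by
          rw [h] at hn ⊢; field_simp
        unfold ZZ
        linear_combination (2 * (m + β)) * this
      rw [e]
      have hyi : ∀ i, |y i * (pd V i y - 2 * (m + β) * (y i / ‖y‖ ^ 2))| ≤ B := by
        intro i
        rw [abs_mul]
        have h3 : |y i| ≤ 1 := (abs_coord_le y i).trans (h2.trans hr)
        have := mul_le_mul h3 (hc i) (abs_nonneg _) zero_le_one
        linarith
      have h3 := abs_add_le (2 * β + y 0 * (pd V 0 y - 2 * (m + β) * (y 0 / ‖y‖ ^ 2))) (y 1 * (pd V 1 y - 2 * (m + β) * (y 1 / ‖y‖ ^ 2)))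
      have h4 := abs_add_le (2 * β) (y 0 * (pd V 0 y - 2 * (m + β) * (y 0 / ‖y‖ ^ 2)))
      have h5 : |2 * β| = 2 * |β| := by rw [abs_mul, abs_two]
      linarith [hyi 0, hyi 1]
    have hZ2 : ZZ m V y ^ 2 ≤ (2 * |β| + 2 * B) ^ 2 := by
      rw [← sq_abs]; gcongr
    rw [mul_assoc]
    refine mul_le_mul hZ2 (gradSq_cut_le ha hL0 hC y) (by unfold gradSq; positivity) (by positivity)
  have T2 : -(4 * k) * ∫ y, (cut a L y * (y 0 * pd (cut a L) 0 y + y 1 * pd (cut a L) 1 y)) * F2τ τ (UU m V y) ≤ (4 * (C / L) * (K * B)) * (1 ^ 2 * om) := by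
    refine HI.mono ((HI.of I3).const_mul (-(4 * k))) ((HI_ind zero_le_one).const_mul (4 * (C / L) * (K * B))) fun y => ?_
    rw [x_grad_cut ha hL0]
    rcases dich y with h | ⟨h1, h2⟩
    · rw [h]; simp
      have := ind_nonneg 1 y
      positivity
    obtain ⟨-, h3, h4⟩ := hcol y h1 h2
    rw [ind_one (h2.trans hr)]
    have h5 := hK _ h4
    have h6 : k * |F2τ τ (UU m V y)| ≤ K * B := by
      calc _ ≤ k * (K * fτ τ (UU m V y)) := by gcongr
        _ = K * (k * fτ τ (UU m V y)) := by ring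
        _ ≤ _ := by gcongr
    have h7 : cut a L y * (Sd (Tl a L ‖y‖) / L) ≤ C / L := by
      have := cut_le_one (a := a) (L := L) y
      have := cut_nonneg (a := a) (L := L) y
      have h8 : Sd (Tl a L ‖y‖) / L ≤ C / L := by gcongr; exact hC _
      have h9 : 0 ≤ Sd (Tl a L ‖y‖) / L := div_nonneg (Sd_nonneg _) hL0.le
      nlinarith
    have h9 : 0 ≤ cut a L y * (Sd (Tl a L ‖y‖) / L) := mul_nonneg (cut_nonneg y) (div_nonneg (Sd_nonneg _) hL0.le)
    calc _ = 4 * (cut a L y * (Sd (Tl a L ‖y‖) / L)) * (k * F2τ τ (UU m V y)) := by ring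
      _ ≤ 4 * (cut a L y * (Sd (Tl a L ‖y‖) / L)) * (k * |F2τ τ (UU m V y)|) := by
        gcongr; exact le_abs_self _
      _ ≤ 4 * (C / L) * (K * B) := by gcongr
      _ = _ := by ring
  have e : ((2 * |β| + 2 * B) ^ 2 * C * (2 * om) + 4 * C * K * B * om) / 4 / L = (((2 * |β| + 2 * B) ^ 2 * (C / L)) * (2 * om) + (4 * (C / L) * (K * B)) * (1 ^ 2 * om)) / 4 := by
    field_simp
  rw [e]
  linarith

lemma core2 {τ : ℝ} (hτ : 0 < τ) {K : ℝ} (hK1 : 1 ≤ K) (hKF : ∀ t, |F2τ τ t| ≤ K)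
    (hKe : ∀ t ≤ 0, Real.exp t ≤ K * F2τ τ t) 
    {m a L ε η X : ℝ} (ha : 0 < a) (hL : 0 < L) (hε : 0 < ε) (hη : 0 < η) 
    {V : Pl → ℝ} (hV : ContDiff ℝ (⊤ : ℕ∞) V)
    (hneg : ∀ y : Pl, ε * η ≤ ‖y‖ → ‖y‖ ≤ a * Real.exp L → UU m V y ≤ 0)
    (hX : (ε ^ 2)⁻¹ * ∫ y, cut a L y ^ 2 * F2τ τ (UU m V y) ≤ X) :
    (ε ^ 2)⁻¹ * ∫ y in {y : Pl | ε * η ≤ ‖y‖ ∧ ‖y‖ ≤ a}, Real.exp (UU m V y) ≤ K * X + K ^ 2 * om * η ^ 2 := by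
  have hexp : a ≤ a * Real.exp L := le_mul_of_one_le_right ha.le (Real.one_le_exp hL.le)
  have hεη : 0 < ε * η := by positivity
  have hAc : IsCompact {y : Pl | ε * η ≤ ‖y‖ ∧ ‖y‖ ≤ a} := by
    refine (isCompact_closedBall (0:Pl) a).of_isClosed_subset ?_ (fun y hy => by simpa using hy.2)
    exact (isClosed_le continuous_const continuous_norm).inter (isClosed_le continuous_norm continuous_const)
  have hA := hAc.measurableSet
  have hψc := sm_cont (cut_smooth ha hL)
  have I2 : Integrable fun y => cut a L y ^ 2 * F2τ τ (UU m V y) :=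
    integ_mul_UU (F_cont hτ) hKF m hV (r := a * Real.exp L) (by fun_prop) (fun y hy => by rw [cut_zero' ha hL hy]; ring)
  have IA : Integrable (({y : Pl | ε * η ≤ ‖y‖ ∧ ‖y‖ ≤ a}).indicator fun y => Real.exp (UU m V y)) := by
    rw [integrable_indicator_iff hA]
    refine ContinuousOn.integrableOn_compact hAc ((contOn_comp_UU Real.continuous_exp m hV).mono ?_)
    intro y hy h0
    rw [mem_singleton_iff] at h0
    have := hy.1
    rw [h0, norm_zero] at this
    linarith
  have hk : 0 < (ε ^ 2)⁻¹ := by positivity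
  have main := HI.mono (HI.of IA) (((HI.of I2).const_mul K).add ((HI_ind hεη.le).const_mul (K ^ 2))) (by
    intro y
    have hψ0 := cut_nonneg (a := a) (L := L) y
    have hψ1 := cut_le_one (a := a) (L := L) y
    have hF := abs_le.1 (hKF (UU m V y))
    have hi := ind_nonneg (ε * η) y
    have hrest : ∀ y : Pl, ε * η ≤ ‖y‖ → 0 ≤ K * (cut a L y ^ 2 * F2τ τ (UU m V y)) := by
      intro y hy
      by_cases hr : ‖y‖ ≤ a * Real.exp L
      · have := (Real.exp_pos _).le.trans (hKe _ (hneg y hy hr))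
        nlinarith [sq_nonneg (cut a L y)]
      · rw [cut_zero' ha hL (by linarith)]; simp
    by_cases hy : y ∈ {y : Pl | ε * η ≤ ‖y‖ ∧ ‖y‖ ≤ a}
    · rw [indicator_of_mem hy, cut_one ha hL hy.2]
      have := hKe _ (hneg y hy.1 (hy.2.trans hexp))
      nlinarith
    · rw [indicator_of_notMem hy]
      by_cases h1 : ε * η ≤ ‖y‖
      · have := hrest y h1
        positivity
      · rw [ind_one (by linarith)]
        have h2 : cut a L y ^ 2 ≤ 1 := by nlinarith
        have h3 : -K ≤ cut a L y ^ 2 * F2τ τ (UU m V y) := by nlinarith [sq_nonneg (cut a L y)]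
        nlinarith)
  rw [integral_indicator hA] at main
  have m2 := mul_le_mul_of_nonneg_left main hk.le
  have e : (ε ^ 2)⁻¹ * (K ^ 2 * ((ε * η) ^ 2 * om)) = K ^ 2 * om * η ^ 2 := by field_simp
  rw [mul_add, e] at m2
  have : (ε ^ 2)⁻¹ * (K * ∫ y, cut a L y ^ 2 * F2τ τ (UU m V y)) ≤ K * X := by
    calc _ = K * ((ε ^ 2)⁻¹ * ∫ y, cut a L y ^ 2 * F2τ τ (UU m V y)) := by ring
      _ ≤ _ := by gcongr
  linarith

lemma core3 {τ : ℝ} (hτ : 0 < τ) {K : ℝ} (hK1 : 1 ≤ K) (hKF : ∀ t, |F2τ τ t| ≤ K) (hKf : ∀ t, |fτ τ t| ≤ K)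
    (hKe : ∀ t ≤ 0, Real.exp t ≤ K * F2τ τ t) (hKe' : ∀ t ≤ 0, fτ τ t ≤ K * Real.exp t)
    {m a L ε η X : ℝ} (ha : 0 < a) (hL : 0 < L) (hε : 0 < ε) (hη : 0 < η) 
    {V : Pl → ℝ} (hV : ContDiff ℝ (⊤ : ℕ∞) V)
    (hneg : ∀ y : Pl, ε * η ≤ ‖y‖ → ‖y‖ ≤ a * Real.exp L → UU m V y ≤ 0)
    (hX : (ε ^ 2)⁻¹ * ∫ y, cut a L y ^ 2 * F2τ τ (UU m V y) ≤ X) :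
    |(ε ^ 2)⁻¹ * ∫ y, cut a L y ^ 2 * fτ τ (UU m V y)| ≤ K ^ 2 * X + (K + K ^ 3) * om * η ^ 2 := by
  have hεη : 0 < ε * η := by positivity
  have hψc := sm_cont (cut_smooth ha hL)
  have I2 : Integrable fun y => cut a L y ^ 2 * F2τ τ (UU m V y) :=
    integ_mul_UU (F_cont hτ) hKF m hV (r := a * Real.exp L) (by fun_prop) (fun y hy => by rw [cut_zero' ha hL hy]; ring)
  have If : Integrable fun y => cut a L y ^ 2 * fτ τ (UU m V y) :=
    integ_mul_UU (f_cont hτ) hKf m hV (r := a * Real.exp L) (by fun_prop) (fun y hy => by rw [cut_zero' ha hL hy]; ring)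
  have hk : 0 < (ε ^ 2)⁻¹ := by positivity
  have pw : ∀ y, |cut a L y ^ 2 * fτ τ (UU m V y)| ≤ K ^ 2 * (cut a L y ^ 2 * F2τ τ (UU m V y)) + (K + K ^ 3) * ind (ε * η) y := by
    intro y
    have hψ0 := cut_nonneg (a := a) (L := L) y
    have hψ1 := cut_le_one (a := a) (L := L) y
    have hF := abs_le.1 (hKF (UU m V y))
    have hf := hKf (UU m V y)
    have hi := ind_nonneg (ε * η) y
    have h2 : cut a L y ^ 2 ≤ 1 := by nlinarith
    have h20 := sq_nonneg (cut a L y)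
    by_cases h1 : ε * η ≤ ‖y‖
    · by_cases hr : ‖y‖ ≤ a * Real.exp L
      · have hn := hneg y h1 hr
        have h3 := hKe _ hn
        have h4 := hKe' _ hn
        have h5 := f_nonneg hτ hn
        have h6 : fτ τ (UU m V y) ≤ K ^ 2 * F2τ τ (UU m V y) := by nlinarith
        rw [abs_of_nonneg (by positivity)]
        have : cut a L y ^ 2 * fτ τ (UU m V y) ≤ K ^ 2 * (cut a L y ^ 2 * F2τ τ (UU m V y)) := by nlinarith
        have : 0 ≤ (K + K ^ 3) * ind (ε * η) y := by positivity
        linarith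
      · rw [cut_zero' ha hL (by linarith)]; simp; positivity
    · rw [ind_one (by linarith), abs_mul, abs_of_nonneg h20]
      have h3 : -K ≤ cut a L y ^ 2 * F2τ τ (UU m V y) := by nlinarith [sq_nonneg (cut a L y)]
      have h4 : cut a L y ^ 2 * |fτ τ (UU m V y)| ≤ K := by nlinarith [abs_nonneg (fτ τ (UU m V y))]
      have h5 : - K ^ 3 ≤ K ^ 2 * (cut a L y ^ 2 * F2τ τ (UU m V y)) := by nlinarith [sq_nonneg K]
      linarith
  have hR := ((HI.of I2).const_mul (K ^ 2)).add ((HI_ind hεη.le).const_mul (K + K ^ 3))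
  have main : |∫ y, cut a L y ^ 2 * fτ τ (UU m V y)| ≤ K ^ 2 * (∫ y, cut a L y ^ 2 * F2τ τ (UU m V y)) + (K + K ^ 3) * ((ε * η) ^ 2 * om) := by
    refine abs_integral_le_integral_abs.trans ?_
    exact HI.mono (HI.of If.abs) hR pw
  rw [abs_mul, abs_of_pos hk]
  have m2 := mul_le_mul_of_nonneg_left main hk.le
  have e : (ε ^ 2)⁻¹ * ((K + K ^ 3) * ((ε * η) ^ 2 * om)) = (K + K ^ 3) * om * η ^ 2 := by field_simp
  rw [mul_add, e] at m2
  have : (ε ^ 2)⁻¹ * (K ^ 2 * ∫ y, cut a L y ^ 2 * F2τ τ (UU m V y)) ≤ K ^ 2 * X := by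
    calc _ = K ^ 2 * ((ε ^ 2)⁻¹ * ∫ y, cut a L y ^ 2 * F2τ τ (UU m V y)) := by ring
      _ ≤ _ := by gcongr
  linarith

lemma core4 {m β B C a L : ℝ} (hC : ∀ t, Sd t ≤ C) (hB : 0 ≤ B) (ha : 0 < a) (hL : 1 ≤ L) 
    {V : Pl → ℝ} (hV : ContDiff ℝ (⊤ : ℕ∞) V)
    (hcol : ∀ y : Pl, a ≤ ‖y‖ → ‖y‖ ≤ a * Real.exp L → 
      (∀ i, |pd V i y - 2 * (m + β) * (y i / ‖y‖ ^ 2)| ≤ B)) :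
    |(∫ y, 2 * cut a L y * (pd (cut a L) 0 y * pd V 0 y + pd (cut a L) 1 y * pd V 1 y)) + 4 * om * (m + β)|
      ≤ B * (2 * C * om + 2 * om) * (a * Real.exp L) := by
  have hL0 : 0 < L := by linarith
  have hC0 : 0 ≤ C := (Sd_nonneg 0).trans (hC 0)
  set r := a * Real.exp L with hr
  have hr0 : 0 < r := by positivity
  have hψ := cut_smooth ha hL0
  have hp0 := sm_cont (smooth_pd hψ 0)
  have hp1 := sm_cont (smooth_pd hψ 1)
  have hv0 := sm_cont (smooth_pd hV 0)
  have hv1 := sm_cont (smooth_pd hV 1)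
  have hψc := sm_cont hψ
  have hs : ∀ y : Pl, r < ‖y‖ → cut a L y = 0 := fun y hy => cut_zero' ha hL0 hy
  have I : Integrable fun y => 2 * cut a L y * (pd (cut a L) 0 y * pd V 0 y + pd (cut a L) 1 y * pd V 1 y) :=
    integ_cont (r := r) (by fun_prop) (fun y hy => by rw [hs y hy]; ring)
  have J := (HI.of I).add ((HI_Sd2 ha hL0).const_mul (2 * (m + β)))
  have e : (∫ y, 2 * cut a L y * (pd (cut a L) 0 y * pd V 0 y + pd (cut a L) 1 y * pd V 1 y)) + 4 * om * (m + β) = 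
     (∫ y, 2 * cut a L y * (pd (cut a L) 0 y * pd V 0 y + pd (cut a L) 1 y * pd V 1 y)) + 2 * (m + β) * (2 * om) := by ring
  rw [e, ← J.2]
  refine abs_integral_le_integral_abs.trans ?_
  have R := ((HI_Sd ha hL0).const_mul (B * r * (C / L))).add ((HI_ind hr0.le).const_mul (2 * B / r))
  have main := HI.mono (HI.of J.1.abs) R (by
    intro y
    have hSn := Sd_nonneg (Tl a L ‖y‖)
    have hR0 : 0 ≤ B * r * (C / L) * (Sd (Tl a L ‖y‖) / (L * ‖y‖ ^ 2)) + 2 * B / r * ind r y := by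
      have := ind_nonneg r y
      positivity
    by_cases hcl : a ≤ ‖y‖ ∧ ‖y‖ ≤ r
    · obtain ⟨h1, h2⟩ := hcl
      have hc := hcol y h1 h2
      have hy : y ≠ 0 := by rintro rfl; simp at h1; linarith
      have hn : ‖y‖ ^ 2 ≠ 0 := by simpa using hy
      set d0 := pd V 0 y - 2 * (m + β) * (y 0 / ‖y‖ ^ 2) with hd0
      set d1 := pd V 1 y - 2 * (m + β) * (y 1 / ‖y‖ ^ 2) with hd1
      have e2 : 2 * cut a L y * (pd (cut a L) 0 y * pd V 0 y + pd (cut a L) 1 y * pd V 1 y) + 2 * (m + β) * (2 * cut a L y * Sd (Tl a L ‖y‖) / (L * ‖y‖ ^ 2)) =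
          2 * cut a L y * (pd (cut a L) 0 y * d0 + pd (cut a L) 1 y * d1) := by
        have hx := x_grad_cut ha hL0 y
        have hx2 : pd (cut a L) 0 y * (y 0 / ‖y‖ ^ 2) + pd (cut a L) 1 y * (y 1 / ‖y‖ ^ 2) = - (Sd (Tl a L ‖y‖) / (L * ‖y‖ ^ 2)) := by
          have : - (Sd (Tl a L ‖y‖) / (L * ‖y‖ ^ 2)) = - (Sd (Tl a L ‖y‖) / L) / ‖y‖^2 := by field_simp
          rw [this, ← hx]; ring
        rw [hd0, hd1]
        linear_combination (4 * cut a L y * (m + β)) * hx2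
      rw [e2, ind_one h2]
      have hg := gradSq_cut_le ha hL0 hC y
      unfold gradSq at hg
      set p0 := pd (cut a L) 0 y
      set p1 := pd (cut a L) 1 y
      have q : ∀ p : ℝ, |p| ≤ (r * p ^ 2 + 1 / r) / 2 := by
        intro p
        have : 0 ≤ (r * |p| - 1) ^ 2 / r := by positivity
        have e3 : (r * |p| - 1) ^ 2 / r = r * p ^ 2 - 2 * |p| + 1 / r := by
          rw [← sq_abs p]; field_simp; ring
        linarith
      have hb : |p0 * d0 + p1 * d1| ≤ B * (|p0| + |p1|) := by
        refine (abs_add_le _ _).trans ?_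
        rw [abs_mul, abs_mul]
        have := mul_le_mul_of_nonneg_left (hc 0) (abs_nonneg p0)
        have := mul_le_mul_of_nonneg_left (hc 1) (abs_nonneg p1)
        linarith
      have hψ0 := cut_nonneg (a := a) (L := L) y
      have hψ1 := cut_le_one (a := a) (L := L) y
      rw [abs_mul, abs_of_nonneg (show 0 ≤ 2 * cut a L y by positivity)]
      calc 2 * cut a L y * |p0 * d0 + p1 * d1| ≤ 2 * 1 * (B * (|p0| + |p1|)) := by gcongr
        _ ≤ 2 * 1 * (B * ((r * p0 ^ 2 + 1 / r) / 2 + (r * p1 ^ 2 + 1 / r) / 2)) := by gcongr <;> apply q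
        _ = B * r * (p0 ^ 2 + p1 ^ 2) + 2 * B / r * 1 := by field_simp; ring
        _ ≤ B * r * (C / L * (Sd (Tl a L ‖y‖) / (L * ‖y‖ ^ 2))) + 2 * B / r * 1 := by gcongr
        _ = _ := by ring
    · have hS : Sd (Tl a L ‖y‖) = 0 := by
        apply Sd_collar ha hL0
        by_contra hcon
        push Not at hcon
        exact hcl ⟨hcon.1.le, hcon.2.le⟩
      have : ∀ i, pd (cut a L) i y = 0 := fun i => by rw [pd_cut ha hL0, hS]; simp
      rw [this 0, this 1, hS]
      simp
      have := ind_nonneg r y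
      positivity)
  refine main.trans ?_
  have hom := om_pos
  have e5 : 2 * B / r * (r ^ 2 * om) = 2 * B * r * om := by field_simp
  rw [e5]
  have : C / L ≤ C := div_le_self hC0 hL
  have : B * r * (C / L) * (2 * om) ≤ B * r * C * (2 * om) := by gcongr
  linarith

theorem core {τ : ℝ} (hτ : 0 < τ) (m β B : ℝ) (hB : 0 ≤ B) : ∃ C > 0, ∀ (ε η a L r1 : ℝ) (V : Pl → ℝ),
    0 < ε → 0 < η → 0 < a → 1 ≤ L → a * Real.exp L ≤ 1 → a * Real.exp L < r1 → 
    ContDiff ℝ (⊤ : ℕ∞) V → 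
    (∀ y, y ≠ 0 → ‖y‖ < r1 → lap V y + (ε ^ 2)⁻¹ * fτ τ (UU m V y) = 0) → 
    (∀ φ : Pl → ℝ, ContDiff ℝ (⊤ : ℕ∞) φ → (∀ y, a * Real.exp L < ‖y‖ → φ y = 0) → 
       0 ≤ ∫ y, (gradSq φ y - (ε ^ 2)⁻¹ * fτ' τ (UU m V y) * (φ y) ^ 2)) → 
    (∀ y : Pl, a ≤ ‖y‖ → ‖y‖ ≤ a * Real.exp L → 
      (∀ i, |pd V i y - 2 * (m + β) * (y i / ‖y‖ ^ 2)| ≤ B) ∧ (ε ^ 2)⁻¹ * fτ τ (UU m V y) ≤ B ∧ UU m V y ≤ -1) → 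
    (∀ y : Pl, ε * η ≤ ‖y‖ → ‖y‖ ≤ a * Real.exp L → UU m V y ≤ 0) → 
    (ε ^ 2)⁻¹ * ∫ y in {y : Pl | ε * η ≤ ‖y‖ ∧ ‖y‖ ≤ a}, Real.exp (UU m V y) ≤ C * (1 / L + a * Real.exp L + η ^ 2) ∧ 
    |m + β| ≤ C * (1 / L + a * Real.exp L + η ^ 2) := by
  obtain ⟨K, hK1, hKf, hKF, hKe, hKe', hKc⟩ := tau_bounds hτ
  obtain ⟨C, hC0, hC⟩ := Sd_bdd
  have hom := om_pos
  have hK0 : 0 ≤ K := by linarith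
  set C1 := ((2 * |β| + 2 * B) ^ 2 * C * (2 * om) + 4 * C * K * B * om) / 4 with hC1
  have hC10 : 0 ≤ C1 := by positivity
  refine ⟨K * C1 + K ^ 2 * om + (K ^ 2 * C1 + (K + K ^ 3) * om + B * (2 * C * om + 2 * om)) / (4 * om), by positivity, ?_⟩
  intro ε η a L r1 V hε hη ha hL hr hr1 hV hpde hst hcol hneg
  have hL0 : 0 < L := by linarith
  have X := core1 hτ hC hK0 hKc hB ha hL hr hr1 (by positivity) hV hpde hst hcol
  rw [← hC1] at X
  have s2 := core2 hτ hK1 hKF hKe ha hL0 hε hη hV hneg X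
  have s3 := core3 hτ hK1 hKF hKf hKe hKe' ha hL0 hε hη hV hneg X
  have s4 := core4 (m := m) (β := β) hC hB ha hL hV fun y h1 h2 => (hcol y h1 h2).1
  have mi := mass_id hτ hr1 hV hpde (cut_smooth ha hL0) (fun y hy => cut_zero' ha hL0 hy)
  set r := a * Real.exp L
  have hr0 : 0 < r := by positivity
  have hiL : 0 < 1 / L := by positivity
  have hη2 : 0 < η ^ 2 := by positivity
  have eL : C1 / L = C1 * (1 / L) := by ring
  rw [eL] at s2 s3
  set D := (K ^ 2 * C1 + (K + K ^ 3) * om + B * (2 * C * om + 2 * om)) / (4 * om) with hD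
  have hD0 : 0 ≤ D := by positivity
  have hD' : K ^ 2 * C1 + (K + K ^ 3) * om + B * (2 * C * om + 2 * om) = 4 * om * D := by rw [hD]; field_simp
  have hKC : 0 ≤ K * C1 := by positivity
  have hKo : 0 ≤ K ^ 2 * om := by positivity
  set iL := 1 / L
  set E := η ^ 2
  have p1 := mul_nonneg hKC hr0.le
  have p2 := mul_nonneg hKC hη2.le
  have p3 := mul_nonneg hKo hr0.le
  have p4 := mul_nonneg hKo hiL.le
  have p5 := mul_nonneg hD0 (show 0 ≤ iL + r + E by positivity)
  have p6 := mul_nonneg hKC hiL.le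
  have p7 := mul_nonneg hKo hη2.le
  constructor
  · linarith
  · rw [← mi] at s4
    have h5 : |4 * om * (m + β)| ≤ 4 * om * D * (iL + r + E) := by
      have h6 := abs_sub_abs_le_abs_sub (4 * om * (m + β)) (-((ε ^ 2)⁻¹ * ∫ y, cut a L y ^ 2 * fτ τ (UU m V y)))
      rw [abs_neg, sub_neg_eq_add, add_comm (4 * om * (m + β))] at h6
      rw [← hD']
      have q1 : 0 ≤ K ^ 2 * C1 := by positivity
      have q2 : 0 ≤ (K + K ^ 3) * om := by positivity
      have q3 : 0 ≤ B * (2 * C * om + 2 * om) := by positivity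
      have := mul_nonneg q1 (show 0 ≤ r + E by positivity)
      have := mul_nonneg q2 (show 0 ≤ iL + r by positivity)
      have := mul_nonneg q3 (show 0 ≤ iL + E by positivity)
      linarith
    rw [abs_mul, abs_of_pos (show 0 < 4 * om by positivity), mul_assoc (4 * om) D] at h5
    have h7 := le_of_mul_le_mul_left h5 (show 0 < 4 * om by positivity)
    linarith

/-- smooth extension -/
lemma ext_smooth {s : Pl → ℝ} {R ρ : ℝ} (hs : ContDiffOn ℝ (⊤ : ℕ∞) s (ball 0 R)) (h0 : 0 < ρ) (hρ : ρ < R) :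
    ∃ t : Pl → ℝ, ContDiff ℝ (⊤ : ℕ∞) t ∧ (∀ y, ‖y‖ ≤ ρ → t y = s y) ∧ (∀ y, R < ‖y‖ → t y = 0) := by
  let b : ContDiffBump (0 : Pl) := ⟨ρ, (ρ + R) / 2, h0, by linarith⟩
  refine ⟨fun y => b y * s y, ?_, ?_, ?_⟩
  · rw [contDiff_iff_contDiffAt]
    intro y
    by_cases hy : ‖y‖ < R
    · exact b.contDiff.contDiffAt.mul (hs.contDiffAt (isOpen_ball.mem_nhds (by simpa using hy)))
    · have : (fun y => b y * s y) =ᶠ[𝓝 y] fun _ => 0 := by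
        have ho : IsOpen {z : Pl | (ρ + R) / 2 < ‖z‖} := isOpen_lt continuous_const continuous_norm
        filter_upwards [ho.mem_nhds (show (ρ + R) / 2 < ‖y‖ by linarith)] with z hz
        rw [b.zero_of_le_dist (by simpa using (le_of_lt hz)), zero_mul]
      exact contDiffAt_const.congr_of_eventuallyEq this
  · intro y hy
    show b y * s y = s y
    rw [b.one_of_mem_closedBall (by simpa using hy), one_mul]
  · intro y hy
    show b y * s y = 0
    rw [b.zero_of_le_dist (by simp only [dist_zero_right]; show (ρ + R)/2 ≤ _; linarith), zero_mul]

/-- mollifier profile -/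
def Nm (z : Pl) : ℝ := Real.smoothTransition (1 - ‖z‖ ^ 2)
def κm (z : Pl) : ℝ := 2 * Sd (1 - ‖z‖ ^ 2)

lemma Nm_smooth : ContDiff ℝ (⊤ : ℕ∞) Nm :=
  Real.smoothTransition.contDiff.comp (contDiff_const.sub (contDiff_norm_sq ℝ))

lemma Nm_zero {z : Pl} (h : 1 < ‖z‖) : Nm z = 0 :=
  Real.smoothTransition.zero_of_nonpos (by nlinarith)

lemma κm_cont : Continuous κm := by
  unfold κm
  exact continuous_const.mul (Sd_cont.comp (by fun_prop))

lemma κm_zero {z : Pl} (h : 1 < ‖z‖) : κm z = 0 := by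
  unfold κm; rw [Sd_zero_of_nonpos (by nlinarith), mul_zero]

lemma κm_nonneg (z : Pl) : 0 ≤ κm z := mul_nonneg two_pos.le (Sd_nonneg _)

lemma Nm_nonneg (z : Pl) : 0 ≤ Nm z := Real.smoothTransition.nonneg _

lemma pd_Nm (z : Pl) (i : Fin 2) : pd Nm i z = - (z i * κm z) := by
  have h1 : HasFDerivAt (fun y : Pl => 1 - ‖y‖ ^ 2) (-(2 • (innerSL ℝ z : Pl →L[ℝ] ℝ))) z := 
    (hasStrictFDerivAt_norm_sq z).hasFDerivAt.const_sub 1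
  have h2 := pd_comp h1.differentiableAt (S_hasDerivAt (1 - ‖z‖^2)) i
  show pd (fun y => Real.smoothTransition (1 - ‖y‖^2)) i z = _
  rw [h2, h1.pd_eq, κm]
  simp [ee, EuclideanSpace.inner_single_right]
  ring

lemma int_Nm_pos : 0 < ∫ z, Nm z := by
  refine Continuous.integral_pos_of_hasCompactSupport_nonneg_nonzero (x := (0:Pl)) (sm_cont Nm_smooth) ?_ Nm_nonneg ?_
  · refine HasCompactSupport.intro (isCompact_closedBall (0:Pl) 1) fun y hy => Nm_zero ?_
    simpa using hy
  · simp [Nm, Real.smoothTransition.one]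

lemma int_κm_pos : 0 < ∫ z, κm z := by
  have h : ∀ i, HI (fun z => pd Nm i z * z i + Nm z * pd (fun z => z i) i z) 0 := fun i =>
    A_int (r := 1) (smooth_coord i) Nm_smooth (fun y hy => Nm_zero hy) i
  have hI := integ_cont κm_cont (fun y hy => κm_zero hy)
  have hN : Integrable Nm := integ_cont (sm_cont Nm_smooth) (fun y hy => Nm_zero hy)
  have := HI.mono (((HI.of hN).const_mul 2).sub ((h 0).add (h 1))) (HI.of hI) (by
    intro z
    rw [pd_Nm, pd_Nm, pd_coord, pd_coord]
    simp only [if_true]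
    have h2 := pl_norm_sq z
    by_cases h3 : 1 < ‖z‖
    · rw [κm_zero h3, Nm_zero h3]; simp
    · have h4 : ‖z‖ ^ 2 ≤ 1 := by nlinarith [norm_nonneg z]
      have := κm_nonneg z
      nlinarith)
  have := int_Nm_pos
  linarith

lemma pd_scale {g : Pl → ℝ} (hg : ContDiff ℝ (⊤ : ℕ∞) g) (t : ℝ) (z : Pl) (i : Fin 2) :
    pd (fun z => g (t • z)) i z = t * pd g i (t • z) := by
  have h1 : HasFDerivAt (fun z : Pl => t • z) (t • ContinuousLinearMap.id ℝ Pl) z := 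
    (hasFDerivAt_id z).const_smul t
  have h2 := (sm_diff hg (t • z)).hasFDerivAt.comp z h1
  have h3 : HasFDerivAt (fun z => g (t • z)) ((fderiv ℝ g (t • z)).comp (t • ContinuousLinearMap.id ℝ Pl)) z := h2
  rw [h3.pd_eq, pd_eq_fderiv (sm_diff hg _)]
  simp

lemma mv0 {s : Pl → ℝ} {R ρ M : ℝ} (hs : ContDiff ℝ (⊤ : ℕ∞) s) (hz : ∀ y, R < ‖y‖ → s y = 0) (hρ : 0 < ρ)
    (hM : ∀ y, ‖y‖ ≤ ρ → -M ≤ lap s y) :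
    s 0 * ∫ z, κm z ≤ (∫ z, κm z * s (ρ • z)) + M * ρ ^ 2 / 2 * ∫ z, Nm z := by
  have hc := sm_cont hs
  have hp := fun i => sm_cont (smooth_pd hs i)
  have hp0 := hp 0
  have hp1 := hp 1
  have hκ := κm_cont
  have hN := sm_cont Nm_smooth
  have c0 := sm_cont (smooth_coord 0)
  have c1 := sm_cont (smooth_coord 1)
  obtain ⟨D0, hD0⟩ := bdd_of_cont (hp 0) (fun y hy => pd_eq_zero_of_notMem hz 0 hy)
  obtain ⟨D1, hD1⟩ := bdd_of_cont (hp 1) (fun y hy => pd_eq_zero_of_notMem hz 1 hy)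
  have hIN : Integrable Nm := integ_cont hN (fun y hy => Nm_zero hy)
  let A : ℝ → ℝ := fun t => ∫ z, κm z * s (t • z)
  let A' : ℝ → ℝ := fun t => ∫ z, κm z * (z 0 * pd s 0 (t • z) + z 1 * pd s 1 (t • z))
  have hA : ∀ t, HasDerivAt A (A' t) t := by
    intro t
    refine (hasDerivAt_integral_of_dominated_loc_of_deriv_le (𝕜 := ℝ) (μ := (volume : Measure Pl)) (F := fun t z => κm z * s (t • z)) (F' := fun t z => κm z * (z 0 * pd s 0 (t • z) + z 1 * pd s 1 (t • z))) (s := univ) (bound := fun z => κm z * (D0 + D1)) univ_mem ?_ ?_ ?_ ?_ ?_ ?_).2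
    · refine Eventually.of_forall fun x => Continuous.aestronglyMeasurable ?_
      fun_prop
    · exact integ_cont (r := 1) (by fun_prop) (fun y hy => by rw [κm_zero hy, zero_mul])
    · refine Continuous.aestronglyMeasurable ?_
      fun_prop
    · refine Eventually.of_forall fun z x _ => ?_
      rw [norm_mul, Real.norm_eq_abs, abs_of_nonneg (κm_nonneg z)]
      by_cases h1 : 1 < ‖z‖
      · rw [κm_zero h1]; simp
      · refine mul_le_mul_of_nonneg_left ?_ (κm_nonneg z)
        rw [Real.norm_eq_abs]
        have hz0 := (abs_coord_le z 0).trans (not_lt.1 h1)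
        have hz1 := (abs_coord_le z 1).trans (not_lt.1 h1)
        refine (abs_add_le _ _).trans ?_
        rw [abs_mul, abs_mul]
        have := mul_le_mul hz0 (hD0 (x • z)) (abs_nonneg _) zero_le_one
        have := mul_le_mul hz1 (hD1 (x • z)) (abs_nonneg _) zero_le_one
        linarith
    · exact integ_cont (r := 1) (by fun_prop) (fun y hy => by rw [κm_zero hy, zero_mul])
    · refine Eventually.of_forall fun z x _ => ?_
      have h1 : HasDerivAt (fun x : ℝ => x • z) z x := by simpa using (hasDerivAt_id x).smul_const z
      have h2 : HasDerivAt (fun x : ℝ => s (x • z)) (fderiv ℝ s (x • z) z) x := (sm_diff hs (x • z)).hasFDerivAt.comp_hasDerivAt x h1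
      have h3 : fderiv ℝ s (x • z) z = z 0 * pd s 0 (x • z) + z 1 * pd s 1 (x • z) := by
        rw [pd_eq_fderiv (sm_diff hs _), pd_eq_fderiv (sm_diff hs _)]
        have : z = z 0 • ee 0 + z 1 • ee 1 := by
          ext i; fin_cases i <;> simp [ee]
        generalize fderiv ℝ s (x • z) = ℓ
        conv_lhs => rw [this]
        simp only [map_add, map_smul, smul_eq_mul]
      rw [h3] at h2
      exact h2.const_mul _
  have hA' : ∀ t, 0 ≤ t → t ≤ ρ → -M * t * (∫ z, Nm z) ≤ A' t := by
    intro t ht htρ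
    have hl : ContDiff ℝ (⊤ : ℕ∞) (fun z : Pl => t • z) := contDiff_id.const_smul t
    have hv : ∀ i, ContDiff ℝ (⊤ : ℕ∞) (fun z => pd s i (t • z)) := fun i => (smooth_pd hs i).comp hl
    have a : ∀ i, HI (fun z => pd Nm i z * pd s i (t • z) + Nm z * pd (fun z => pd s i (t • z)) i z) 0 := fun i => 
      A_int (r := 1) (hv i) Nm_smooth (fun y hy => Nm_zero hy) i
    have hI : Integrable fun z => κm z * (z 0 * pd s 0 (t • z) + z 1 * pd s 1 (t • z)) := 
      integ_cont (r := 1) (by fun_prop) (fun y hy => by rw [κm_zero hy, zero_mul])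
    have := HI.mono ((HI.of hIN).const_mul (-M * t)) ((HI.of hI).add ((a 0).add (a 1))) (by
      intro z
      rw [pd_scale (smooth_pd hs 0), pd_scale (smooth_pd hs 1), pd_Nm, pd_Nm]
      have e : κm z * (z 0 * pd s 0 (t • z) + z 1 * pd s 1 (t • z)) + (-(z 0 * κm z) * pd s 0 (t • z) + Nm z * (t * pd (pd s 0) 0 (t • z)) + (-(z 1 * κm z) * pd s 1 (t • z) + Nm z * (t * pd (pd s 1) 1 (t • z)))) = t * Nm z * lap s (t • z) := by
        unfold lap; ring
      rw [e]
      by_cases h1 : 1 < ‖z‖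
      · rw [Nm_zero h1]; simp
      · have h2 : ‖t • z‖ ≤ ρ := by
          rw [norm_smul, Real.norm_eq_abs, abs_of_nonneg ht]
          have := not_lt.1 h1
          nlinarith [norm_nonneg z]
        have h3 := mul_le_mul_of_nonneg_left (hM _ h2) (mul_nonneg ht (Nm_nonneg z))
        linarith)
    simpa using this
  have hB : ∀ t, HasDerivAt (fun t => A t + M * t ^ 2 / 2 * ∫ z, Nm z) (A' t + M * t * ∫ z, Nm z) t := by
    intro t
    have h1 : HasDerivAt (fun t : ℝ => M * t ^ 2 / 2 * ∫ z, Nm z) (M * t * ∫ z, Nm z) t := by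
      have := (((hasDerivAt_pow 2 t).const_mul M).div_const 2).mul_const (∫ z, Nm z)
      exact this.congr_deriv (by push_cast; ring)
    exact (hA t).add h1
  have mono : MonotoneOn (fun t => A t + M * t ^ 2 / 2 * ∫ z, Nm z) (Icc 0 ρ) := by
    refine monotoneOn_of_deriv_nonneg (convex_Icc 0 ρ) (fun t _ => (hB t).continuousAt.continuousWithinAt) (fun t _ => (hB t).differentiableAt.differentiableWithinAt) ?_
    intro t ht
    rw [interior_Icc] at ht
    rw [(hB t).deriv]
    have := hA' t ht.1.le ht.2.le
    linarith
  have fin := mono (left_mem_Icc.2 hρ.le) (right_mem_Icc.2 hρ.le) hρ.le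
  have e0 : A 0 = s 0 * ∫ z, κm z := by
    show ∫ z, κm z * s ((0:ℝ) • z) = _
    simp only [zero_smul]
    rw [integral_mul_const, mul_comm]
  simp only [e0] at fin
  simpa using fin

lemma mv : ∃ c > 0, ∀ (s : Pl → ℝ) (R ρ M : ℝ), ContDiff ℝ (⊤ : ℕ∞) s → (∀ y, R < ‖y‖ → s y = 0) → 0 < ρ → 0 ≤ M →
    (∀ y, ‖y‖ ≤ ρ → -M ≤ lap s y) → (∀ y, ‖y‖ ≤ ρ → 0 ≤ s y) → 
    s 0 ≤ c * ((ρ ^ 2)⁻¹ * (∫ y in closedBall 0 ρ, s y) + M * ρ ^ 2) := by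
  obtain ⟨C, hC0, hC⟩ := Sd_bdd
  have hκ := int_κm_pos
  have hN := int_Nm_pos
  refine ⟨(2 * C + (∫ z, Nm z) / 2) / ∫ z, κm z, by positivity, ?_⟩
  intro s R ρ M hs hz hρ hM0 hM hpos
  have h := mv0 hs hz hρ hM
  have hsc := sm_cont hs
  have hI : IntegrableOn (fun z => s (ρ • z)) (closedBall 0 1) := 
    ContinuousOn.integrableOn_compact (isCompact_closedBall _ _) (by fun_prop)
  have h1 : ∫ z, κm z * s (ρ • z) ≤ 2 * C * ∫ z in closedBall (0:Pl) 1, s (ρ • z) := by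
    have hJ : Integrable ((closedBall (0:Pl) 1).indicator fun z => s (ρ • z)) := (integrable_indicator_iff measurableSet_closedBall).2 hI
    have hκc := κm_cont
    have := HI.mono (HI.of (integ_cont (r := 1) (g := fun z => κm z * s (ρ • z)) (by fun_prop) (fun y hy => by rw [κm_zero hy, zero_mul]))) ((HI.of hJ).const_mul (2 * C)) (by
      intro z
      by_cases h1 : 1 < ‖z‖
      · rw [κm_zero h1, indicator_of_notMem (by simpa using h1)]; simp
      · have h2 : ‖ρ • z‖ ≤ ρ := by
          rw [norm_smul, Real.norm_eq_abs, abs_of_pos hρ]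
          have := not_lt.1 h1
          nlinarith [norm_nonneg z]
        rw [indicator_of_mem (by simpa using h1)]
        refine mul_le_mul_of_nonneg_right ?_ (hpos _ h2)
        unfold κm
        linarith [hC (1 - ‖z‖ ^ 2)])
    rwa [integral_indicator measurableSet_closedBall] at this
  have h2 : ∫ z in closedBall (0:Pl) 1, s (ρ • z) = (ρ ^ 2)⁻¹ * ∫ y in closedBall 0 ρ, s y := by
    rw [Measure.setIntegral_comp_smul_of_pos volume s _ hρ, _root_.smul_closedBall _ _ zero_le_one]
    simp [abs_of_pos hρ]
  have h3 : 0 ≤ ∫ y in closedBall (0:Pl) ρ, s y := setIntegral_nonneg measurableSet_closedBall (fun y hy => hpos y (by simpa using hy))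
  rw [h2] at h1
  set I := (ρ ^ 2)⁻¹ * ∫ y in closedBall (0:Pl) ρ, s y
  have hI0 : 0 ≤ I := by positivity
  rw [div_mul_eq_mul_div, le_div_iff₀ hκ]
  have : 0 ≤ 2 * C * (M * ρ ^ 2) := by positivity
  have : 0 ≤ (∫ z, Nm z) / 2 * I := by positivity
  nlinarith

/-! ### Periodization of test functions -/

lemma mem_lat {v : Pl} : v ∈ unitLattice ↔ ∀ i, ∃ n : ℤ, v i = n := by
  constructor
  · rintro ⟨a, b, rfl⟩ i
    fin_cases i
    · exact ⟨a, by simp⟩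
    · exact ⟨b, by simp⟩
  · intro h
    obtain ⟨a, ha⟩ := h 0
    obtain ⟨b, hb⟩ := h 1
    refine ⟨a, b, ?_⟩
    ext i
    fin_cases i
    · simpa using ha
    · simpa using hb

def LatG : AddSubgroup Pl where
  carrier := unitLattice
  add_mem' := by
    intro a b ha hb
    rw [mem_lat] at *
    intro i
    obtain ⟨m, hm⟩ := ha i
    obtain ⟨n, hn⟩ := hb i
    exact ⟨m + n, by simp [hm, hn]⟩
  zero_mem' := by
    rw [mem_lat]
    intro i
    exact ⟨0, by simp⟩
  neg_mem' := by
    intro a ha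
    rw [mem_lat] at *
    intro i
    obtain ⟨m, hm⟩ := ha i
    exact ⟨-m, by simp [hm]⟩

def latv (n : Fin 2 → ℤ) : Pl := WithLp.toLp 2 (fun i => (n i : ℝ))

lemma latv_apply (n : Fin 2 → ℤ) (i : Fin 2) : latv n i = n i := rfl

lemma latv_mem (n : Fin 2 → ℤ) : latv n ∈ unitLattice := mem_lat.2 fun i => ⟨n i, rfl⟩

instance : Countable LatG := by
  refine Function.Surjective.countable (f := fun n : Fin 2 → ℤ => (⟨latv n, latv_mem n⟩ : LatG)) ?_
  rintro ⟨v, hv⟩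
  have hv' := mem_lat.1 hv
  choose n hn using hv'
  refine ⟨n, Subtype.ext ?_⟩
  ext i
  rw [latv_apply, hn]

def Sq (c : Pl) : Set Pl := {x | ∀ i, x i - c i ∈ Ico (0:ℝ) 1}

lemma Sq_meas (c : Pl) : MeasurableSet (Sq c) := by
  have : Sq c = ⋂ i, (fun x : Pl => x i - c i) ⁻¹' Ico (0:ℝ) 1 := by
    ext x; simp [Sq]
  rw [this]
  refine MeasurableSet.iInter fun i => ?_
  have : Continuous (fun x : Pl => x i - c i) := by
    have := sm_cont (smooth_coord i)
    fun_prop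
  exact this.measurable measurableSet_Ico

lemma Sq_fund (c : Pl) : IsAddFundamentalDomain LatG (Sq c) (volume : Measure Pl) := by
  refine IsAddFundamentalDomain.mk' (Sq_meas c).nullMeasurableSet ?_
  intro x
  refine ⟨⟨latv fun i => -⌊x i - c i⌋, latv_mem _⟩, ?_, ?_⟩
  · show (latv _ + x) ∈ Sq c
    intro i
    have : (latv (fun i => -⌊x i - c i⌋) + x) i - c i = Int.fract (x i - c i) := by
      rw [PiLp.add_apply, latv_apply, Int.fract]; push_cast; ring
    rw [this]
    exact ⟨Int.fract_nonneg _, Int.fract_lt_one _⟩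
  · rintro ⟨g, hg⟩ h
    refine Subtype.ext ?_
    ext i
    have h1 : (g + x) i - c i ∈ Ico (0:ℝ) 1 := h i
    obtain ⟨n, hn⟩ := mem_lat.1 hg i
    rw [PiLp.add_apply, hn] at h1
    show g i = latv _ i
    rw [latv_apply, hn]
    have : ⌊x i - c i⌋ = -n := by
      rw [Int.floor_eq_iff]
      push_cast
      constructor <;> linarith [h1.1, h1.2]
    rw [this]; simp

lemma fund_eq : fund = Sq 0 := by
  ext x
  simp [fund, Sq, Fin.forall_fin_two]

def rd (y : Pl) : Fin 2 → ℤ := fun i => ⌊y i + 1 / 2⌋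

def per (p : Pl) (φ : Pl → ℝ) (x : Pl) : ℝ := φ (x - p - latv (rd (x - p)))

lemma per_local {p : Pl} {φ : Pl → ℝ} {r : ℝ} (hr : r ≤ 1 / 4) (hφ : ∀ y, r < ‖y‖ → φ y = 0) (x0 : Pl) :
    per p φ =ᶠ[𝓝 x0] fun x => φ (x + (-p - latv (rd (x0 - p)))) := by
  filter_upwards [Metric.ball_mem_nhds x0 (show (0:ℝ) < 1 / 8 by norm_num)] with x hx
  have hx1 : ∀ i, |x i - x0 i| < 1 / 8 := fun i => by
    have := abs_coord_le (x - x0) i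
    rw [mem_ball, dist_eq_norm] at hx
    simpa using this.trans_lt hx
  unfold per
  have e1 : x + (-p - latv (rd (x0 - p))) = x - p - latv (rd (x0 - p)) := by abel
  rw [e1]
  by_cases h : rd (x - p) = rd (x0 - p)
  · rw [h]
  · obtain ⟨i, hi⟩ : ∃ i, rd (x - p) i ≠ rd (x0 - p) i := by
      by_contra! h'
      exact h (funext h')
    have z : ∀ y : Pl, 1 / 4 < |y i| → φ y = 0 := fun y hy => hφ y (hr.trans_lt (hy.trans_le (abs_coord_le y i)))
    have a1 := Int.floor_le ((x - p) i + 1 / 2)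
    have a2 := Int.lt_floor_add_one ((x - p) i + 1 / 2)
    have b1 := Int.floor_le ((x0 - p) i + 1 / 2)
    have b2 := Int.lt_floor_add_one ((x0 - p) i + 1 / 2)
    have hi' : ⌊(x - p) i + 1 / 2⌋ ≠ ⌊(x0 - p) i + 1 / 2⌋ := hi
    have hxi := abs_lt.1 (hx1 i)
    rw [z, z]
    · rw [PiLp.sub_apply, latv_apply]
      show 1 / 4 < |(x - p) i - (⌊(x0 - p) i + 1 / 2⌋ : ℝ)|
      rw [lt_abs]
      simp only [PiLp.sub_apply] at *
      rcases lt_or_gt_of_ne hi' with h1 | h1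
      · have : ((⌊x.ofLp i - p.ofLp i + 1 / 2⌋ + 1 : ℤ) : ℝ) ≤ (⌊x0.ofLp i - p.ofLp i + 1 / 2⌋ : ℝ) := Int.cast_le.2 (Int.add_one_le_of_lt h1)
        push_cast at this
        right; linarith
      · have : ((⌊x0.ofLp i - p.ofLp i + 1 / 2⌋ + 1 : ℤ) : ℝ) ≤ (⌊x.ofLp i - p.ofLp i + 1 / 2⌋ : ℝ) := Int.cast_le.2 (Int.add_one_le_of_lt h1)
        push_cast at this
        left; linarith
    · rw [PiLp.sub_apply, latv_apply]
      show 1 / 4 < |(x - p) i - (⌊(x - p) i + 1 / 2⌋ : ℝ)|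
      rw [lt_abs]
      simp only [PiLp.sub_apply] at *
      rcases lt_or_gt_of_ne hi' with h1 | h1
      · have : ((⌊x.ofLp i - p.ofLp i + 1 / 2⌋ + 1 : ℤ) : ℝ) ≤ (⌊x0.ofLp i - p.ofLp i + 1 / 2⌋ : ℝ) := Int.cast_le.2 (Int.add_one_le_of_lt h1)
        push_cast at this
        left; linarith
      · have : ((⌊x0.ofLp i - p.ofLp i + 1 / 2⌋ + 1 : ℤ) : ℝ) ≤ (⌊x.ofLp i - p.ofLp i + 1 / 2⌋ : ℝ) := Int.cast_le.2 (Int.add_one_le_of_lt h1)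
        push_cast at this
        right; linarith

lemma per_smooth {p : Pl} {φ : Pl → ℝ} {r : ℝ} (hr : r ≤ 1 / 4) (hs : ContDiff ℝ (⊤ : ℕ∞) φ) (hφ : ∀ y, r < ‖y‖ → φ y = 0) :
    ContDiff ℝ (⊤ : ℕ∞) (per p φ) := by
  rw [contDiff_iff_contDiffAt]
  intro x0
  refine ContDiffAt.congr_of_eventuallyEq ?_ (per_local hr hφ x0)
  exact (hs.comp (contDiff_id.add contDiff_const)).contDiffAt

lemma per_periodic (p : Pl) (φ : Pl → ℝ) : Periodic2 (per p φ) := by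
  intro x v hv
  obtain ⟨n, hn⟩ : ∃ n : Fin 2 → ℤ, ∀ i, v i = n i := by
    have := mem_lat.1 hv
    choose n hn using this
    exact ⟨n, hn⟩
  unfold per
  congr 1
  ext i
  simp only [PiLp.sub_apply, PiLp.add_apply, latv_apply, rd, hn]
  have : x i + (n i : ℝ) - p i + 1 / 2 = x i - p i + 1 / 2 + (n i : ℝ) := by ring
  rw [this, Int.floor_add_intCast]
  push_cast
  ring

def hlf : Pl := WithLp.toLp 2 (fun _ => (1 / 2 : ℝ))

lemma rd_Sq {p x : Pl} (hx : x ∈ Sq (p - hlf)) : latv (rd (x - p)) = 0 := by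
  ext i
  rw [latv_apply]
  have h := hx i
  have : rd (x - p) i = 0 := by
    unfold rd
    rw [Int.floor_eq_zero_iff]
    have e : (x - p) i + 1 / 2 = x i - (p - hlf) i := by
      simp [hlf]; ring
    rwa [e]
  rw [this]; simp

lemma gradSq_translate (u : Pl → ℝ) (p y : Pl) : gradSq (fun y => u (p + y)) y = gradSq u (p + y) := by
  unfold gradSq
  rw [pd_translate, pd_translate]

lemma gradSq_congr {u v : Pl → ℝ} {x : Pl} (h : u =ᶠ[𝓝 x] v) : gradSq u x = gradSq v x := by
  unfold gradSq
  rw [pd_congr h, pd_congr h]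

lemma stab_local {τ ε : ℝ} {u : Pl → ℝ} (hst : Stable τ ε u) (hp : Periodic2 u) (p : Pl) {φ : Pl → ℝ} {r : ℝ}
    (hr : r ≤ 1 / 4) (hs : ContDiff ℝ (⊤ : ℕ∞) φ) (hφ : ∀ y, r < ‖y‖ → φ y = 0) :
    0 ≤ ∫ y, (gradSq φ y - (ε ^ 2)⁻¹ * fτ' τ (u (p + y)) * (φ y) ^ 2) := by
  have h := hst _ (per_smooth (p := p) hr hs hφ) (per_periodic p φ)
  unfold QuadForm at h
  rw [fund_eq, (Sq_fund 0).setIntegral_eq (Sq_fund (p - hlf))] at h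
  · have e1 : ∀ x ∈ Sq (p - hlf), gradSq (per p φ) x - (ε ^ 2)⁻¹ * fτ' τ (u x) * (per p φ x) ^ 2 = 
        (fun y => gradSq φ y - (ε ^ 2)⁻¹ * fτ' τ (u (p + y)) * (φ y) ^ 2) (x - p) := by
      intro x hx
      have hl := per_local hr hφ (p := p) x
      rw [rd_Sq hx] at hl
      rw [gradSq_congr hl]
      have e2 : (fun x => φ (x + (-p - 0))) = fun x => φ (-p + x) := by
        funext x; congr 1; abel
      rw [e2, gradSq_translate]
      have e3 : per p φ x = φ (x - p) := by
        unfold per; rw [rd_Sq hx, sub_zero]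
      have e4 : -p + x = x - p := by abel
      have e5 : p + (x - p) = x := by abel
      simp only [e3, e4, e5]
    rw [setIntegral_congr_fun (Sq_meas _) e1, setIntegral_eq_integral_of_forall_compl_eq_zero, integral_sub_right_eq_self (μ := (volume : Measure Pl)) (fun y => gradSq φ y - (ε ^ 2)⁻¹ * fτ' τ (u (p + y)) * (φ y) ^ 2) p] at h
    · exact h
    · intro x hx
      have : r < ‖x - p‖ := by
        by_contra! h1
        apply hx
        intro i
        have := abs_le.1 ((abs_coord_le (x - p) i).trans (h1.trans hr))
        simp only [PiLp.sub_apply, hlf] at this ⊢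
        constructor <;> linarith [this.1, this.2]
      have p0 := pd_eq_zero_of_notMem hφ 0 this
      have p1 := pd_eq_zero_of_notMem hφ 1 this
      simp only [gradSq, p0, p1, hφ _ this]
      ring
  · rintro ⟨g, hg⟩ x
    show gradSq (per p φ) (g + x) - (ε ^ 2)⁻¹ * fτ' τ (u (g + x)) * (per p φ (g + x)) ^ 2 = _
    rw [add_comm g x, hp x g hg, per_periodic p φ x g hg, add_comm x g, ← gradSq_translate]
    have : (fun y => per p φ (g + y)) = per p φ := by
      funext y
      rw [add_comm, per_periodic p φ y g hg]
    rw [this]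

/-! ### Local representation, maximum principle, mean value inequality -/

lemma UU_smooth (m : ℝ) {V : Pl → ℝ} (hV : ContDiff ℝ (⊤ : ℕ∞) V) : ContDiffOn ℝ (⊤ : ℕ∞) (UU m V) {0}ᶜ := by
  intro y hy
  exact ((contDiffAt_const.mul (contDiffAt_log_norm hy)).add hV.contDiffAt).contDiffWithinAt

lemma pd_UU_diff (m : ℝ) {V : Pl → ℝ} (hV : ContDiff ℝ (⊤ : ℕ∞) V) (i : Fin 2) {y : Pl} (hy : y ≠ 0) :
    DifferentiableAt ℝ (pd (UU m V) i) y := 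
  ((contDiffOn_pd isOpen_compl_singleton (UU_smooth m hV) i).contDiffAt (isOpen_compl_singleton.mem_nhds hy)).differentiableAt (by simp)

lemma lap_UU (m : ℝ) {V : Pl → ℝ} (hV : ContDiff ℝ (⊤ : ℕ∞) V) {y : Pl} (hy : y ≠ 0) :
    lap (UU m V) y = lap V y := by
  have hlog : ContDiffOn ℝ (⊤ : ℕ∞) (fun y : Pl => Real.log ‖y‖) {0}ᶜ := fun z hz => (contDiffAt_log_norm hz).contDiffWithinAt
  have key : ∀ i, pd (pd (UU m V) i) i y = (-2 * m) * pd (pd (fun y : Pl => Real.log ‖y‖) i) i y + pd (pd V i) i y := by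
    intro i
    have h1 : pd (UU m V) i =ᶠ[𝓝 y] fun z => (-2 * m) * pd (fun y : Pl => Real.log ‖y‖) i z + pd V i z := by
      filter_upwards [isOpen_compl_singleton.mem_nhds (show y ∈ ({0} : Set Pl)ᶜ from hy)] with z hz
      rw [pd_UU m hV hz, pd_log_norm hz]
    have h2 : DifferentiableAt ℝ (pd (fun y : Pl => Real.log ‖y‖) i) y := 
      ((contDiffOn_pd isOpen_compl_singleton hlog i).contDiffAt (isOpen_compl_singleton.mem_nhds hy)).differentiableAt (by simp)
    rw [pd_congr h1, pd_add (h2.const_mul _) (sm_diff (smooth_pd hV i) y), pd_const_mul _ h2]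
  have := lap_log_norm hy
  unfold lap at *
  rw [key, key]
  linear_combination (-2 * m) * this

lemma local_V {u : Pl → ℝ} {p : Pl} {r0 r1 m : ℝ} (hu : ContDiffOn ℝ (⊤ : ℕ∞) u (ball p r0 \ {p}))
    (hs : LogSing u p (-m)) (h1 : 0 < r1) (h10 : r1 < r0) :
    ∃ V : Pl → ℝ, ContDiff ℝ (⊤ : ℕ∞) V ∧ ∀ y, y ≠ 0 → ‖y‖ ≤ r1 → UU m V y = u (p + y) := by
  obtain ⟨r, hr, v, hv, huv⟩ := hs
  let W : Pl → ℝ := fun y => if y = 0 then v p else u (p + y) + 2 * m * Real.log ‖y‖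
  have hsm : ContDiff ℝ (⊤ : ℕ∞) (fun y : Pl => p + y) := contDiff_const.add contDiff_id
  have hW : ContDiffOn ℝ (⊤ : ℕ∞) W (ball 0 r0) := by
    intro y hy
    refine ContDiffAt.contDiffWithinAt ?_
    rw [mem_ball_zero_iff] at hy
    by_cases hy0 : y = 0
    · subst hy0
      have e : W =ᶠ[𝓝 0] fun y => v (p + y) := by
        filter_upwards [ball_mem_nhds (0:Pl) hr] with z hz
        rw [mem_ball_zero_iff] at hz
        by_cases h : z = 0
        · simp [W, h]
        · simp only [W, if_neg h]
          rw [huv (p + z) (by simpa [mem_ball, dist_eq_norm] using hz) (by simpa using h)]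
          simp
      refine ContDiffAt.congr_of_eventuallyEq ?_ e
      refine ContDiffAt.comp (0:Pl) (g := v) ?_ hsm.contDiffAt
      refine hv.contDiffAt (isOpen_ball.mem_nhds ?_)
      simpa using hr
    · have e : W =ᶠ[𝓝 y] fun y => u (p + y) + 2 * m * Real.log ‖y‖ := by
        filter_upwards [isOpen_compl_singleton.mem_nhds (show y ∈ ({0} : Set Pl)ᶜ from hy0)] with z hz
        have hz' : z ≠ 0 := hz
        simp only [W, if_neg hz']
      refine ContDiffAt.congr_of_eventuallyEq ?_ e
      refine ContDiffAt.add ?_ (contDiffAt_const.mul (contDiffAt_log_norm hy0))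
      refine ContDiffAt.comp y (g := u) ?_ hsm.contDiffAt
      refine hu.contDiffAt ((isOpen_ball.sdiff isClosed_singleton).mem_nhds ⟨?_, ?_⟩)
      · simpa [mem_ball, dist_eq_norm] using hy
      · simpa using hy0
  obtain ⟨V, hV, hVW, -⟩ := ext_smooth hW h1 h10
  refine ⟨V, hV, fun y hy hy1 => ?_⟩
  unfold UU
  rw [hVW y hy1]
  simp only [W, if_neg hy]
  ring

lemma sec_deriv {U : Pl → ℝ} {y : Pl} (hc : ContinuousAt U y) (hm : IsLocalMax U y) (i : Fin 2) : pd (pd U i) i y ≤ 0 := by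
  by_contra! h
  let g : ℝ → ℝ := fun t => U (y + t • EuclideanSpace.single i (1:ℝ))
  have hpd : ∀ t, pd U i (y + t • EuclideanSpace.single i (1:ℝ)) = deriv g t := by
    intro t
    unfold pd lineDeriv
    have : (fun s : ℝ => U (y + t • EuclideanSpace.single i (1:ℝ) + s • EuclideanSpace.single i (1:ℝ))) = fun s => g (t + s) := by
      funext s
      simp only [g, add_smul, add_assoc]
    rw [this, deriv_comp_const_add, add_zero]
  have h2 : pd (pd U i) i y = deriv (deriv g) 0 := by
    have : pd (pd U i) i y = deriv (fun t : ℝ => pd U i (y + t • EuclideanSpace.single i (1:ℝ))) 0 := rfl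
    rw [this]
    congr 1
    funext t
    exact hpd t
  rw [h2] at h
  have hl : ContinuousAt (fun t : ℝ => y + t • (EuclideanSpace.single i (1:ℝ) : Pl)) 0 := by fun_prop
  have hy : y + (0:ℝ) • (EuclideanSpace.single i (1:ℝ) : Pl) = y := by simp
  have hgc : ContinuousAt g 0 := ContinuousAt.comp (g := U) (by rw [hy]; exact hc) hl
  have hgm : IsLocalMax g 0 := by
    have ht : Tendsto (fun t : ℝ => y + t • (EuclideanSpace.single i (1:ℝ) : Pl)) (𝓝 0) (𝓝 y) := by
      have := hl.tendsto
      rwa [hy] at this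
    have := ht.eventually hm
    simpa [IsLocalMax, IsMaxFilter, g] using this
  have hmin := isLocalMin_of_deriv_deriv_pos h hgm.deriv_eq_zero hgc
  have hconst : g =ᶠ[𝓝 0] fun _ => g 0 := by
    filter_upwards [hgm, hmin] with t a b
    exact le_antisymm a b
  have h3 := hconst.deriv.deriv_eq
  rw [h3] at h
  simp at h

lemma max_princ {τ : ℝ} (hτ : 0 < τ) {m ε r1 α b : ℝ} {V : Pl → ℝ} (hε : 0 < ε) (hV : ContDiff ℝ (⊤ : ℕ∞) V)
    (hpde : ∀ y, y ≠ 0 → ‖y‖ < r1 → lap V y + (ε ^ 2)⁻¹ * fτ τ (UU m V y) = 0) (hα : 0 < α) (hb : b < r1)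
    (h1 : ∀ y, ‖y‖ = α → UU m V y ≤ 0) (h2 : ∀ y, ‖y‖ = b → UU m V y ≤ 0) :
    ∀ y, α ≤ ‖y‖ → ‖y‖ ≤ b → UU m V y ≤ 0 := by
  intro y hy1 hy2
  by_contra! hpos
  have hK : IsCompact (closedBall (0:Pl) b ∩ {y | α ≤ ‖y‖}) := 
    (isCompact_closedBall 0 b).inter_right (isClosed_le continuous_const continuous_norm)
  have hc : ContinuousOn (UU m V) (closedBall (0:Pl) b ∩ {y | α ≤ ‖y‖}) := by
    refine (UU_contOn m hV).mono ?_
    rintro z ⟨_, hz⟩ h0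
    rw [mem_singleton_iff] at h0
    simp [h0] at hz
    linarith
  obtain ⟨y0, ⟨hy0b, hy0a⟩, hmax⟩ := hK.exists_isMaxOn ⟨y, by simpa using hy2, hy1⟩ hc
  have hp0 : 0 < UU m V y0 := hpos.trans_le (hmax ⟨by simpa using hy2, hy1⟩)
  rw [mem_closedBall_zero_iff] at hy0b
  have hα0 : α < ‖y0‖ := lt_of_le_of_ne hy0a fun h => absurd (h1 y0 h.symm) (not_le.2 hp0)
  have hb0 : ‖y0‖ < b := lt_of_le_of_ne hy0b fun h => absurd (h2 y0 h) (not_le.2 hp0)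
  have hne : y0 ≠ 0 := norm_pos_iff.1 (hα.trans hα0)
  have hloc : IsLocalMax (UU m V) y0 := by
    refine hmax.isLocalMax ?_
    filter_upwards [(isOpen_lt continuous_norm continuous_const).mem_nhds hb0, (isOpen_lt continuous_const continuous_norm).mem_nhds hα0] with z hz1 hz2
    exact ⟨by simpa using (le_of_lt hz1), le_of_lt hz2⟩
  have hca := (UU_diff m hV hne).continuousAt
  have e0 := sec_deriv hca hloc 0
  have e1 := sec_deriv hca hloc 1
  have e2 := lap_UU m hV hne
  have e3 := hpde y0 hne (hb0.trans hb)
  have e4 := f_neg hτ hp0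
  have e5 : (ε ^ 2)⁻¹ * fτ τ (UU m V y0) < 0 := mul_neg_of_pos_of_neg (by positivity) e4
  unfold lap at e2 e3
  linarith

lemma mvU {τ : ℝ} (hτ : 0 < τ) : ∃ c > 0, ∀ (m ε r1 ρ : ℝ) (V : Pl → ℝ) (x : Pl), 0 < ε → ContDiff ℝ (⊤ : ℕ∞) V →
    (∀ y, y ≠ 0 → ‖y‖ < r1 → lap V y + (ε ^ 2)⁻¹ * fτ τ (UU m V y) = 0) → 0 < ρ → ρ < ‖x‖ → ‖x‖ + ρ < r1 →
    (∀ y ∈ closedBall x ρ, UU m V y ≤ 0) → 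
    exp (UU m V x) ≤ c * ((ρ ^ 2)⁻¹ * (∫ y in closedBall x ρ, exp (UU m V y)) + (ε ^ 2)⁻¹ * ρ ^ 2) := by
  obtain ⟨c, hc, hmv⟩ := mv
  obtain ⟨K, hK1, hKf, -⟩ := tau_bounds hτ
  refine ⟨c * K, by positivity, ?_⟩
  intro m ε r1 ρ V x hε hV hpde hρ hρx hr1 hU
  have hsm : ContDiff ℝ (⊤ : ℕ∞) (fun y : Pl => x + y) := contDiff_const.add contDiff_id
  have hxy : ∀ y : Pl, ‖y‖ < ‖x‖ → x + y ≠ 0 := by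
    intro y hy h
    have : x = -y := eq_neg_of_add_eq_zero_left h
    rw [this, norm_neg] at hy
    exact lt_irrefl _ hy
  have hs : ContDiffOn ℝ (⊤ : ℕ∞) (fun y => exp (UU m V (x + y))) (ball 0 ‖x‖) := by
    intro y hy
    rw [mem_ball_zero_iff] at hy
    refine ContDiffAt.contDiffWithinAt ?_
    refine ContDiffAt.exp ?_
    refine ContDiffAt.comp y (g := UU m V) ?_ hsm.contDiffAt
    exact (UU_smooth m hV).contDiffAt (isOpen_compl_singleton.mem_nhds (hxy y hy))
  obtain ⟨t, ht, hts, ht0⟩ := ext_smooth hs (show 0 < (ρ + ‖x‖) / 2 by linarith) (show (ρ + ‖x‖) / 2 < ‖x‖ by linarith)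
  have hUball : ∀ y : Pl, ‖y‖ ≤ ρ → UU m V (x + y) ≤ 0 := fun y hy => hU _ (by simpa [mem_closedBall, dist_eq_norm] using hy)
  have hε2 : 0 < (ε ^ 2)⁻¹ := by positivity
  have h := hmv t ‖x‖ ρ (K * (ε ^ 2)⁻¹) ht ht0 hρ (by positivity) ?_ ?_
  · rw [hts 0 (by simp; positivity), add_zero] at h
    have e1 : ∫ y in closedBall (0:Pl) ρ, t y = ∫ y in closedBall x ρ, exp (UU m V y) := by
      have e2 : ∫ y in closedBall (0:Pl) ρ, t y = ∫ y in closedBall (0:Pl) ρ, exp (UU m V (x + y)) := by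
        refine setIntegral_congr_fun measurableSet_closedBall fun y hy => ?_
        rw [mem_closedBall_zero_iff] at hy
        exact hts y (by linarith)
      rw [e2, ← integral_indicator measurableSet_closedBall, ← integral_indicator measurableSet_closedBall, 
        ← integral_add_left_eq_self (μ := (volume : Measure Pl)) ((closedBall x ρ).indicator fun y => exp (UU m V y)) x]
      congr 1
      funext y
      by_cases hy : ‖y‖ ≤ ρ
      · rw [indicator_of_mem (by simpa using hy), indicator_of_mem (by simpa [mem_closedBall, dist_eq_norm] using hy)]
      · rw [indicator_of_notMem (by simpa using hy), indicator_of_notMem (by simpa [mem_closedBall, dist_eq_norm] using hy)]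
    rw [e1] at h
    refine h.trans ?_
    rw [mul_assoc c K]
    refine mul_le_mul_of_nonneg_left ?_ hc.le
    have : 0 ≤ (ρ ^ 2)⁻¹ * ∫ y in closedBall x ρ, exp (UU m V y) := 
      mul_nonneg (by positivity) (setIntegral_nonneg measurableSet_closedBall fun y _ => (exp_pos _).le)
    nlinarith
  · intro y hy
    have hyx : ‖y‖ < ‖x‖ := by linarith
    have e1 : t =ᶠ[𝓝 y] fun y => exp (UU m V (x + y)) := by
      filter_upwards [(isOpen_lt continuous_norm continuous_const).mem_nhds (show ‖y‖ < (ρ + ‖x‖) / 2 by linarith)] with z hz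
      exact hts z (le_of_lt hz)
    have hne := hxy y hyx
    rw [lap_congr e1, lap_translate (fun z => exp (UU m V z)) x y]
    have e2 : ∀ i, pd (pd (fun z => exp (UU m V z)) i) i (x + y) = exp (UU m V (x + y)) * ((pd (UU m V) i (x + y)) ^ 2 + pd (pd (UU m V) i) i (x + y)) := by
      intro i
      have e3 : pd (fun z => exp (UU m V z)) i =ᶠ[𝓝 (x + y)] fun z => exp (UU m V z) * pd (UU m V) i z := by
        filter_upwards [isOpen_compl_singleton.mem_nhds (show x + y ∈ ({0} : Set Pl)ᶜ from hne)] with z hz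
        exact pd_comp (UU_diff m hV hz) (Real.hasDerivAt_exp _) i
      rw [pd_congr e3, pd_mul (UU_diff m hV hne).exp (pd_UU_diff m hV i hne), pd_comp (UU_diff m hV hne) (Real.hasDerivAt_exp _) i]
      ring
    have hxr : ‖x + y‖ < r1 := (norm_add_le _ _).trans_lt (by linarith)
    have e4 := hpde _ hne hxr
    rw [← lap_UU m hV hne] at e4
    unfold lap at e4 ⊢
    rw [e2, e2]
    set s := exp (UU m V (x + y))
    have hs0 : 0 < s := exp_pos _
    have hs1 : s ≤ 1 := by
      rw [exp_le_one_iff]; exact hUball y hy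
    have hf := (abs_le.1 (hKf (UU m V (x + y)))).2
    have e5 : pd (pd (UU m V) 0) 0 (x + y) + pd (pd (UU m V) 1) 1 (x + y) = -((ε ^ 2)⁻¹ * fτ τ (UU m V (x + y))) := by linarith
    have e6 : (ε ^ 2)⁻¹ * fτ τ (UU m V (x + y)) ≤ (ε ^ 2)⁻¹ * K := mul_le_mul_of_nonneg_left hf hε2.le
    have e7 : s * ((ε ^ 2)⁻¹ * fτ τ (UU m V (x + y))) ≤ (ε ^ 2)⁻¹ * K := by
      refine (mul_le_mul_of_nonneg_left e6 hs0.le).trans ?_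
      exact mul_le_of_le_one_left (by positivity) hs1
    have e8 : 0 ≤ s * ((pd (UU m V) 0 (x + y)) ^ 2 + (pd (UU m V) 1 (x + y)) ^ 2) := by positivity
    have e9 : s * (pd (UU m V) 0 (x + y) ^ 2 + pd (pd (UU m V) 0) 0 (x + y)) + s * (pd (UU m V) 1 (x + y) ^ 2 + pd (pd (UU m V) 1) 1 (x + y)) = s * ((pd (UU m V) 0 (x + y)) ^ 2 + (pd (UU m V) 1 (x + y)) ^ 2) + s * (pd (pd (UU m V) 0) 0 (x + y) + pd (pd (UU m V) 1) 1 (x + y)) := by ring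
    rw [e9, e5]
    linarith
  · intro y hy
    rw [hts y (by linarith)]
    exact (exp_pos _).le

/-! ### Assembly -/

lemma TendstoC2LocOn.unif {u : ℕ → Pl → ℝ} {w : Pl → ℝ} {s K : Set Pl} (h : TendstoC2LocOn u w s) (hK : IsCompact K) (hKs : K ⊆ s) :
    ∀ᶠ n in atTop, ∀ x ∈ K, (∀ i, |pd (u n) i x - pd w i x| ≤ 1) ∧ |lap (u n) x - lap w x| ≤ 2 := by
  obtain ⟨-, h1, h2⟩ := h
  have a1 : ∀ i, ∀ᶠ n in atTop, ∀ x ∈ K, |pd (u n) i x - pd w i x| ≤ 1 := fun i => by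
    have := (tendstoLocallyUniformlyOn_iff_tendstoUniformlyOn_of_compact hK).1 ((h1 i).mono hKs)
    filter_upwards [Metric.tendstoUniformlyOn_iff.1 this 1 one_pos] with n hn x hx
    have := hn x hx
    rw [dist_comm, Real.dist_eq] at this
    exact this.le
  have a2 : ∀ i, ∀ᶠ n in atTop, ∀ x ∈ K, |pd (pd (u n) i) i x - pd (pd w i) i x| ≤ 1 := fun i => by
    have := (tendstoLocallyUniformlyOn_iff_tendstoUniformlyOn_of_compact hK).1 ((h2 i i).mono hKs)
    filter_upwards [Metric.tendstoUniformlyOn_iff.1 this 1 one_pos] with n hn x hx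
    have := hn x hx
    rw [dist_comm, Real.dist_eq] at this
    exact this.le
  filter_upwards [a1 0, a1 1, a2 0, a2 1] with n b0 b1 c0 c1 x hx
  refine ⟨?_, ?_⟩
  · intro i
    fin_cases i
    · exact b0 x hx
    · exact b1 x hx
  · have e : lap (u n) x - lap w x = (pd (pd (u n) 0) 0 x - pd (pd w 0) 0 x) + (pd (pd (u n) 1) 1 x - pd (pd w 1) 1 x) := by
      unfold lap; ring
    rw [e]
    refine (abs_add_le _ _).trans ?_
    linarith [c0 x hx, c1 x hx]


lemma unify (V : VortexData) (τ : ℝ) (ε : ℕ → ℝ) (u : ℕ → Pl → ℝ) (β : Fin V.d₂ → ℝ)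
    (hcase : (∃ w : Pl → ℝ, Case1 V τ ε u β w) ∨ (∃ x₀ : Pl, ∃ g : Pl → ℝ, Case2 V u β x₀ g)) (j : Fin V.d₂) :
    ∃ (cn : ℕ → ℝ) (W : Pl → ℝ), TendstoC2LocOn (fun n x => u n x - cn n) W (V.Z2)ᶜ ∧ ContDiffOn ℝ (⊤ : ℕ∞) W (V.Z)ᶜ ∧
      LogSing W (V.p₂ j) (β j) := by
  rcases hcase with ⟨w, h⟩ | ⟨x0, g, h⟩
  · exact ⟨_, w, h.1, h.2.2.1, h.2.2.2.2.2 j⟩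
  · exact ⟨_, g, h.2.1, h.2.2.2.1, h.2.2.2.2.2.2 j⟩

lemma iso_notMem {V : VortexData} {j : Fin V.d₂} {r₀ : ℝ} (hiso : closedBall (V.p₂ j) r₀ ∩ V.Z = {V.p₂ j}) {y : Pl}
    (hy : y ≠ 0) (hy1 : ‖y‖ ≤ r₀) : V.p₂ j + y ∉ V.Z := by
  intro h
  have : V.p₂ j + y ∈ closedBall (V.p₂ j) r₀ ∩ V.Z := ⟨by simpa [mem_closedBall, dist_eq_norm] using hy1, h⟩
  rw [hiso] at this
  simp at this
  exact hy this

lemma iso_sub {V : VortexData} {j : Fin V.d₂} {r₀ : ℝ} (hiso : closedBall (V.p₂ j) r₀ ∩ V.Z = {V.p₂ j}) :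
    ball (V.p₂ j) r₀ \ {V.p₂ j} ⊆ (V.Z)ᶜ := by
  rintro x ⟨hx, hxp⟩ hz
  have : x ∈ closedBall (V.p₂ j) r₀ ∩ V.Z := ⟨ball_subset_closedBall hx, hz⟩
  rw [hiso] at this
  exact hxp this

lemma up_lemma (V : VortexData) (ε : ℕ → ℝ) (hε : ∀ n, 0 < ε n) (hε0 : Tendsto ε atTop (nhds 0)) (u : ℕ → Pl → ℝ) 
    (hupper : ∀ r > 0, ∃ c > 0, ∀ n : ℕ, ∀ x : Pl, (∀ y ∈ V.Z2, r ≤ dist x y) →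
        u n x - 2 * Real.log (ε n) < c)
    (j : Fin V.d₂) (r₀ : ℝ) (hiso : closedBall (V.p₂ j) r₀ ∩ V.Z = {V.p₂ j}) {δ r : ℝ} (hδ : 0 < δ) (hr : r < r₀) (M : ℝ) :
    ∀ᶠ n in atTop, ∀ y : Pl, δ ≤ ‖y‖ → ‖y‖ ≤ r → u n (V.p₂ j + y) ≤ M := by
  obtain ⟨c, hc, h⟩ := hupper (min δ (r₀ - r)) (lt_min hδ (by linarith))
  have hlog : Tendsto (fun n => Real.log (ε n)) atTop atBot := 
    Real.tendsto_log_nhdsGT_zero.comp (tendsto_nhdsWithin_iff.2 ⟨hε0, Eventually.of_forall hε⟩)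
  filter_upwards [hlog.eventually_le_atBot ((M - c) / 2)] with n hn y h1 h2
  have := h n (V.p₂ j + y) ?_
  · linarith
  · intro z hz
    by_cases hzp : z = V.p₂ j
    · subst hzp
      refine (min_le_left _ _).trans ?_
      simpa [dist_eq_norm] using h1
    · refine (min_le_right _ _).trans ?_
      have hz1 : r₀ < dist z (V.p₂ j) := by
        by_contra! h3
        have : z ∈ closedBall (V.p₂ j) r₀ ∩ V.Z := ⟨h3, Or.inr hz⟩
        rw [hiso] at this
        exact hzp this
      have h4 := dist_triangle z (V.p₂ j + y) (V.p₂ j)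
      have h5 : dist (V.p₂ j + y) (V.p₂ j) = ‖y‖ := by simp [dist_eq_norm]
      rw [dist_comm z (V.p₂ j + y), h5] at h4
      linarith

lemma setup (V : VortexData) (τ : ℝ) (hτ : 0 < τ)
    (ε : ℕ → ℝ) (hε : ∀ n, 0 < ε n) (hε0 : Tendsto ε atTop (nhds 0))
    (u : ℕ → Pl → ℝ) (hu : ∀ n, IsSolution V τ (ε n) (u n))
    (hstab : ∀ n, Stable τ (ε n) (u n))
    (hupper : ∀ r > 0, ∃ c > 0, ∀ n : ℕ, ∀ x : Pl, (∀ y ∈ V.Z2, r ≤ dist x y) →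
        u n x - 2 * Real.log (ε n) < c)
    (β : Fin V.d₂ → ℝ)
    (hcase : (∃ w : Pl → ℝ, Case1 V τ ε u β w) ∨
             (∃ x₀ : Pl, ∃ g : Pl → ℝ, Case2 V u β x₀ g))
    (j : Fin V.d₂) (r₀ : ℝ) (hr₀ : 0 < r₀)
    (hiso : closedBall (V.p₂ j) r₀ ∩ V.Z = {V.p₂ j})
    (hsph : ∀ η > 0, Tendsto
        (fun n => sSup ((fun x => u n (V.p₂ j + ε n • (x - V.p₂ j))) '' sphere (V.p₂ j) η))
        atTop atBot) : 
    ∃ (S : ℕ → Pl → ℝ) (B : ℝ), 0 ≤ B ∧ (∀ n, ContDiff ℝ (⊤ : ℕ∞) (S n)) ∧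
     (∀ n y, y ≠ 0 → ‖y‖ ≤ r₀ / 2 → UU (V.m₂ j) (S n) y = u n (V.p₂ j + y)) ∧
     (∀ n y, y ≠ 0 → ‖y‖ < r₀ / 2 → lap (S n) y + ((ε n) ^ 2)⁻¹ * fτ τ (UU (V.m₂ j) (S n) y) = 0) ∧
     (∀ n φ r, ContDiff ℝ (⊤ : ℕ∞) φ → r ≤ 1 / 4 → r ≤ r₀ / 2 → (∀ y, r < ‖y‖ → φ y = 0) → 
        0 ≤ ∫ y, (gradSq φ y - ((ε n) ^ 2)⁻¹ * fτ' τ (UU (V.m₂ j) (S n) y) * (φ y) ^ 2)) ∧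
     (∀ a R, 0 < a → R < r₀ / 2 → R ≤ 1 → ∀ᶠ n in atTop, ∀ y, a ≤ ‖y‖ → ‖y‖ ≤ R → 
        (∀ i, |pd (S n) i y - 2 * (V.m₂ j + β j) * (y i / ‖y‖ ^ 2)| ≤ B) ∧ 
          ((ε n) ^ 2)⁻¹ * fτ τ (UU (V.m₂ j) (S n) y) ≤ B ∧ UU (V.m₂ j) (S n) y ≤ -1) ∧
     (∀ η > 0, ∀ R > 0, R < r₀ / 2 → ∀ᶠ n in atTop, ∀ y, ε n * η ≤ ‖y‖ → ‖y‖ ≤ R → UU (V.m₂ j) (S n) y ≤ 0) := by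
  have hr1 : r₀ / 2 < r₀ := by linarith
  have hr1' : 0 < r₀ / 2 := by linarith
  have hsub := iso_sub hiso
  have hloc : ∀ n, ∃ S : Pl → ℝ, ContDiff ℝ (⊤ : ℕ∞) S ∧ ∀ y, y ≠ 0 → ‖y‖ ≤ r₀ / 2 → UU (V.m₂ j) S y = u n (V.p₂ j + y) := 
    fun n => local_V ((hu n).smooth.mono hsub) ((hu n).sing₂ j) hr1' hr1
  choose S hS hSu using hloc
  obtain ⟨cn, W, hconv, hW, hWs⟩ := unify V τ ε u β hcase j
  obtain ⟨Om, hOm, hOmW⟩ := local_V (m := -(β j)) (hW.mono hsub) (by simpa using hWs) hr1' hr1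
  have nbhd : ∀ y : Pl, y ≠ 0 → ‖y‖ < r₀ / 2 → ∀ᶠ z in 𝓝 y, z ≠ 0 ∧ ‖z‖ ≤ r₀ / 2 := by
    intro y hy hy1
    filter_upwards [isOpen_compl_singleton.mem_nhds (show y ∈ ({0} : Set Pl)ᶜ from hy), (isOpen_lt continuous_norm continuous_const).mem_nhds hy1] with z h1 h2
    exact ⟨h1, le_of_lt h2⟩
  have Seq : ∀ n y, y ≠ 0 → ‖y‖ < r₀ / 2 → UU (V.m₂ j) (S n) =ᶠ[𝓝 y] fun z => u n (V.p₂ j + z) := by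
    intro n y hy hy1
    filter_upwards [nbhd y hy hy1] with z hz
    exact hSu n z hz.1 hz.2
  have Weq : ∀ y, y ≠ 0 → ‖y‖ < r₀ / 2 → UU (-(β j)) Om =ᶠ[𝓝 y] fun z => W (V.p₂ j + z) := by
    intro y hy hy1
    filter_upwards [nbhd y hy hy1] with z hz
    exact hOmW z hz.1 hz.2
  have lapS : ∀ n y, y ≠ 0 → ‖y‖ < r₀ / 2 → lap (S n) y = lap (u n) (V.p₂ j + y) := by
    intro n y hy hy1
    rw [← lap_UU (V.m₂ j) (hS n) hy, lap_congr (Seq n y hy hy1), lap_translate]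
  have lapW : ∀ y, y ≠ 0 → ‖y‖ < r₀ / 2 → lap Om y = lap W (V.p₂ j + y) := by
    intro y hy hy1
    rw [← lap_UU (-(β j)) hOm hy, lap_congr (Weq y hy hy1), lap_translate]
  have hpde : ∀ n y, y ≠ 0 → ‖y‖ < r₀ / 2 → lap (S n) y + ((ε n) ^ 2)⁻¹ * fτ τ (UU (V.m₂ j) (S n) y) = 0 := by
    intro n y hy hy1
    rw [lapS n y hy hy1, hSu n y hy hy1.le]
    exact (hu n).pde _ (iso_notMem hiso hy (by linarith))
  have hc : ∀ i, Continuous (pd Om i) := fun i => sm_cont (smooth_pd hOm i)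
  have hl : Continuous (lap Om) := by
    have h0 := sm_cont (smooth_pd (smooth_pd hOm 0) 0)
    have h1 := sm_cont (smooth_pd (smooth_pd hOm 1) 1)
    exact h0.add h1
  obtain ⟨B0, hB0⟩ := (isCompact_closedBall (0:Pl) 1).exists_bound_of_continuousOn (hc 0).continuousOn
  obtain ⟨B1, hB1⟩ := (isCompact_closedBall (0:Pl) 1).exists_bound_of_continuousOn (hc 1).continuousOn
  obtain ⟨B2, hB2⟩ := (isCompact_closedBall (0:Pl) 1).exists_bound_of_continuousOn hl.continuousOn
  have p0 : 0 ≤ B0 := (norm_nonneg _).trans (hB0 0 (by simp))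
  have p1 : 0 ≤ B1 := (norm_nonneg _).trans (hB1 0 (by simp))
  have p2 : 0 ≤ B2 := (norm_nonneg _).trans (hB2 0 (by simp))
  have hupl := fun {δ r : ℝ} (hδ : 0 < δ) (hr : r < r₀) (M : ℝ) => up_lemma V ε hε hε0 u hupper j r₀ hiso hδ hr M
  refine ⟨S, B0 + B1 + B2 + 2, by linarith, hS, hSu, hpde, ?_, ?_, ?_⟩
  · intro n φ r hφ hr hr2 hz
    have h := stab_local (hstab n) (hu n).periodic (V.p₂ j) hr hφ hz
    refine h.trans (le_of_eq ?_)
    refine integral_congr_ae ?_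
    filter_upwards [ae_ne_zero_pl] with y hy
    by_cases hy1 : ‖y‖ ≤ r
    · rw [hSu n y hy (hy1.trans hr2)]
    · rw [hz y (not_le.1 hy1)]; simp
  · intro a R ha hR hR1
    have hK : IsCompact ((fun y => V.p₂ j + y) '' (closedBall (0:Pl) R ∩ {y | a ≤ ‖y‖})) := 
      ((isCompact_closedBall 0 R).inter_right (isClosed_le continuous_const continuous_norm)).image (by fun_prop)
    have hKs : ((fun y => V.p₂ j + y) '' (closedBall (0:Pl) R ∩ {y | a ≤ ‖y‖})) ⊆ (V.Z2)ᶜ := by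
      rintro _ ⟨y, ⟨h1, h2⟩, rfl⟩ h3
      have hy : y ≠ 0 := norm_pos_iff.1 (lt_of_lt_of_le ha h2)
      rw [mem_closedBall_zero_iff] at h1
      exact iso_notMem hiso hy (by linarith) (Or.inr h3)
    filter_upwards [hconv.unif hK hKs, hupl ha (show R < r₀ by linarith) (-1)] with n hn hn2 y hy1 hy2
    have hy : y ≠ 0 := norm_pos_iff.1 (lt_of_lt_of_le ha hy1)
    have hyr : ‖y‖ < r₀ / 2 := by linarith
    have hyb : y ∈ closedBall (0:Pl) 1 := by rw [mem_closedBall_zero_iff]; linarith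
    obtain ⟨q1, q2⟩ := hn (V.p₂ j + y) ⟨y, ⟨by simpa using hy2, hy1⟩, rfl⟩
    have q2' : |lap (u n) (V.p₂ j + y) - lap W (V.p₂ j + y)| ≤ 2 := by
      simpa only [lap, pd_sub_const] using q2
    rw [← lapS n y hy hyr, ← lapW y hy hyr] at q2'
    have l2 := abs_le.1 (hB2 y hyb)
    refine ⟨?_, ?_, ?_⟩
    · intro i
      have q := q1 i
      simp only [pd_sub_const] at q
      have s1 : pd (u n) i (V.p₂ j + y) = -2 * V.m₂ j * (y i / ‖y‖ ^ 2) + pd (S n) i y := by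
        rw [← pd_UU (V.m₂ j) (hS n) hy, pd_congr (Seq n y hy hyr), pd_translate]
      have s2 : pd W i (V.p₂ j + y) = -2 * (-(β j)) * (y i / ‖y‖ ^ 2) + pd Om i y := by
        rw [← pd_UU (-(β j)) hOm hy, pd_congr (Weq y hy hyr), pd_translate]
      rw [s1, s2] at q
      have hbi : |pd Om i y| ≤ B0 + B1 := by
        fin_cases i
        · have := hB0 y hyb
          rw [Real.norm_eq_abs] at this
          show |pd Om 0 y| ≤ _
          linarith
        · have := hB1 y hyb
          rw [Real.norm_eq_abs] at this
          show |pd Om 1 y| ≤ _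
          linarith
      have q' := abs_le.1 q
      have hbi' := abs_le.1 hbi
      rw [abs_le]
      constructor <;> linarith [q'.1, q'.2, hbi'.1, hbi'.2]
    · have := hpde n y hy hyr
      have := (abs_le.1 q2').1
      linarith [l2.1]
    · rw [hSu n y hy hyr.le]
      exact hn2 y hy1 hy2
  · intro η hη R hR hR2
    have hεη : ∀ᶠ n in atTop, ε n * η < r₀ / 2 := by
      have : Tendsto (fun n => ε n * η) atTop (𝓝 (0 * η)) := hε0.mul_const η
      rw [zero_mul] at this
      exact this.eventually_lt_const hr1'
    filter_upwards [hεη, hupl hR (show R < r₀ by linarith) 0, (hsph η hη).eventually_le_atBot 0] with n h1 h2 h3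
    refine max_princ hτ (hε n) (hS n) (hpde n) (mul_pos (hε n) hη) hR2 ?_ ?_
    · intro y hy
      have hy0 : y ≠ 0 := norm_pos_iff.1 (by rw [hy]; exact mul_pos (hε n) hη)
      rw [hSu n y hy0 (by rw [hy]; exact h1.le)]
      refine le_trans (le_csSup ?_ ?_) h3
      · refine IsCompact.bddAbove ?_
        refine (isCompact_sphere (V.p₂ j) η).image_of_continuousOn ?_
        refine ContinuousOn.comp (t := (ball (V.p₂ j) r₀ \ {V.p₂ j})) (g := u n) ((hu n).smooth.mono hsub).continuousOn (by fun_prop) ?_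
        intro x hx
        rw [mem_sphere, dist_eq_norm] at hx
        have hn : ‖ε n • (x - V.p₂ j)‖ = ε n * η := by
          rw [norm_smul, Real.norm_eq_abs, abs_of_pos (hε n), hx]
        refine ⟨?_, ?_⟩
        · rw [mem_ball, dist_eq_norm, add_sub_cancel_left, hn]
          linarith
        · intro h
          have h' : ε n • (x - V.p₂ j) = 0 := by simpa using h
          rw [h', norm_zero] at hn
          have := mul_pos (hε n) hη
          linarith
      · refine ⟨V.p₂ j + (ε n)⁻¹ • y, ?_, ?_⟩
        · rw [mem_sphere, dist_eq_norm, add_sub_cancel_left, norm_smul, hy, norm_inv, Real.norm_eq_abs, abs_of_pos (hε n)]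
          have := (hε n).ne'
          field_simp
        · simp only [add_sub_cancel_left]
          rw [smul_smul, mul_inv_cancel₀ (hε n).ne', one_smul]
    · intro y hy
      have hy0 : y ≠ 0 := norm_pos_iff.1 (by rw [hy]; exact hR)
      rw [hSu n y hy0 (by rw [hy]; exact hR2.le)]
      exact h2 y hy.ge hy.le

/-- **Lemma 4.5.** Let `u_ε` be stable solutions of `(E_ε)` with
`u_ε − 2 ln ε` bounded above away from `Z₂`, in either Case 1 or Case 2 of the limit
behavior, and suppose that for `p = p_{j,2}` and `û_ε(x) = u_ε(p + ε(x−p))` one has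
`sup_{|x−p|=η} û_ε → −∞` for every `η > 0`. Then
`sup_{η ≤ |x−p| ≤ r/ε} û_ε → −∞` for all small `η, r > 0`, and `m_{j,2} + β_{j,2} = 0`. -/
theorem annulus_blow_down_and_mass
    (V : VortexData) (τ : ℝ) (hτ : 0 < τ)
    (ε : ℕ → ℝ) (hε : ∀ n, 0 < ε n) (hε0 : Tendsto ε atTop (nhds 0))
    (u : ℕ → Pl → ℝ) (hu : ∀ n, IsSolution V τ (ε n) (u n))
    (hstab : ∀ n, Stable τ (ε n) (u n))
    (hupper : ∀ r > 0, ∃ c > 0, ∀ n : ℕ, ∀ x : Pl, (∀ y ∈ V.Z2, r ≤ dist x y) →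
        u n x - 2 * Real.log (ε n) < c)
    (β : Fin V.d₂ → ℝ)
    (hcase : (∃ w : Pl → ℝ, Case1 V τ ε u β w) ∨
             (∃ x₀ : Pl, ∃ g : Pl → ℝ, Case2 V u β x₀ g))
    (j : Fin V.d₂) (r₀ : ℝ) (hr₀ : 0 < r₀)
    (hiso : closedBall (V.p₂ j) r₀ ∩ V.Z = {V.p₂ j})
    (hsph : ∀ η > 0, Tendsto
        (fun n => sSup ((fun x => u n (V.p₂ j + ε n • (x - V.p₂ j))) '' sphere (V.p₂ j) η))
        atTop atBot) :
    (∀ η > 0, ∀ r ∈ Ioo (0:ℝ) r₀, Tendsto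
        (fun n => sSup ((fun x => u n (V.p₂ j + ε n • (x - V.p₂ j))) ''
          {x : Pl | η ≤ dist x (V.p₂ j) ∧ dist x (V.p₂ j) ≤ r / ε n}))
        atTop atBot) ∧
    V.m₂ j + β j = 0 := by
  obtain ⟨S, B, hB, hS, hSu, hpde, hst, hcol, hneg⟩ := setup V τ hτ ε hε hε0 u hu hstab hupper β hcase j r₀ hr₀ hiso hsph
  obtain ⟨C, hC, hcore⟩ := core hτ (V.m₂ j) (β j) B hB
  have main : ∀ δ η : ℝ, 0 < δ → δ ≤ 1 / 4 → δ < r₀ / 2 → 0 < η → η ^ 2 ≤ δ → ∀ᶠ n in atTop,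
      (((ε n) ^ 2)⁻¹ * ∫ y in {y : Pl | ε n * η ≤ ‖y‖ ∧ ‖y‖ ≤ δ * exp (-(1 / δ))}, exp (UU (V.m₂ j) (S n) y) ≤ C * (3 * δ)) ∧
        |V.m₂ j + β j| ≤ C * (3 * δ) := by
    intro δ η hδ hδ4 hδr hη hηδ
    have ha : 0 < δ * exp (-(1 / δ)) := by positivity
    have hR : δ * exp (-(1 / δ)) * exp (1 / δ) = δ := by
      rw [mul_assoc, ← Real.exp_add, neg_add_cancel, Real.exp_zero, mul_one]
    have hL : 1 ≤ 1 / δ := by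
      rw [le_div_iff₀ hδ]; linarith
    filter_upwards [hcol _ δ ha hδr (by linarith), hneg η hη δ hδ hδr] with n h1 h2
    have h := hcore (ε n) η (δ * exp (-(1 / δ))) (1 / δ) (r₀ / 2) (S n) (hε n) hη ha hL (by rw [hR]; linarith) (by rw [hR]; exact hδr)
      (hS n) (hpde n) (fun φ hφ hz => hst n φ δ hφ hδ4 hδr.le (by rwa [hR] at hz)) (by rw [hR]; exact h1) (by rw [hR]; exact h2)
    rw [hR, one_div_one_div] at h
    have hle : C * (δ + δ + η ^ 2) ≤ C * (3 * δ) := mul_le_mul_of_nonneg_left (by linarith) hC.le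
    exact ⟨h.1.trans hle, h.2.trans hle⟩
  constructor
  · intro η hη r hr
    rw [tendsto_atBot]
    intro M
    obtain ⟨c, hc, hmv⟩ := mvU hτ
    have hθ : 0 < exp M := exp_pos M
    obtain ⟨σ, hσ, hση, hσ2⟩ : ∃ σ > 0, σ ≤ η / 2 ∧ c * σ ^ 2 ≤ exp M / 2 := by
      refine ⟨min (η / 2) (min 1 (exp M / (2 * c))), by positivity, min_le_left _ _, ?_⟩
      set σ := min (η / 2) (min 1 (exp M / (2 * c)))
      have h0 : 0 < σ := by positivity
      have h1 : σ ≤ 1 := (min_le_right _ _).trans (min_le_left _ _)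
      have h2 : σ ≤ exp M / (2 * c) := (min_le_right _ _).trans (min_le_right _ _)
      rw [le_div_iff₀ (by positivity)] at h2
      have h3 : c * σ ^ 2 ≤ c * σ := mul_le_mul_of_nonneg_left (by nlinarith) hc.le
      linarith
    obtain ⟨δ, hδ, hδ4, hδr, hδ2⟩ : ∃ δ > 0, δ ≤ 1 / 4 ∧ δ < r₀ / 2 ∧ c * ((σ ^ 2)⁻¹ * (C * (3 * δ))) ≤ exp M / 2 := by
      set A := c * ((σ ^ 2)⁻¹ * (C * 3))
      have hA : 0 < A := by positivity
      refine ⟨min (1 / 4) (min (r₀ / 4) (exp M / (2 * A))), by positivity, min_le_left _ _, ?_, ?_⟩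
      · have := (min_le_right (1 / 4) (min (r₀ / 4) (exp M / (2 * A)))).trans (min_le_left _ _)
        linarith
      · have h2 := (min_le_right (1 / 4) (min (r₀ / 4) (exp M / (2 * A)))).trans (min_le_right _ _)
        set δ := min (1 / 4) (min (r₀ / 4) (exp M / (2 * A)))
        rw [le_div_iff₀ (by positivity)] at h2
        have : c * ((σ ^ 2)⁻¹ * (C * (3 * δ))) = A * δ := by simp only [A]; ring
        rw [this]
        linarith
    obtain ⟨η', hη', hηη, hηδ⟩ : ∃ η' > 0, η' ≤ η / 2 ∧ η' ^ 2 ≤ δ := by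
      refine ⟨min (η / 2) δ, by positivity, min_le_left _ _, ?_⟩
      have h1 : min (η / 2) δ ≤ δ := min_le_right _ _
      have h2 : 0 < min (η / 2) δ := by positivity
      nlinarith
    set a := δ * exp (-(1 / δ)) with ha_def
    have ha : 0 < a := by positivity
    have haδ : a ≤ δ := by
      rw [ha_def]
      refine mul_le_of_le_one_right hδ.le ?_
      rw [exp_le_one_iff]
      have : 0 < 1 / δ := by positivity
      linarith
    have t1 : ∀ᶠ n in atTop, ε n * σ < a / 2 := by
      have : Tendsto (fun n => ε n * σ) atTop (𝓝 (0 * σ)) := hε0.mul_const σ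
      rw [zero_mul] at this
      exact this.eventually_lt_const (by positivity)
    have t2 : ∀ᶠ n in atTop, ε n * η < r := by
      have : Tendsto (fun n => ε n * η) atTop (𝓝 (0 * η)) := hε0.mul_const η
      rw [zero_mul] at this
      exact this.eventually_lt_const hr.1
    filter_upwards [main δ η' hδ hδ4 hδr hη' hηδ, hneg η' hη' δ hδ hδr, up_lemma V ε hε hε0 u hupper j r₀ hiso (show 0 < a / 2 by positivity) hr.2 M, t1, t2] with n n1 n2 n3 n4 n5
    have he := hε n
    refine csSup_le ?_ ?_
    · refine Set.Nonempty.image _ ⟨V.p₂ j + η • EuclideanSpace.single 0 (1:ℝ), ?_⟩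
      have hd : dist (V.p₂ j + η • EuclideanSpace.single 0 (1:ℝ)) (V.p₂ j) = η := by
        rw [dist_eq_norm, add_sub_cancel_left, norm_smul]
        simp [abs_of_pos hη]
      rw [mem_setOf_eq, hd]
      refine ⟨le_rfl, ?_⟩
      rw [le_div_iff₀ he]
      linarith
    · rintro _ ⟨x, ⟨hx1, hx2⟩, rfl⟩
      rw [dist_eq_norm] at hx1 hx2
      show u n (V.p₂ j + ε n • (x - V.p₂ j)) ≤ M
      have hny : ‖ε n • (x - V.p₂ j)‖ = ε n * ‖x - V.p₂ j‖ := by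
        rw [norm_smul, Real.norm_eq_abs, abs_of_pos he]
      have hy1 : ε n * η ≤ ‖ε n • (x - V.p₂ j)‖ := by
        rw [hny]; exact mul_le_mul_of_nonneg_left hx1 he.le
      have hy2 : ‖ε n • (x - V.p₂ j)‖ ≤ r := by
        rw [hny]
        rw [le_div_iff₀ he] at hx2
        linarith
      generalize ε n • (x - V.p₂ j) = y at hy1 hy2
      by_cases hya : a / 2 ≤ ‖y‖
      · exact n3 y hya hy2
      · have hya' := not_le.1 hya
        have hεη : 0 < ε n * η := mul_pos he hη
        have hy0 : y ≠ 0 := norm_pos_iff.1 (hεη.trans_le hy1)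
        rw [← hSu n y hy0 (by linarith)]
        have hεσ : ε n * σ ≤ ε n * η / 2 := by
          have := mul_le_mul_of_nonneg_left hση he.le
          linarith
        have hεη' : ε n * η' ≤ ε n * η / 2 := by
          have := mul_le_mul_of_nonneg_left hηη he.le
          linarith
        have hsub : closedBall y (ε n * σ) ⊆ {z : Pl | ε n * η' ≤ ‖z‖ ∧ ‖z‖ ≤ a} := by
          intro z hz
          rw [mem_closedBall, dist_eq_norm] at hz
          have q1 : ‖y‖ ≤ ‖z‖ + ‖z - y‖ := by
            have := norm_sub_le z (z - y)
            simpa using this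
          have q2 : ‖z‖ ≤ ‖y‖ + ‖z - y‖ := by
            have := norm_add_le y (z - y)
            simpa using this
          exact ⟨by linarith, by linarith⟩
        have hb := hmv (V.m₂ j) (ε n) (r₀ / 2) (ε n * σ) (S n) y he (hS n) (hpde n) (mul_pos he hσ) (by linarith) (by linarith) ?_
        · have hmeas : MeasurableSet {z : Pl | ε n * η' ≤ ‖z‖ ∧ ‖z‖ ≤ a} := 
            (measurableSet_le measurable_const measurable_norm).inter (measurableSet_le measurable_norm measurable_const)
          have hcpt : IsCompact (closedBall (0:Pl) a ∩ {z : Pl | ε n * η' ≤ ‖z‖}) := 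
            (isCompact_closedBall 0 a).inter_right (isClosed_le continuous_const continuous_norm)
          have hintE : IntegrableOn (fun z => exp (UU (V.m₂ j) (S n) z)) {z : Pl | ε n * η' ≤ ‖z‖ ∧ ‖z‖ ≤ a} := by
            refine IntegrableOn.mono_set (ContinuousOn.integrableOn_compact hcpt ?_) (fun z hz => ⟨by simpa using hz.2, hz.1⟩)
            refine ContinuousOn.rexp ((UU_contOn (V.m₂ j) (hS n)).mono ?_)
            rintro z ⟨_, hz⟩ h0
            rw [mem_singleton_iff] at h0
            rw [mem_setOf_eq, h0, norm_zero] at hz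
            have := mul_pos he hη'
            linarith
          have hmono : ∫ z in closedBall y (ε n * σ), exp (UU (V.m₂ j) (S n) z) ≤ ∫ z in {z : Pl | ε n * η' ≤ ‖z‖ ∧ ‖z‖ ≤ a}, exp (UU (V.m₂ j) (S n) z) := 
            setIntegral_mono_set hintE (Eventually.of_forall fun z => (exp_pos _).le) (Eventually.of_forall hsub)
          have e1 : (((ε n) * σ) ^ 2)⁻¹ * ∫ z in closedBall y (ε n * σ), exp (UU (V.m₂ j) (S n) z) ≤ (σ ^ 2)⁻¹ * (C * (3 * δ)) := by
            rw [mul_pow, mul_inv, mul_comm (((ε n) ^ 2)⁻¹), mul_assoc]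
            refine mul_le_mul_of_nonneg_left ?_ (by positivity)
            refine le_trans ?_ n1.1
            exact mul_le_mul_of_nonneg_left hmono (by positivity)
          have e2 : ((ε n) ^ 2)⁻¹ * ((ε n) * σ) ^ 2 = σ ^ 2 := by
            have := he.ne'
            field_simp
          rw [e2] at hb
          have e3 := mul_le_mul_of_nonneg_left e1 hc.le
          have e4 : exp (UU (V.m₂ j) (S n) y) ≤ exp M := by linarith
          exact exp_le_exp.1 e4
        · intro z hz
          have := hsub hz
          exact n2 z this.1 (this.2.trans haδ)
  · by_contra hne
    have hpos : 0 < |V.m₂ j + β j| := abs_pos.2 hne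
    set A := |V.m₂ j + β j|
    set δ := min (1 / 4) (min (r₀ / 4) (A / (6 * C)))
    have hδ : 0 < δ := by positivity
    have d1 : δ ≤ 1 / 4 := min_le_left _ _
    have d2 : δ ≤ r₀ / 4 := (min_le_right _ _).trans (min_le_left _ _)
    have d3 : δ ≤ A / (6 * C) := (min_le_right _ _).trans (min_le_right _ _)
    rw [le_div_iff₀ (by positivity)] at d3
    obtain ⟨n, hn⟩ := (main δ δ hδ d1 (by linarith) hδ (by nlinarith)).exists
    linarith [hn.2]
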